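/- For every natural number N there exist N central division algebras D₁,…,D_N of degree 3 over ℚ (i.e., division rings that are 9-dimensional central simple ℚ-algebras) that are pairwise non-isomorphic as ℚ-algebras, yet have the same maximal subfields: for every field extension F/ℚ of degree 3 and all indices i, j, there exists a ℚ-algebra embedding F → D_i if and only if there exists a ℚ-algebra embedding F → D_j. -/

import Mathlib

/-- A bundled central division algebra of degree `n` over `K`. -/
structure CentralDivAlg (K : Type) [Field K] (n : ℕ) : Type 1 where
  carrier : Type
  [divisionRing : DivisionRing carrier]
  [algebra : Algebra K carrier]
  [findim : FiniteDimensional K carrier]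
  central : Subalgebra.center K carrier = ⊥
  degree_eq : Module.finrank K carrier = n ^ 2

attribute [instance] CentralDivAlg.divisionRing CentralDivAlg.algebra CentralDivAlg.findim


namespace HN
open NumberField NumberField.InfinitePlace NumberField.mixedEmbedding NumberField.Units
  NumberField.Units.dirichletUnitTheorem Module

/-- tent function -/
noncomputable def tent (x : ℝ) : ℝ := max 0 (1 - |x|)

lemma tent_nonneg (x : ℝ) : 0 ≤ tent x := le_max_left _ _
lemma tent_le_one (x : ℝ) : tent x ≤ 1 := max_le zero_le_one (by linarith [abs_nonneg x])
lemma tent_lip (x y : ℝ) : |tent x - tent y| ≤ |x - y| := by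
  unfold tent
  rw [max_comm, max_comm 0]
  refine (abs_max_sub_max_le_abs (1 - |x|) (1 - |y|) 0).trans ?_
  have := abs_abs_sub_abs_le x y
  rw [show 1 - |x| - (1 - |y|) = -(|x| - |y|) by ring, abs_neg]; exact this

lemma tent_eq_zero {x : ℝ} (h : 1 ≤ |x|) : tent x = 0 := max_eq_left (by linarith)
lemma abs_lt_of_tent_ne {x : ℝ} (h : tent x ≠ 0) : |x| < 1 := by
  by_contra hh; exact h (tent_eq_zero (not_lt.mp hh))

/-- partition of unity -/
lemma tent_sum (t : ℝ) : ∃ k₀ : ℤ, (∀ k : ℤ, k ∉ ({k₀, k₀ + 1} : Finset ℤ) → tent (t + k) = 0) ∧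
    ∑ k ∈ ({k₀, k₀ + 1} : Finset ℤ), tent (t + k) = 1 := by
  refine ⟨-⌊t⌋ - 1, ?_, ?_⟩
  · intro k hk
    simp only [Finset.mem_insert, Finset.mem_singleton, not_or] at hk
    apply tent_eq_zero
    have h1 := Int.floor_le t
    have h2 := Int.lt_floor_add_one t
    rcases lt_or_ge k (-⌊t⌋ - 1) with h | h
    · have h3 : k ≤ -⌊t⌋ - 2 := by omega
      have h4 : (k : ℝ) ≤ -⌊t⌋ - 2 := by exact_mod_cast h3
      rw [abs_of_neg (by linarith)]; linarith
    · have h3 : -⌊t⌋ + 1 ≤ k := by omega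
      have h4 : -(⌊t⌋ : ℝ) + 1 ≤ k := by exact_mod_cast h3
      rw [abs_of_pos (by linarith)]; linarith
  · rw [Finset.sum_pair (by omega)]
    have h1 := Int.floor_le t
    have h2 := Int.lt_floor_add_one t
    push_cast
    unfold tent
    rw [abs_of_nonpos (by linarith), abs_of_nonneg (by linarith), max_eq_right (by linarith),
      max_eq_right (by linarith)]
    ring

lemma tent_hasSum_pi {ι : Type*} [Fintype ι] (t : ι → ℝ) :
    HasSum (fun k : ι → ℤ => ∏ i, tent (t i + k i)) 1 := by
  classical
  choose k₀ h0 h1 using fun i => tent_sum (t i)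
  have := hasSum_sum_of_ne_finset_zero (L := .unconditional _)
    (f := fun k : ι → ℤ => ∏ i, tent (t i + k i))
    (s := Fintype.piFinset fun i => ({k₀ i, k₀ i + 1} : Finset ℤ)) ?_
  · have h2 := Finset.prod_univ_sum (fun i => ({k₀ i, k₀ i + 1} : Finset ℤ))
      (fun i (k : ℤ) => tent (t i + k))
    rw [← h2] at this
    simpa only [h1, Finset.prod_const_one] using this
  · intro k hk
    rw [Fintype.mem_piFinset, not_forall] at hk
    obtain ⟨i, hi⟩ := hk
    exact Finset.prod_eq_zero (Finset.mem_univ i) (h0 i _ hi)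

variable (K : Type*) [Field K] [NumberField K]

open scoped Classical in
/-- coordinates of the log map on the unit lattice basis -/
noncomputable def lb : Basis (Fin (Units.rank K)) ℝ (logSpace K) :=
  (basisUnitLattice K).ofZLatticeBasis ℝ (unitLattice K)

lemma lb_apply (j) : ((basisUnitLattice K j : unitLattice K) : logSpace K) = lb K j := by
  classical
  exact ((basisUnitLattice K).ofZLatticeBasis_apply ℝ (unitLattice K) j).symm

variable {K}
/-- cutoff -/
noncomputable def phi (x : mixedSpace K) : ℝ := ∏ i, tent ((lb K).repr (logMap x) i)

lemma phi_nonneg (x : mixedSpace K) : 0 ≤ phi x := Finset.prod_nonneg fun _ _ => tent_nonneg _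
lemma phi_le_one (x : mixedSpace K) : phi x ≤ 1 :=
  Finset.prod_le_one (fun _ _ => tent_nonneg _) fun _ _ => tent_le_one _

lemma lb_repr_unit (e : Fin (Units.rank K) → ℤ) (ζ : torsion K) (i) :
    (lb K).repr (logEmbedding K (Additive.ofMul ((ζ : (𝓞 K)ˣ) * ∏ i, (fundSystem K i) ^ (e i)))) i
      = e i := by
  classical
  have h1 : logEmbedding K (Additive.ofMul (ζ : (𝓞 K)ˣ)) = 0 :=
    logEmbedding_eq_zero_iff.mpr ζ.2
  rw [ofMul_mul, map_add, h1, zero_add, ofMul_prod, map_sum]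
  simp_rw [ofMul_zpow, map_zsmul, logEmbedding_fundSystem]
  simp_rw [lb_apply, map_sum, map_zsmul, Basis.repr_self]
  simp [Finsupp.single_apply]

lemma phi_hasSum_unit (x : mixedSpace K) (hx : mixedEmbedding.norm x ≠ 0) :
    HasSum (fun u : (𝓞 K)ˣ => phi (u • x)) (torsionOrder K) := by
  classical
  let e : (torsion K × (Fin (Units.rank K) → ℤ)) ≃ (𝓞 K)ˣ := Equiv.ofBijective
    (fun p => (p.1 : (𝓞 K)ˣ) * ∏ i, (fundSystem K i) ^ (p.2 i)) (by
      rw [Function.bijective_iff_existsUnique]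
      intro u
      obtain ⟨p, hp, hu⟩ := exist_unique_eq_mul_prod K u
      exact ⟨p, hp.symm, fun q hq => hu q hq.symm⟩)
  rw [← e.hasSum_iff]
  have key : ∀ p : torsion K × (Fin (Units.rank K) → ℤ), ((fun u : (𝓞 K)ˣ => phi (u • x)) ∘ e) p =
      ∏ i, tent ((lb K).repr (logMap x) i + p.2 i) := by
    rintro ⟨ζ, k⟩
    simp only [Function.comp, phi]
    refine Finset.prod_congr rfl fun i _ => ?_
    rw [logMap_unit_smul _ hx, map_add, Finsupp.add_apply]
    simp only [e, Equiv.ofBijective_apply]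
    rw [lb_repr_unit, add_comm]
  have h2 := tent_hasSum_pi (fun i => (lb K).repr (logMap x) i)
  have h3 : HasSum (fun _ : torsion K => (1 : ℝ)) (torsionOrder K) := by
    have : Fintype (torsion K) := Fintype.ofFinite _
    have := hasSum_fintype (fun _ : torsion K => (1 : ℝ))
    simpa [torsionOrder] using this
  have := h3.mul h2 (by
    apply Summable.mul_of_nonneg h3.summable h2.summable (fun _ => zero_le_one)
    exact fun k => Finset.prod_nonneg fun _ _ => tent_nonneg _)
  rw [mul_one] at this
  refine this.congr_fun ?_
  intro p; rw [key, one_mul]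

end HN


namespace HN
set_option linter.unusedSectionVars false
open NumberField NumberField.InfinitePlace NumberField.mixedEmbedding NumberField.Units
  NumberField.Units.dirichletUnitTheorem Module

variable {K : Type*} [Field K] [NumberField K]

lemma log_norm_eq (x : mixedSpace K) (hx : mixedEmbedding.norm x ≠ 0) :
    Real.log (mixedEmbedding.norm x) = ∑ w, (mult w : ℝ) * Real.log (normAtPlace w x) := by
  rw [mixedEmbedding.norm_apply, Real.log_prod]
  · simp_rw [Real.log_pow]
  · intro w _
    exact pow_ne_zero _ (mixedEmbedding.norm_ne_zero_iff.mp hx w)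

lemma sum_mult_log (x : mixedSpace K) (hx : mixedEmbedding.norm x ≠ 0) :
    ∑ w, (mult w : ℝ) * (Real.log (normAtPlace w x) -
      Real.log (mixedEmbedding.norm x) * (finrank ℚ K : ℝ)⁻¹) = 0 := by
  simp_rw [mul_sub, Finset.sum_sub_distrib, ← Finset.sum_mul]
  rw [← log_norm_eq x hx]
  have : (∑ w : InfinitePlace K, (mult w : ℝ)) = finrank ℚ K := by
    exact_mod_cast InfinitePlace.sum_mult_eq
  rw [this]
  have h : (finrank ℚ K : ℝ) ≠ 0 := by exact_mod_cast (finrank_pos (R := ℚ) (M := K)).ne'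
  field_simp; ring

lemma one_le_mult (w : InfinitePlace K) : (1 : ℝ) ≤ mult w := by
  exact_mod_cast Nat.one_le_iff_ne_zero.mpr mult_ne_zero

variable (K) in
lemma exists_log_bound : ∃ A : ℝ, 0 ≤ A ∧ ∀ x : mixedSpace K, mixedEmbedding.norm x ≠ 0 → phi x ≠ 0 →
    ∀ w, |Real.log (normAtPlace w x) - Real.log (mixedEmbedding.norm x) * (finrank ℚ K : ℝ)⁻¹|
      ≤ A := by
  classical
  let A := ∑ i, ‖lb K i‖
  have hA : 0 ≤ A := Finset.sum_nonneg fun _ _ => norm_nonneg _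
  refine ⟨A * (Fintype.card (InfinitePlace K) + 1), by positivity, fun x hx hp => ?_⟩
  have h1 : ‖logMap x‖ ≤ A := by
    rw [← (lb K).sum_repr (logMap x)]
    refine (norm_sum_le _ _).trans (Finset.sum_le_sum fun i _ => ?_)
    rw [_root_.norm_smul]
    have := (abs_lt_of_tent_ne (Finset.prod_ne_zero_iff.mp hp i (Finset.mem_univ _))).le
    calc _ ≤ 1 * ‖lb K i‖ := by gcongr; exact this
      _ = _ := one_mul _
  have h2 : ∀ w, w ≠ w₀ → |(mult w : ℝ) * (Real.log (normAtPlace w x) -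
      Real.log (mixedEmbedding.norm x) * (finrank ℚ K : ℝ)⁻¹)| ≤ A := by
    intro w hw
    exact (norm_le_pi_norm (logMap x) ⟨w, hw⟩).trans h1
  have h3 : |(mult (w₀ : InfinitePlace K) : ℝ) * (Real.log (normAtPlace w₀ x) -
      Real.log (mixedEmbedding.norm x) * (finrank ℚ K : ℝ)⁻¹)| ≤
        A * (Fintype.card (InfinitePlace K)) := by
    have := sum_mult_log x hx
    rw [← Finset.add_sum_erase _ _ (Finset.mem_univ (w₀ : InfinitePlace K))] at this
    rw [eq_neg_of_add_eq_zero_left this, abs_neg]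
    refine (Finset.abs_sum_le_sum_abs _ _).trans ?_
    calc _ ≤ ∑ w ∈ Finset.univ.erase (w₀ : InfinitePlace K), A :=
          Finset.sum_le_sum fun w hw => h2 w (Finset.ne_of_mem_erase hw)
      _ ≤ ∑ w : InfinitePlace K, A :=
          Finset.sum_le_sum_of_subset_of_nonneg (Finset.erase_subset _ _) (fun _ _ _ => hA)
      _ = _ := by simp [mul_comm]
  intro w
  have h4 : |(mult w : ℝ) * (Real.log (normAtPlace w x) -
      Real.log (mixedEmbedding.norm x) * (finrank ℚ K : ℝ)⁻¹)| ≤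
        A * (Fintype.card (InfinitePlace K) + 1) := by
    by_cases hw : w = w₀
    · subst hw; refine h3.trans ?_; nlinarith
    · refine (h2 w hw).trans ?_
      have : (0 : ℝ) ≤ Fintype.card (InfinitePlace K) := by positivity
      nlinarith
  rw [abs_mul, abs_of_nonneg (by positivity)] at h4
  refine le_trans ?_ h4
  exact le_mul_of_one_le_left (abs_nonneg _) (one_le_mult w)

variable (K) in
open scoped Classical in
lemma exists_support : ∃ c : ℝ, 0 < c ∧ ∀ x : mixedSpace K, mixedEmbedding.norm x ≠ 0 → phi x ≠ 0 →
    ∀ w, c * ‖x‖ ≤ normAtPlace w x := by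
  obtain ⟨A, hA, h⟩ := exists_log_bound K
  refine ⟨Real.exp (-(2 * A)), Real.exp_pos _, fun x hx hp w => ?_⟩
  have hpos : ∀ w, 0 < normAtPlace w x := fun w =>
    lt_of_le_of_ne (normAtPlace_nonneg _ _) (mixedEmbedding.norm_ne_zero_iff.mp hx w).symm
  obtain ⟨w', -, hw'⟩ := Finset.exists_mem_eq_sup' (Finset.univ_nonempty (α := InfinitePlace K))
    (fun w ↦ normAtPlace w x)
  rw [norm_eq_sup'_normAtPlace, hw']
  rw [← Real.exp_log (hpos w), ← Real.exp_log (hpos w'), ← Real.exp_add, Real.exp_le_exp]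
  have h1 := abs_le.mp (h x hx hp w)
  have h2 := abs_le.mp (h x hx hp w')
  linarith [h1.1, h2.2]

/-- smooth cutoff of the norm power -/
noncomputable def gg (s : ℝ) (x : mixedSpace K) : ℝ := phi x * (mixedEmbedding.norm x) ^ (-s)

lemma gg_nonneg (s : ℝ) (x : mixedSpace K) : 0 ≤ gg s x :=
  mul_nonneg (phi_nonneg _) (Real.rpow_nonneg (mixedEmbedding.norm_nonneg _) _)

lemma gg_eq_zero {s : ℝ} (hs : 1 ≤ s) {x : mixedSpace K}
    (h : ¬ (mixedEmbedding.norm x ≠ 0 ∧ phi x ≠ 0)) : gg s x = 0 := by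
  unfold gg
  by_cases h1 : phi x = 0
  · simp [h1]
  · have : mixedEmbedding.norm x = 0 := by by_contra h2; exact h ⟨h2, h1⟩
    rw [this, Real.zero_rpow (by linarith), mul_zero]

lemma norm_ge_pow {r : ℝ} (hr : 0 ≤ r) (x : mixedSpace K) (h : ∀ w, r ≤ normAtPlace w x) :
    r ^ (finrank ℚ K) ≤ mixedEmbedding.norm x := by
  rw [mixedEmbedding.norm_apply, ← InfinitePlace.sum_mult_eq, ← Finset.prod_pow_eq_pow_sum]
  exact Finset.prod_le_prod (fun _ _ => pow_nonneg hr _) fun w _ => pow_le_pow_left₀ hr (h w) _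

lemma abs_log_sub_le {a b m : ℝ} (hm : 0 < m) (ha : m ≤ a) (hb : m ≤ b) :
    |Real.log a - Real.log b| ≤ |a - b| / m := by
  wlog hab : b ≤ a generalizing a b
  · rw [abs_sub_comm, abs_sub_comm a]; exact this hb ha (not_le.mp hab).le
  have hb0 : 0 < b := hm.trans_le hb
  have ha0 : 0 < a := hm.trans_le ha
  rw [abs_of_nonneg (sub_nonneg.mpr (Real.log_le_log hb0 hab)), abs_of_nonneg (sub_nonneg.mpr hab),
    ← Real.log_div ha0.ne' hb0.ne']
  calc _ ≤ a / b - 1 := Real.log_le_sub_one_of_pos (by positivity)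
    _ = (a - b) / b := by field_simp
    _ ≤ _ := div_le_div_of_nonneg_left (by linarith) hm hb

lemma abs_rpow_sub_le {a b m s : ℝ} (hm : 1 ≤ m) (ha : m ≤ a) (hb : m ≤ b) (hs : 1 ≤ s)
    (hs2 : s ≤ 2) : |a ^ (-s) - b ^ (-s)| ≤ m⁻¹ * (2 * |Real.log a - Real.log b|) := by
  wlog hab : b ≤ a generalizing a b
  · rw [abs_sub_comm, abs_sub_comm (Real.log a)]; exact this hb ha (not_le.mp hab).le
  have hb0 : 0 < b := by linarith
  have ha0 : 0 < a := by linarith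
  have h1 : a ^ (-s) ≤ b ^ (-s) := Real.rpow_le_rpow_of_nonpos hb0 hab (by linarith)
  have h0 : 0 ≤ Real.log a - Real.log b := sub_nonneg.mpr (Real.log_le_log hb0 hab)
  rw [abs_sub_comm, abs_of_nonneg (sub_nonneg.mpr h1), abs_of_nonneg h0]
  have h2 : a ^ (-s) = b ^ (-s) * Real.exp (-(s * (Real.log a - Real.log b))) := by
    rw [Real.rpow_def_of_pos ha0, Real.rpow_def_of_pos hb0, ← Real.exp_add]; ring_nf
  have h3 := Real.add_one_le_exp (-(s * (Real.log a - Real.log b)))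
  have h4 : b ^ (-s) ≤ m⁻¹ := by
    calc b ^ (-s) ≤ m ^ (-s) := Real.rpow_le_rpow_of_nonpos (by linarith) hb (by linarith)
      _ ≤ m ^ (-1 : ℝ) := Real.rpow_le_rpow_of_exponent_le hm (by linarith)
      _ = m⁻¹ := Real.rpow_neg_one m
  have h5 : 0 ≤ b ^ (-s) := Real.rpow_nonneg hb0.le _
  calc b ^ (-s) - a ^ (-s) = b ^ (-s) * (1 - Real.exp (-(s * (Real.log a - Real.log b)))) := by
        rw [h2]; ring
    _ ≤ b ^ (-s) * (s * (Real.log a - Real.log b)) := by gcongr; linarith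
    _ ≤ m⁻¹ * (2 * (Real.log a - Real.log b)) := by gcongr

lemma abs_prod_sub_le {ι : Type*} (s : Finset ι) (a b : ι → ℝ) (ha : ∀ i, a i ∈ Set.Icc (0:ℝ) 1)
    (hb : ∀ i, b i ∈ Set.Icc (0:ℝ) 1) :
    |∏ i ∈ s, a i - ∏ i ∈ s, b i| ≤ ∑ i ∈ s, |a i - b i| := by
  classical
  induction s using Finset.induction_on with
  | empty => simp
  | insert i s hi ih =>
    rw [Finset.prod_insert hi, Finset.prod_insert hi, Finset.sum_insert hi]
    have e : a i * ∏ i ∈ s, a i - b i * ∏ i ∈ s, b i =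
      (a i - b i) * ∏ i ∈ s, a i + b i * (∏ i ∈ s, a i - ∏ i ∈ s, b i) := by ring
    rw [e]
    refine (abs_add_le _ _).trans ?_
    rw [abs_mul, abs_mul]
    have h1 : |∏ i ∈ s, a i| ≤ 1 := by
      rw [abs_of_nonneg (Finset.prod_nonneg fun i _ => (ha i).1)]
      exact Finset.prod_le_one (fun i _ => (ha i).1) fun i _ => (ha i).2
    have h2 : |b i| ≤ 1 := by rw [abs_of_nonneg (hb i).1]; exact (hb i).2
    have := abs_nonneg (a i - b i)
    have := abs_nonneg (∏ i ∈ s, a i - ∏ i ∈ s, b i)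
    nlinarith

variable (K) in
open scoped Classical in
lemma exists_lb_bound : ∃ B : ℝ, 0 ≤ B ∧ ∀ (v : logSpace K), ∑ i, |(lb K).repr v i| ≤ B * ‖v‖ := by
  classical
  let T : logSpace K →ₗ[ℝ] (Fin (Units.rank K) → ℝ) := (lb K).equivFun.toLinearMap
  let T' := LinearMap.toContinuousLinearMap T
  refine ⟨Units.rank K * ‖T'‖, by positivity, fun v => ?_⟩
  calc ∑ i, |(lb K).repr v i| ≤ ∑ i : Fin (Units.rank K), ‖T'‖ * ‖v‖ := by
        refine Finset.sum_le_sum fun i _ => ?_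
        exact (norm_le_pi_norm (T' v) i).trans (T'.le_opNorm v)
    _ = _ := by simp; ring

lemma abs_normAtPlace_sub_le (w : InfinitePlace K) (x y : mixedSpace K) :
    |normAtPlace w y - normAtPlace w x| ≤ normAtPlace w (y - x) := by
  have h1 := normAtPlace_add_le w (y - x) x
  rw [sub_add_cancel] at h1
  have h3 := normAtPlace_add_le w (-(y - x)) y
  rw [normAtPlace_neg, neg_sub, sub_add_cancel] at h3
  rw [abs_le]; constructor <;> linarith

open scoped Classical in
lemma normAtPlace_le_norm (w : InfinitePlace K) (x : mixedSpace K) : normAtPlace w x ≤ ‖x‖ := by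
  rw [norm_eq_sup'_normAtPlace]
  exact Finset.le_sup' (fun w => normAtPlace w x) (Finset.mem_univ w)

variable (K) in
open scoped Classical in
lemma exists_diff_bound (Δ : ℝ) (hΔ : 0 ≤ Δ) : ∃ C R : ℝ, 0 ≤ C ∧ 1 ≤ R ∧ ∀ x y : mixedSpace K,
    ‖y - x‖ ≤ Δ → R ≤ ‖x‖ → mixedEmbedding.norm x ≠ 0 → phi x ≠ 0 → ∀ s : ℝ, 1 ≤ s → s ≤ 2 →
    |gg s y - gg s x| ≤ C * ‖x‖⁻¹ ^ (finrank ℚ K + 1) := by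
  obtain ⟨c, hc, hsupp⟩ := exists_support K
  obtain ⟨B, hB, hlb⟩ := exists_lb_bound K
  set n := finrank ℚ K with hn
  have hn0 : (0 : ℝ) < n := by exact_mod_cast (finrank_pos (R := ℚ) (M := K))
  refine ⟨(B * 4 + n * 2) * (2 * Δ / c) * (2 / c) ^ n , max 1 (max (2 * Δ / c) (2 / c)),
    by positivity, le_max_left _ _, fun x y hxy hx hN hp s hs hs2 => ?_⟩
  have hx1 : 1 ≤ ‖x‖ := (le_max_left _ _).trans hx
  have hx2 : 2 * Δ / c ≤ ‖x‖ := ((le_max_left _ _).trans (le_max_right _ _)).trans hx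
  have hx3 : 2 / c ≤ ‖x‖ := ((le_max_right _ _).trans (le_max_right _ _)).trans hx
  rw [div_le_iff₀ hc] at hx2 hx3
  have hm : 0 < c * ‖x‖ / 2 := by positivity
  have hxl : ∀ w, c * ‖x‖ / 2 ≤ normAtPlace w x := fun w => by
    have := hsupp x hN hp w; linarith [mul_nonneg hc.le (norm_nonneg x)]
  have hd : ∀ w, |normAtPlace w y - normAtPlace w x| ≤ Δ := fun w =>
    (abs_normAtPlace_sub_le w x y).trans ((normAtPlace_le_norm w _).trans hxy)
  have hyl : ∀ w, c * ‖x‖ / 2 ≤ normAtPlace w y := fun w => by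
    have h1 := hsupp x hN hp w
    have h2 := (abs_le.mp (hd w)).1
    linarith
  set η := 2 * Δ / c * ‖x‖⁻¹ with hη
  have hη0 : 0 ≤ η := by positivity
  have hlog : ∀ w, |Real.log (normAtPlace w y) - Real.log (normAtPlace w x)| ≤ η := fun w => by
    refine (abs_log_sub_le hm (hyl w) (hxl w)).trans ?_
    calc _ ≤ Δ / (c * ‖x‖ / 2) := by gcongr; exact hd w
      _ = η := by rw [hη]; field_simp
  have hNy : mixedEmbedding.norm y ≠ 0 := mixedEmbedding.norm_ne_zero_iff.mpr fun w =>
    (hm.trans_le (hyl w)).ne'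
  have hsm : (∑ w : InfinitePlace K, (mult w : ℝ)) = n := by
    exact_mod_cast InfinitePlace.sum_mult_eq
  have hlogN : |Real.log (mixedEmbedding.norm y) - Real.log (mixedEmbedding.norm x)| ≤ n * η := by
    rw [log_norm_eq _ hNy, log_norm_eq _ hN, ← Finset.sum_sub_distrib, ← hsm, Finset.sum_mul]
    refine (Finset.abs_sum_le_sum_abs _ _).trans (Finset.sum_le_sum fun w _ => ?_)
    rw [← mul_sub, abs_mul, abs_of_nonneg (by positivity)]
    gcongr; exact hlog w
  have hlm : ‖logMap y - logMap x‖ ≤ 4 * η := by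
    rw [pi_norm_le_iff_of_nonneg (by positivity)]
    intro w
    rw [Pi.sub_apply, logMap_apply, logMap_apply, ← mul_sub, Real.norm_eq_abs, abs_mul,
      abs_of_nonneg (by positivity)]
    have h2 : (mult (w : InfinitePlace K) : ℝ) ≤ 2 := by
      unfold mult; split_ifs <;> norm_num
    have h3 : |Real.log (normAtPlace w y) - Real.log (mixedEmbedding.norm y) * (n : ℝ)⁻¹ -
      (Real.log (normAtPlace w x) - Real.log (mixedEmbedding.norm x) * (n : ℝ)⁻¹)| ≤ 2 * η := by
      have e : Real.log (normAtPlace w y) - Real.log (mixedEmbedding.norm y) * (n : ℝ)⁻¹ -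
        (Real.log (normAtPlace w x) - Real.log (mixedEmbedding.norm x) * (n : ℝ)⁻¹) =
        (Real.log (normAtPlace w y) - Real.log (normAtPlace w x)) -
        (Real.log (mixedEmbedding.norm y) - Real.log (mixedEmbedding.norm x)) * (n : ℝ)⁻¹ := by ring
      rw [e]
      refine (abs_sub _ _).trans ?_
      rw [abs_mul, abs_of_nonneg (inv_nonneg.mpr hn0.le)]
      have h4 : |Real.log (mixedEmbedding.norm y) - Real.log (mixedEmbedding.norm x)| * (n : ℝ)⁻¹
          ≤ η := by
        rw [← div_eq_mul_inv, div_le_iff₀ hn0]; linarith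
      linarith [hlog w]
    calc _ ≤ 2 * (2 * η) := by gcongr
      _ = _ := by ring
  have hphi : |phi y - phi x| ≤ B * (4 * η) := by
    unfold phi
    refine (abs_prod_sub_le _ _ _ (fun i => ⟨tent_nonneg _, tent_le_one _⟩)
      (fun i => ⟨tent_nonneg _, tent_le_one _⟩)).trans ?_
    calc _ ≤ ∑ i, |(lb K).repr (logMap y - logMap x) i| := by
          refine Finset.sum_le_sum fun i _ => (tent_lip _ _).trans ?_
          rw [map_sub, Finsupp.sub_apply]
      _ ≤ B * ‖logMap y - logMap x‖ := hlb _
      _ ≤ _ := by gcongr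
  set m := (c * ‖x‖ / 2) ^ n with hmdef
  have hm1 : 1 ≤ m := one_le_pow₀ (by linarith)
  have hmx : m ≤ mixedEmbedding.norm x := norm_ge_pow hm.le x hxl
  have hmy : m ≤ mixedEmbedding.norm y := norm_ge_pow hm.le y hyl
  have hpow := abs_rpow_sub_le hm1 hmy hmx hs hs2
  have hyp : mixedEmbedding.norm y ^ (-s) ≤ m⁻¹ := by
    calc _ ≤ m ^ (-s) := Real.rpow_le_rpow_of_nonpos (by linarith) hmy (by linarith)
      _ ≤ m ^ (-1 : ℝ) := Real.rpow_le_rpow_of_exponent_le hm1 (by linarith)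
      _ = m⁻¹ := Real.rpow_neg_one m
  have e : gg s y - gg s x = (phi y - phi x) * mixedEmbedding.norm y ^ (-s) +
    phi x * (mixedEmbedding.norm y ^ (-s) - mixedEmbedding.norm x ^ (-s)) := by unfold gg; ring
  have hy0 : 0 ≤ mixedEmbedding.norm y ^ (-s) := Real.rpow_nonneg (mixedEmbedding.norm_nonneg _) _
  calc |gg s y - gg s x| ≤ |phi y - phi x| * mixedEmbedding.norm y ^ (-s) +
        phi x * |mixedEmbedding.norm y ^ (-s) - mixedEmbedding.norm x ^ (-s)| := by
        rw [e]; refine (abs_add_le _ _).trans ?_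
        rw [abs_mul, abs_mul, abs_of_nonneg hy0, abs_of_nonneg (phi_nonneg x)]
    _ ≤ B * (4 * η) * m⁻¹ + 1 * (m⁻¹ * (2 * (n * η))) := by
        gcongr
        · exact phi_le_one x
        · refine hpow.trans ?_
          have : 0 ≤ m⁻¹ := by positivity
          gcongr
    _ = _ := by
        rw [hmdef, hη, pow_succ]
        have h1 : c * ‖x‖ / 2 = ((2 / c) * ‖x‖⁻¹)⁻¹ := by field_simp
        rw [h1, inv_pow, inv_inv, mul_pow]
        ring

end HN


namespace HN
set_option linter.unusedSectionVars false
open NumberField NumberField.InfinitePlace NumberField.mixedEmbedding NumberField.Units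
  NumberField.Units.dirichletUnitTheorem Module

variable {K : Type*} [Field K] [NumberField K]

/-- smooth cutoff on integers -/
noncomputable def GG (s : ℝ) (a : 𝓞 K) : ℝ := gg s (mixedEmbedding K a)

lemma GG_nonneg (s : ℝ) (a : 𝓞 K) : 0 ≤ GG s a := gg_nonneg _ _

lemma norm_int_eq (a : 𝓞 K) :
    mixedEmbedding.norm (mixedEmbedding K (a : K)) = (Ideal.absNorm (Ideal.span {a}) : ℝ) := by
  rw [norm_eq_norm, Ideal.absNorm_span_singleton]
  have : (Algebra.norm ℚ (a : K)) = ((Algebra.norm ℤ a : ℤ) : ℚ) := by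
    rw [← Algebra.coe_norm_int]
  rw [this]
  simp [Nat.cast_natAbs]

lemma GG_zero {s : ℝ} (hs : 1 ≤ s) : GG s (0 : 𝓞 K) = 0 := by
  refine gg_eq_zero hs ?_
  simp

lemma one_le_norm_int {a : 𝓞 K} (ha : a ≠ 0) :
    (1 : ℝ) ≤ (Ideal.absNorm (Ideal.span {a}) : ℝ) := by
  have : Ideal.absNorm (Ideal.span {a}) ≠ 0 := by
    rw [Ne, Ideal.absNorm_eq_zero_iff, Ideal.span_singleton_eq_bot]; exact ha
  exact_mod_cast Nat.one_le_iff_ne_zero.mpr this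

lemma GG_le_one {s : ℝ} (hs : 1 ≤ s) (a : 𝓞 K) : GG s a ≤ 1 := by
  by_cases ha : a = 0
  · rw [ha, GG_zero hs]; exact zero_le_one
  · unfold GG gg
    refine mul_le_one₀ (phi_le_one _) (Real.rpow_nonneg (mixedEmbedding.norm_nonneg _) _) ?_
    rw [norm_int_eq]
    exact Real.rpow_le_one_of_one_le_of_nonpos (one_le_norm_int ha) (by linarith)

lemma GG_hasSum_unit (s : ℝ) {a : 𝓞 K} (ha : a ≠ 0) :
    HasSum (fun u : (𝓞 K)ˣ => GG s ((u : 𝓞 K) * a))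
      (torsionOrder K * (Ideal.absNorm (Ideal.span {a}) : ℝ) ^ (-s)) := by
  have hN : mixedEmbedding.norm (mixedEmbedding K (a : K)) ≠ 0 := by
    rw [norm_int_eq]; linarith [one_le_norm_int ha]
  have := (phi_hasSum_unit _ hN).mul_right ((Ideal.absNorm (Ideal.span {a}) : ℝ) ^ (-s))
  refine this.congr_fun fun u => ?_
  have e : mixedEmbedding K (((u : 𝓞 K) * a : 𝓞 K) : K) = u • mixedEmbedding K (a : K) := by
    rw [unitSMul_smul, ← map_mul]; simp
  unfold GG gg
  rw [e, norm_unit_smul, norm_int_eq]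

/-- integer lattice parametrization -/
noncomputable def intEquiv (K : Type*) [Field K] [NumberField K] :
    𝓞 K ≃ mixedEmbedding.integerLattice K :=
  Equiv.ofBijective (fun a => ⟨mixedEmbedding K a, ⟨a, rfl⟩⟩) (by
    constructor
    · intro a b h
      have := congrArg Subtype.val h
      exact RingOfIntegers.ext ((mixedEmbedding_injective K) this)
    · rintro ⟨_, ⟨a, rfl⟩⟩
      exact ⟨a, rfl⟩)

open scoped Classical in
lemma finrank_intLattice : finrank ℤ (mixedEmbedding.integerLattice K) = finrank ℚ K := by
  rw [ZLattice.rank ℝ, mixedEmbedding.finrank]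

open scoped Classical in
lemma summable_int_rpow (r : ℝ) (hr : r < -(finrank ℚ K : ℝ)) :
    Summable fun a : 𝓞 K => ‖mixedEmbedding K (a : K)‖ ^ r := by
  have h := ZLattice.summable_norm_rpow (mixedEmbedding.integerLattice K) r
    (by rw [finrank_intLattice]; exact hr)
  exact (intEquiv K).summable_iff.mpr h

open scoped Classical in
lemma finite_int_ball (R : ℝ) : {a : 𝓞 K | ‖mixedEmbedding K (a : K)‖ < R}.Finite := by
  have h := (summable_int_rpow (K := K) (-(finrank ℚ K : ℝ) - 1) (by linarith)).tendsto_cofinite_zero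
  by_cases hR : R ≤ 0
  · convert Set.finite_empty
    ext a; simp only [Set.mem_ofPred_eq, Set.mem_empty_iff_false, iff_false, not_lt]
    exact hR.trans (norm_nonneg _)
  push Not at hR
  have h2 : ∀ᶠ a : 𝓞 K in Filter.cofinite,
      ‖mixedEmbedding K (a : K)‖ ^ (-(finrank ℚ K : ℝ) - 1) < R ^ (-(finrank ℚ K : ℝ) - 1) :=
    h.eventually_lt_const (by positivity)
  have h3 := (Filter.eventually_cofinite.mp h2).union (Set.finite_singleton 0)
  refine h3.subset fun a ha => ?_
  by_cases h0 : a = 0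
  · right; exact h0
  left
  simp only [Set.mem_ofPred_eq, not_lt] at ha ⊢
  have : mixedEmbedding K (a : K) ≠ 0 := by
    rw [Ne, map_eq_zero]; simpa using h0
  exact Real.rpow_le_rpow_of_nonpos (norm_pos_iff.mpr this) ha.le (by
    have : (0 : ℝ) ≤ finrank ℚ K := by positivity
    linarith)

lemma GG_summable {s : ℝ} (hs : 1 < s) : Summable fun a : 𝓞 K => GG s a := by
  classical
  obtain ⟨c, hc, hsupp⟩ := exists_support K
  have hn0 : (0 : ℝ) < finrank ℚ K := by exact_mod_cast (finrank_pos (R := ℚ) (M := K))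
  refine Summable.of_nonneg_of_le (fun a => GG_nonneg s a) (fun a => ?_)
    ((summable_int_rpow (K := K) (finrank ℚ K * (-s)) (by nlinarith)).mul_left
      (c ^ (finrank ℚ K * (-s))))
  by_cases h : mixedEmbedding.norm (mixedEmbedding K (a : K)) ≠ 0 ∧ phi (mixedEmbedding K (a : K)) ≠ 0
  · have hx : 0 < ‖mixedEmbedding K (a : K)‖ := by
      rw [norm_pos_iff]; intro h0; exact h.1 (by rw [h0]; simp)
    have h1 := norm_ge_pow (by positivity) _ (hsupp _ h.1 h.2)
    rw [← Real.mul_rpow hc.le hx.le, Real.rpow_mul (by positivity), Real.rpow_natCast]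
    unfold GG gg
    calc _ ≤ 1 * mixedEmbedding.norm (mixedEmbedding K (a : K)) ^ (-s) := by
          gcongr
          · exact Real.rpow_nonneg (mixedEmbedding.norm_nonneg _) _
          · exact phi_le_one _
      _ = mixedEmbedding.norm (mixedEmbedding K (a : K)) ^ (-s) := one_mul _
      _ ≤ _ := Real.rpow_le_rpow_of_nonpos (by positivity) h1 (by linarith)
  · unfold GG; rw [gg_eq_zero hs.le h]; positivity

set_option maxHeartbeats 2000000 in
lemma GG_diff (δ : 𝓞 K) : ∃ D : 𝓞 K → ℝ, Summable D ∧ ∀ s : ℝ, 1 ≤ s → s ≤ 2 → ∀ a,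
    |GG s (a + δ) - GG s a| ≤ D a := by
  classical
  obtain ⟨C, R, hC, hR, h⟩ := exists_diff_bound K ‖mixedEmbedding K (δ : K)‖ (norm_nonneg _)
  set n := finrank ℚ K
  have hs1 : Summable fun a : 𝓞 K => C * ‖mixedEmbedding K (a : K)‖⁻¹ ^ (n + 1) := by
    refine ((summable_int_rpow (K := K) (-((n + 1 : ℕ) : ℝ)) ?_).congr fun a => ?_).mul_left C
    · push_cast; change -((n : ℝ) + 1) < -n; linarith
    · rw [Real.rpow_neg (norm_nonneg _), Real.rpow_natCast, inv_pow]
  have hs2 : Summable fun a : 𝓞 K => C * ‖mixedEmbedding K ((a + δ : 𝓞 K) : K)‖⁻¹ ^ (n + 1) :=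
    (Equiv.addRight δ).summable_iff.mpr hs1
  have hf1 : Summable fun a : 𝓞 K => if ‖mixedEmbedding K (a : K)‖ < R then (1 : ℝ) else 0 := by
    refine summable_of_finite_support ((finite_int_ball (K := K) R).subset fun a ha => ?_)
    simp only [Function.mem_support] at ha
    by_contra h'; exact ha (if_neg h')
  have hf2 : Summable fun a : 𝓞 K =>
      if ‖mixedEmbedding K ((a + δ : 𝓞 K) : K)‖ < R then (1 : ℝ) else 0 :=
    (Equiv.addRight δ).summable_iff.mpr hf1
  refine ⟨_, (hs1.add hs2).add (hf1.add hf2), fun s h1 h2 a => ?_⟩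
  have p1 : 0 ≤ C * ‖mixedEmbedding K (a : K)‖⁻¹ ^ (n + 1) := by positivity
  have p2 : 0 ≤ C * ‖mixedEmbedding K ((a + δ : 𝓞 K) : K)‖⁻¹ ^ (n + 1) := by positivity
  have p3 : (0 : ℝ) ≤ if ‖mixedEmbedding K (a : K)‖ < R then (1 : ℝ) else 0 := by
    split_ifs <;> norm_num
  have p4 : (0 : ℝ) ≤ if ‖mixedEmbedding K ((a + δ : 𝓞 K) : K)‖ < R then (1 : ℝ) else 0 := by
    split_ifs <;> norm_num
  have p5 : |GG s (a + δ) - GG s a| ≤ 1 := by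
    rw [abs_le]
    constructor <;> linarith [GG_nonneg s a, GG_nonneg s (a + δ), GG_le_one h1 a, GG_le_one h1 (a + δ)]
  by_cases c1 : ‖mixedEmbedding K (a : K)‖ < R
  · rw [if_pos c1] at p3 ⊢; linarith
  by_cases c2 : ‖mixedEmbedding K ((a + δ : 𝓞 K) : K)‖ < R
  · rw [if_pos c2] at p4 ⊢; linarith
  push Not at c1 c2
  have e : mixedEmbedding K ((a + δ : 𝓞 K) : K) - mixedEmbedding K (a : K) =
    mixedEmbedding K (δ : K) := by rw [← map_sub]; simp
  by_cases z1 : mixedEmbedding.norm (mixedEmbedding K (a : K)) ≠ 0 ∧ phi (mixedEmbedding K (a : K)) ≠ 0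
  · have := h (mixedEmbedding K (a : K)) (mixedEmbedding K ((a + δ : 𝓞 K) : K)) (by rw [e]) c1
      z1.1 z1.2 s h1 h2
    unfold GG; linarith
  by_cases z2 : mixedEmbedding.norm (mixedEmbedding K ((a + δ : 𝓞 K) : K)) ≠ 0 ∧
      phi (mixedEmbedding K ((a + δ : 𝓞 K) : K)) ≠ 0
  · have := h (mixedEmbedding K ((a + δ : 𝓞 K) : K)) (mixedEmbedding K (a : K))
      (by rw [norm_sub_rev, e]) c2 z2.1 z2.2 s h1 h2
    unfold GG; rw [abs_sub_comm]; linarith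
  · unfold GG
    rw [gg_eq_zero h1 z1, gg_eq_zero h1 z2]
    simp only [sub_zero, abs_zero]; linarith

end HN


namespace HN
set_option linter.unusedSectionVars false
open NumberField NumberField.Units Module

variable {K : Type*} [Field K] [NumberField K]

open scoped Classical in
/-- weight of principal ideals -/
noncomputable def WW (s : ℝ) (I : Ideal (𝓞 K)) : ℝ :=
  if I ≠ ⊥ ∧ I.IsPrincipal then torsionOrder K * (Ideal.absNorm I : ℝ) ^ (-s) else 0

lemma unfold_sum (F : Ideal (𝓞 K) → ℂ) (hF : ∀ I, ‖F I‖ ≤ 1) {s : ℝ} (hs : 1 < s) :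
    HasSum (fun I => F I * (WW s I : ℂ)) (∑' a : 𝓞 K, F (Ideal.span {a}) * (GG s a : ℂ)) := by
  classical
  have hsum : Summable fun a : 𝓞 K => F (Ideal.span {a}) * (GG s a : ℂ) := by
    refine Summable.of_norm_bounded (GG_summable hs) fun a => ?_
    rw [norm_mul, Complex.norm_real, Real.norm_of_nonneg (GG_nonneg s a)]
    exact mul_le_of_le_one_left (GG_nonneg s a) (hF _)
  let e := Equiv.sigmaFiberEquiv (fun a : 𝓞 K => Ideal.span {a})
  have h1 := (e.hasSum_iff (f := fun a : 𝓞 K => F (Ideal.span {a}) * (GG s a : ℂ))).mpr hsum.hasSum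
  refine h1.sigma fun I => ?_
  have hf : ∀ c : {a : 𝓞 K // Ideal.span {a} = I},
      ((fun a : 𝓞 K => F (Ideal.span {a}) * (GG s a : ℂ)) ∘ e) ⟨I, c⟩ = F I * (GG s c.1 : ℂ) := by
    rintro ⟨c, hc⟩
    simp [e, Equiv.sigmaFiberEquiv, hc]
  refine HasSum.congr_fun (f := fun c : {a : 𝓞 K // Ideal.span {a} = I} => F I * (GG s c.1 : ℂ))
    ?_ hf
  refine HasSum.mul_left _ ?_
  rw [Complex.hasSum_ofReal]
  by_cases hI : I ≠ ⊥ ∧ I.IsPrincipal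
  · obtain ⟨hI0, ⟨a, ha⟩⟩ := hI
    change I = Ideal.span {a} at ha
    have ha0 : a ≠ 0 := by rintro rfl; apply hI0; rw [ha]; simp
    unfold WW
    rw [if_pos ⟨hI0, ⟨a, ha⟩⟩, ha]
    let e2 : (𝓞 K)ˣ ≃ {c : 𝓞 K // Ideal.span {c} = Ideal.span {a}} := Equiv.ofBijective
      (fun u => ⟨u * a, by
        rw [Ideal.span_singleton_eq_span_singleton]
        exact associated_unit_mul_left a _ u.isUnit⟩) (by
        constructor
        · intro u v h
          have := congrArg Subtype.val h
          exact Units.ext (mul_right_cancel₀ ha0 this)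
        · rintro ⟨c, hc⟩
          rw [Ideal.span_singleton_eq_span_singleton] at hc
          obtain ⟨u, hu⟩ := hc.symm
          exact ⟨u, Subtype.ext ((mul_comm _ _).trans hu)⟩)
    rw [← e2.hasSum_iff]
    exact GG_hasSum_unit s ha0
  · unfold WW
    rw [if_neg hI]
    have : ∀ c : {a : 𝓞 K // Ideal.span {a} = I}, GG s c.1 = 0 := by
      rintro ⟨c, hc⟩
      by_cases h0 : c = 0
      · subst h0; exact GG_zero hs.le
      · exact absurd ⟨by rw [← hc]; simpa using h0, ⟨c, hc.symm⟩⟩ hI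
    simp_rw [this]
    exact hasSum_zero

/-- A bounded multiplicative function on ideals, periodic mod `m`. -/
structure RayChar (K : Type*) [Field K] [NumberField K] (m : Ideal (𝓞 K)) where
  toFun : Ideal (𝓞 K) →*₀ ℂ
  norm_le : ∀ I, ‖toFun I‖ ≤ 1
  periodic : ∀ b a a' : Ideal (𝓞 K), ∀ x x' : 𝓞 K, b ≠ ⊥ → Ideal.span {x} = b * a →
    Ideal.span {x'} = b * a' → x - x' ∈ m * b → toFun a = toFun a'

variable {m : Ideal (𝓞 K)} (X : RayChar K m)

open scoped Classical in
/-- function on integers -/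
noncomputable def RayChar.quo (b I : Ideal (𝓞 K)) : ℂ :=
  if h : b ∣ I then X.toFun h.choose else 0

lemma RayChar.quo_mul {b a : Ideal (𝓞 K)} (hb : b ≠ ⊥) : X.quo b (b * a) = X.toFun a := by
  classical
  have h : b ∣ b * a := dvd_mul_right _ _
  unfold RayChar.quo
  rw [dif_pos h]
  congr 1
  exact (mul_left_cancel₀ hb h.choose_spec).symm

lemma RayChar.quo_zero {b I : Ideal (𝓞 K)} (h : ¬ b ∣ I) : X.quo b I = 0 := dif_neg h

lemma RayChar.norm_quo_le (b I : Ideal (𝓞 K)) : ‖X.quo b I‖ ≤ 1 := by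
  unfold RayChar.quo
  split_ifs
  · exact X.norm_le _
  · simp

/-- partial sums over a class -/
noncomputable def RayChar.Z (b : Ideal (𝓞 K)) (s : ℝ) : ℂ :=
  ∑' a : 𝓞 K, X.quo b (Ideal.span {a}) * (GG s a : ℂ)

lemma RayChar.Z_hasSum {b : Ideal (𝓞 K)} (hb : b ≠ ⊥) {s : ℝ} (hs : 1 < s) :
    HasSum (fun a => X.toFun a * (WW s (b * a) : ℂ)) (X.Z b s) := by
  have h := unfold_sum (X.quo b) (X.norm_quo_le b) hs
  have hinj : Function.Injective fun a : Ideal (𝓞 K) => b * a := fun a a' h =>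
    mul_left_cancel₀ hb h
  rw [← hinj.hasSum_iff] at h
  · refine h.congr_fun fun a => ?_
    simp only [Function.comp]
    rw [X.quo_mul hb]
  · intro I hI
    rw [X.quo_zero, zero_mul]
    rintro ⟨a, rfl⟩
    exact hI ⟨a, rfl⟩

open scoped nonZeroDivisors

lemma RayChar.L_hasSum (b : ClassGroup (𝓞 K) → (Ideal (𝓞 K))⁰)
    (hb : Function.Bijective fun C => ClassGroup.mk0 (b C)) {s : ℝ} (hs : 1 < s) :
    HasSum (fun a => X.toFun a * (torsionOrder K * (Ideal.absNorm a : ℝ) ^ (-s) : ℝ))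
      (∑ C, ((Ideal.absNorm (b C : Ideal (𝓞 K)) : ℝ) ^ s : ℝ) * X.Z (b C) s) := by
  classical
  have h1 : ∀ C, (b C : Ideal (𝓞 K)) ≠ ⊥ := fun C => nonZeroDivisors.coe_ne_zero (b C)
  have h2 := hasSum_sum (s := Finset.univ) fun C _ => (X.Z_hasSum (h1 C) hs).mul_left
    (((Ideal.absNorm (b C : Ideal (𝓞 K)) : ℝ) ^ s : ℝ) : ℂ)
  refine h2.congr_fun fun a => ?_
  by_cases ha : a = ⊥
  · subst ha
    have : X.toFun ⊥ = 0 := map_zero X.toFun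
    simp [this]
  have ha' : a ∈ (Ideal (𝓞 K))⁰ := mem_nonZeroDivisors_iff_ne_zero.mpr ha
  obtain ⟨C, hC, hu⟩ := hb.existsUnique (ClassGroup.mk0 ⟨a, ha'⟩)⁻¹
  have hpr : ∀ C', (((b C' : Ideal (𝓞 K)) * a) ≠ ⊥ ∧ ((b C' : Ideal (𝓞 K)) * a).IsPrincipal) ↔
      C' = C := by
    intro C'
    have : ((b C' : Ideal (𝓞 K)) * a).IsPrincipal ↔ ClassGroup.mk0 (b C' * ⟨a, ha'⟩) = 1 := by
      rw [ClassGroup.mk0_eq_one_iff]; rfl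
    rw [this, map_mul, mul_eq_one_iff_eq_inv]
    constructor
    · exact fun h => hu C' h.2
    · rintro rfl; exact ⟨mul_ne_zero (h1 _) ha, hC⟩
  rw [Finset.sum_eq_single C]
  · unfold WW
    rw [if_pos ((hpr C).mpr rfl), map_mul]
    have hN : (0 : ℝ) < Ideal.absNorm (b C : Ideal (𝓞 K)) := by
      exact_mod_cast Nat.pos_of_ne_zero (by rw [Ne, Ideal.absNorm_eq_zero_iff]; exact h1 C)
    push_cast [Nat.cast_mul]
    have e : ((Ideal.absNorm (b C : Ideal (𝓞 K)) : ℝ) ^ s) *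
      ((Ideal.absNorm (b C : Ideal (𝓞 K)) : ℝ) * (Ideal.absNorm a : ℝ)) ^ (-s) =
      (Ideal.absNorm a : ℝ) ^ (-s) := by
      rw [Real.mul_rpow hN.le (by positivity), ← mul_assoc, ← Real.rpow_add hN]; simp
    rw [← e]; push_cast; ring
  · intro C' _ hC'
    unfold WW
    rw [if_neg (fun h => hC' ((hpr C').mp h))]; simp
  · simp

end HN


namespace HN
set_option linter.unusedSectionVars false
open NumberField NumberField.Units Module
open scoped nonZeroDivisors

variable {K : Type*} [Field K] [NumberField K]
variable {m : Ideal (𝓞 K)} (X : RayChar K m)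

lemma RayChar.quo_periodic {b : Ideal (𝓞 K)} (hb : b ≠ ⊥) {x y : 𝓞 K} (h : x - y ∈ m * b) :
    X.quo b (Ideal.span {x}) = X.quo b (Ideal.span {y}) := by
  have hxy : x - y ∈ b := (Ideal.mul_le_right : m * b ≤ b) h
  by_cases hx : x ∈ b
  · have hy : y ∈ b := by have := b.sub_mem hx hxy; simpa using this
    obtain ⟨a, ha⟩ := Ideal.dvd_span_singleton.mpr hx
    obtain ⟨a', ha'⟩ := Ideal.dvd_span_singleton.mpr hy
    rw [ha, ha', X.quo_mul hb, X.quo_mul hb]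
    exact X.periodic b a a' x y hb ha ha' h
  · have hy : y ∉ b := fun hy => hx (by have := b.add_mem hxy hy; simpa using this)
    rw [X.quo_zero (by rwa [Ideal.dvd_span_singleton]), X.quo_zero (by rwa [Ideal.dvd_span_singleton])]

/-- coset decomposition of `b` modulo `b*c` with representatives in `m*b`. -/
lemma exists_reps (m b c : Ideal (𝓞 K)) (hb : b ≠ ⊥) (hc : c ≠ ⊥) (hmc : m ⊔ c = ⊤) :
    ∃ (r : Fin (Ideal.absNorm c) → 𝓞 K) (_ : ∀ q, r q ∈ m * b)
      (e : Fin (Ideal.absNorm c) × (b * c : Ideal (𝓞 K)) ≃ b),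
      ∀ p, (e p : 𝓞 K) = (p.2 : 𝓞 K) + r p.1 := by
  let B := b.toAddSubgroup
  let H := (b * c).toAddSubgroup
  have hHB : H ≤ B := fun x hx => (Ideal.mul_le_left : b * c ≤ b) hx
  have hcard : H.relIndex B = Ideal.absNorm c := by
    have h := AddSubgroup.relIndex_mul_index hHB
    rw [← Ideal.absNorm_eq_index, ← Ideal.absNorm_eq_index, map_mul, mul_comm] at h
    exact mul_left_cancel₀ (by rwa [Ne, Ideal.absNorm_eq_zero_iff]) h
  have hc0 : Ideal.absNorm c ≠ 0 := by rwa [Ne, Ideal.absNorm_eq_zero_iff]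
  have hfin : Finite (B ⧸ H.addSubgroupOf B) := by
    apply Nat.finite_of_card_ne_zero
    rw [← AddSubgroup.index]
    change H.relIndex B ≠ 0
    rw [hcard]; exact hc0
  let ε : Fin (Ideal.absNorm c) ≃ (B ⧸ H.addSubgroupOf B) :=
    (Finite.equivFinOfCardEq (by rw [← hcard]; rfl)).symm
  have hrep : ∀ q : B ⧸ H.addSubgroupOf B, ∃ r : B, (r : 𝓞 K) ∈ m * b ∧
      (QuotientAddGroup.mk r : B ⧸ H.addSubgroupOf B) = q := by
    intro q
    obtain ⟨x, rfl⟩ := QuotientAddGroup.mk_surjective q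
    have hx : (x : 𝓞 K) ∈ m * b ⊔ b * c := by
      rw [mul_comm b c, ← Ideal.sup_mul, hmc, Ideal.top_mul]; exact x.2
    obtain ⟨y, hy, z, hz, hyz⟩ := Submodule.mem_sup.mp hx
    refine ⟨⟨y, (Ideal.mul_le_right : m * b ≤ b) hy⟩, hy, ?_⟩
    rw [QuotientAddGroup.eq, AddSubgroup.mem_addSubgroupOf]
    change -y + (x : 𝓞 K) ∈ b * c
    rw [← hyz]; simpa using hz
  choose r hr hr2 using hrep
  refine ⟨fun i => r (ε i), fun i => hr _, Equiv.ofBijective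
    (fun p => ⟨(p.2 : 𝓞 K) + r (ε p.1), b.add_mem (hHB p.2.2) (r (ε p.1)).2⟩) ⟨?_, ?_⟩,
    fun p => rfl⟩
  · rintro ⟨i, h⟩ ⟨j, k⟩ hij
    have h1 : (h : 𝓞 K) + r (ε i) = (k : 𝓞 K) + r (ε j) := congrArg Subtype.val hij
    have h2 : ε i = ε j := by
      rw [← hr2 (ε i), ← hr2 (ε j), QuotientAddGroup.eq, AddSubgroup.mem_addSubgroupOf]
      change -(r (ε i) : 𝓞 K) + (r (ε j) : 𝓞 K) ∈ b * c
      have : -(r (ε i) : 𝓞 K) + (r (ε j) : 𝓞 K) = h - k := by linear_combination -h1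
      rw [this]; exact (b * c).sub_mem h.2 k.2
    have h3 : i = j := ε.injective h2
    subst h3
    have h4 : (h : 𝓞 K) = k := add_right_cancel h1
    rw [Subtype.ext h4]
  · intro x
    let x' : B := ⟨x.1, x.2⟩
    let q : B ⧸ H.addSubgroupOf B := QuotientAddGroup.mk x'
    have h1 : (x : 𝓞 K) - r q ∈ b * c := by
      have := hr2 q
      rw [QuotientAddGroup.eq, AddSubgroup.mem_addSubgroupOf] at this
      change -(r q : 𝓞 K) + (x : 𝓞 K) ∈ b * c at this
      rwa [neg_add_eq_sub] at this
    refine ⟨⟨ε.symm q, ⟨_, h1⟩⟩, Subtype.ext ?_⟩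
    simp

lemma RayChar.summable_quo (b : Ideal (𝓞 K)) {s : ℝ} (hs : 1 < s) :
    Summable fun a : 𝓞 K => X.quo b (Ideal.span {a}) * (GG s a : ℂ) := by
  refine Summable.of_norm_bounded (GG_summable hs) fun a => ?_
  rw [norm_mul, Complex.norm_real, Real.norm_of_nonneg (GG_nonneg s a)]
  exact mul_le_of_le_one_left (GG_nonneg s a) (X.norm_quo_le _ _)

lemma RayChar.Z_shift {b c : Ideal (𝓞 K)} (hb : b ≠ ⊥) (hc : c ≠ ⊥) (hmc : m ⊔ c = ⊤) :
    ∃ M : ℝ, ∀ s : ℝ, 1 < s → s ≤ 2 →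
      ‖X.Z b s - Ideal.absNorm c * X.toFun c * X.Z (b * c) s‖ ≤ M := by
  obtain ⟨r, hr, e, he⟩ := exists_reps m b c hb hc hmc
  choose D hD hD2 using fun q => GG_diff (r q)
  let D' : Fin (Ideal.absNorm c) → (b * c : Ideal (𝓞 K)) → ℝ := fun q h => D q h
  have hD' : ∀ q, Summable (D' q) := fun q => (hD q).subtype _
  refine ⟨∑ q, ∑' h, D' q h, fun s hs hs2 => ?_⟩
  let f : 𝓞 K → ℂ := fun a => X.quo b (Ideal.span {a}) * (GG s a : ℂ)
  have hf : Summable f := X.summable_quo b hs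
  have h1 : X.Z b s = ∑' x : b, f x := by
    rw [RayChar.Z]
    refine (tsum_subtype_eq_of_support_subset (s := (b : Set (𝓞 K))) (f := f) ?_).symm
    intro a ha
    by_contra hab
    exact ha (by simp only [f]; rw [X.quo_zero, zero_mul]; rwa [Ideal.dvd_span_singleton])
  have hfb : Summable fun x : b => f x := hf.subtype _
  have h2 : X.Z b s = ∑ q, ∑' h : (b * c : Ideal (𝓞 K)), f ((h : 𝓞 K) + r q) := by
    rw [h1, ← e.tsum_eq]
    have hs' : Summable fun p => f (e p) := e.summable_iff.mpr hfb
    rw [hs'.tsum_prod, tsum_fintype]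
    simp_rw [he]
  have hfs : ∀ q, Summable fun h : (b * c : Ideal (𝓞 K)) => f ((h : 𝓞 K) + r q) := fun q =>
    (((Equiv.addRight (r q)).summable_iff).mpr hf).subtype _
  have hfper : ∀ q (h : (b * c : Ideal (𝓞 K))), f ((h : 𝓞 K) + r q) =
      X.toFun c * X.quo (b * c) (Ideal.span {(h : 𝓞 K)}) * (GG s ((h : 𝓞 K) + r q) : ℂ) := by
    intro q h
    simp only [f]
    congr 1
    rw [X.quo_periodic hb (y := (h : 𝓞 K)) (by simpa using hr q)]
    obtain ⟨a, ha⟩ := Ideal.dvd_span_singleton.mpr h.2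
    rw [ha, X.quo_mul (mul_ne_zero hb hc), mul_assoc, X.quo_mul hb, map_mul]
  have h3 : X.toFun c * X.Z (b * c) s = ∑' h : (b * c : Ideal (𝓞 K)),
      X.toFun c * X.quo (b * c) (Ideal.span {(h : 𝓞 K)}) * (GG s (h : 𝓞 K) : ℂ) := by
    rw [RayChar.Z]
    simp_rw [mul_assoc]
    rw [tsum_mul_left]
    congr 1
    refine (tsum_subtype_eq_of_support_subset (s := ((b * c : Ideal (𝓞 K)) : Set (𝓞 K)))
      (f := fun a => X.quo (b * c) (Ideal.span {a}) * (GG s a : ℂ)) ?_).symm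
    intro a ha
    by_contra hab
    exact ha (by
      simp only; rw [X.quo_zero, zero_mul]; rw [Ideal.dvd_span_singleton]; exact hab)
  have hs3 : Summable fun h : (b * c : Ideal (𝓞 K)) =>
      X.toFun c * X.quo (b * c) (Ideal.span {(h : 𝓞 K)}) * (GG s (h : 𝓞 K) : ℂ) := by
    simp_rw [mul_assoc]
    exact ((X.summable_quo (b * c) hs).subtype _).mul_left _
  have h4 : X.Z b s - Ideal.absNorm c * X.toFun c * X.Z (b * c) s =
      ∑ q, (∑' h : (b * c : Ideal (𝓞 K)), (f ((h : 𝓞 K) + r q) -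
      X.toFun c * X.quo (b * c) (Ideal.span {(h : 𝓞 K)}) * (GG s (h : 𝓞 K) : ℂ))) := by
    have : ∀ q, (∑' h : (b * c : Ideal (𝓞 K)), (f ((h : 𝓞 K) + r q) -
      X.toFun c * X.quo (b * c) (Ideal.span {(h : 𝓞 K)}) * (GG s (h : 𝓞 K) : ℂ))) =
      ∑' h : (b * c : Ideal (𝓞 K)), f ((h : 𝓞 K) + r q) - X.toFun c * X.Z (b * c) s := by
      intro q
      rw [(hfs q).tsum_sub hs3, h3]
    simp_rw [this]
    rw [Finset.sum_sub_distrib, ← h2]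
    simp [mul_assoc]
  rw [h4]
  refine (norm_sum_le _ _).trans (Finset.sum_le_sum fun q _ => ?_)
  refine tsum_of_norm_bounded (hD' q).hasSum fun h => ?_
  rw [hfper, ← mul_sub, norm_mul, ← Complex.ofReal_sub, Complex.norm_real, norm_mul]
  have n1 := X.norm_le c
  have n2 := X.norm_quo_le (b * c) (Ideal.span {(h : 𝓞 K)})
  calc _ ≤ 1 * ‖GG s ((h : 𝓞 K) + r q) - GG s (h : 𝓞 K)‖ := by
        gcongr
        exact mul_le_one₀ n1 (norm_nonneg _) n2
    _ ≤ _ := by rw [one_mul]; exact hD2 q s hs.le hs2 h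

/-- the L series -/
noncomputable def RayChar.L (s : ℝ) : ℂ := ∑' a, X.toFun a * ((Ideal.absNorm a : ℝ) ^ (-s) : ℝ)

lemma exists_classReps : ∃ b : ClassGroup (𝓞 K) → (Ideal (𝓞 K))⁰,
    Function.Bijective fun C => ClassGroup.mk0 (b C) := by
  choose b hb using ClassGroup.mk0_surjective (R := 𝓞 K)
  exact ⟨b, by convert Function.bijective_id; exact hb _⟩

lemma tau_ne : (torsionOrder K : ℂ) ≠ 0 := by exact_mod_cast (torsionOrder_pos K).ne'

lemma RayChar.L_eq (b : ClassGroup (𝓞 K) → (Ideal (𝓞 K))⁰)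
    (hb : Function.Bijective fun C => ClassGroup.mk0 (b C)) {s : ℝ} (hs : 1 < s) :
    torsionOrder K * X.L s =
      (∑ C, ((Ideal.absNorm (b C : Ideal (𝓞 K)) : ℝ) ^ s : ℝ) * X.Z (b C) s) := by
  rw [← (X.L_hasSum b hb hs).tsum_eq, RayChar.L, ← tsum_mul_left]
  refine tsum_congr fun a => ?_
  push_cast; ring

lemma RayChar.summable {s : ℝ} (hs : 1 < s) :
    Summable fun a => X.toFun a * ((Ideal.absNorm a : ℝ) ^ (-s) : ℝ) := by
  obtain ⟨b, hb⟩ := exists_classReps (K := K)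
  refine ((X.L_hasSum b hb hs).summable.mul_left (torsionOrder K : ℂ)⁻¹).congr fun a => ?_
  push_cast
  field_simp [tau_ne (K := K)]

theorem RayChar.L_bounded (c : Ideal (𝓞 K)) (hc : c ≠ ⊥) (hmc : m ⊔ c = ⊤) (h1 : X.toFun c ≠ 1)
    (h3 : X.toFun c ^ 3 = 1) : ∃ M : ℝ, ∀ s : ℝ, 1 < s → s ≤ 2 → ‖X.L s‖ ≤ M := by
  obtain ⟨b, hb⟩ := exists_classReps (K := K)
  have hb0 : ∀ C, (b C : Ideal (𝓞 K)) ≠ ⊥ := fun C => nonZeroDivisors.coe_ne_zero (b C)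
  have hc' : c ∈ (Ideal (𝓞 K))⁰ := mem_nonZeroDivisors_iff_ne_zero.mpr hc
  let b' : ClassGroup (𝓞 K) → (Ideal (𝓞 K))⁰ := fun C => b C * ⟨c, hc'⟩
  have hb' : Function.Bijective fun C => ClassGroup.mk0 (b' C) := by
    simp only [b', map_mul]
    exact (Group.mulRight_bijective (ClassGroup.mk0 ⟨c, hc'⟩)).comp hb
  choose M hM using fun C => X.Z_shift (hb0 C) hc hmc
  have hN : (0 : ℝ) < Ideal.absNorm c := by
    exact_mod_cast Nat.pos_of_ne_zero (by rwa [Ne, Ideal.absNorm_eq_zero_iff])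
  have hN1 : (1 : ℝ) ≤ Ideal.absNorm c := by exact_mod_cast hN
  set z := X.toFun c with hz
  have hre : z.re = - (1 / 2) := by
    have e : (z - 1) * (z ^ 2 + z + 1) = 0 := by linear_combination h3
    have e2 := (mul_eq_zero.mp e).resolve_left (sub_ne_zero.mpr h1)
    have r := congrArg Complex.re e2
    have i := congrArg Complex.im e2
    simp [pow_two] at r i
    have : z.im * (2 * z.re + 1) = 0 := by linarith
    rcases mul_eq_zero.mp this with h | h
    · rw [h] at r; nlinarith [sq_nonneg (z.re + 1 / 2)]
    · linarith
  refine ⟨∑ C, (Ideal.absNorm (b C : Ideal (𝓞 K)) : ℝ) ^ (2 : ℝ) * |M C|, fun s hs hs2 => ?_⟩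
  have e1 := X.L_eq b hb hs
  have e2 := X.L_eq b' hb' hs
  set t : ℝ := (Ideal.absNorm c : ℝ) ^ (1 - s) with ht
  have ht0 : 0 ≤ t := by positivity
  have key : torsionOrder K * X.L s * (1 - t * z) =
      ∑ C, ((Ideal.absNorm (b C : Ideal (𝓞 K)) : ℝ) ^ s : ℝ) *
        (X.Z (b C) s - Ideal.absNorm c * z * X.Z (b C * c) s) := by
    rw [mul_sub, mul_one]
    nth_rewrite 2 [e2]
    rw [e1, Finset.sum_mul, ← Finset.sum_sub_distrib]
    refine Finset.sum_congr rfl fun C _ => ?_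
    have hbc : ((b' C : (Ideal (𝓞 K))⁰) : Ideal (𝓞 K)) = b C * c := rfl
    rw [hbc, map_mul]
    have e : ((Ideal.absNorm (b C : Ideal (𝓞 K)) * Ideal.absNorm c : ℕ) : ℝ) ^ s * t =
        (Ideal.absNorm (b C : Ideal (𝓞 K)) : ℝ) ^ s * Ideal.absNorm c := by
      rw [Nat.cast_mul, Real.mul_rpow (by positivity) hN.le, mul_assoc, ht, ← Real.rpow_add hN]
      simp
    have e' := congrArg (fun r : ℝ => (r : ℂ)) e
    simp only [Complex.ofReal_mul, Complex.ofReal_natCast] at e'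
    linear_combination (-z * X.Z (b C * c) s) * e'
  have hlow : 1 ≤ ‖(1 : ℂ) - t * z‖ := by
    refine le_trans ?_ (Complex.re_le_norm _)
    simp [hre]; positivity
  have htau : (1 : ℝ) ≤ ‖(torsionOrder K : ℂ)‖ := by
    rw [Complex.norm_natCast]; exact_mod_cast torsionOrder_pos K
  calc ‖X.L s‖ ≤ ‖(torsionOrder K : ℂ)‖ * ‖X.L s‖ * ‖(1 : ℂ) - t * z‖ := by
        have := norm_nonneg (X.L s)
        have h5 : ‖X.L s‖ ≤ ‖(torsionOrder K : ℂ)‖ * ‖X.L s‖ := le_mul_of_one_le_left this htau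
        exact h5.trans (le_mul_of_one_le_right (by positivity) hlow)
    _ = ‖torsionOrder K * X.L s * (1 - t * z)‖ := by rw [norm_mul, norm_mul]
    _ ≤ _ := by
      rw [key]
      refine (norm_sum_le _ _).trans (Finset.sum_le_sum fun C _ => ?_)
      rw [norm_mul, Complex.norm_real, Real.norm_of_nonneg (by positivity)]
      have hNb : (1 : ℝ) ≤ Ideal.absNorm (b C : Ideal (𝓞 K)) := by
        exact_mod_cast Nat.one_le_iff_ne_zero.mpr
          (by rw [Ne, Ideal.absNorm_eq_zero_iff]; exact hb0 C)
      exact mul_le_mul (Real.rpow_le_rpow_of_exponent_le hNb hs2)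
        ((hM C s hs hs2).trans (le_abs_self _)) (norm_nonneg _) (by positivity)

end HN


namespace HN
set_option linter.unusedSectionVars false
open NumberField NumberField.Units Module Filter Topology
open IsDedekindDomain (HeightOneSpectrum)

variable {K : Type*} [Field K] [NumberField K]

/-- ideals all of whose prime divisors lie in `P` -/
def Smooth (P : Finset (HeightOneSpectrum (𝓞 K))) (I : Ideal (𝓞 K)) : Prop :=
  I ≠ 0 ∧ ∀ v : HeightOneSpectrum (𝓞 K), v.asIdeal ∣ I → v ∈ P

lemma smooth_empty_iff (I : Ideal (𝓞 K)) : Smooth ∅ I ↔ I = 1 := by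
  constructor
  · rintro ⟨h0, h⟩
    by_contra h1
    obtain ⟨M, hM, hIM⟩ := Ideal.exists_le_maximal I (by rwa [Ideal.one_eq_top] at h1)
    have hM0 : M ≠ ⊥ := by rintro rfl; exact h0 (le_bot_iff.mp hIM)
    exact absurd (h ⟨M, hM.isPrime, hM0⟩ (Ideal.dvd_iff_le.mpr hIM)) (Finset.notMem_empty _)
  · rintro rfl
    refine ⟨one_ne_zero, fun v hv => ?_⟩
    exact absurd (isUnit_of_dvd_one hv) v.prime.not_isUnit

lemma smooth_pow_mul_iff {P : Finset (HeightOneSpectrum (𝓞 K))} [DecidableEq (HeightOneSpectrum (𝓞 K))]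
    (v : HeightOneSpectrum (𝓞 K)) (n : ℕ) {J : Ideal (𝓞 K)} (hJ : Smooth P J) :
    Smooth (insert v P) (v.asIdeal ^ n * J) := by
  refine ⟨mul_ne_zero (pow_ne_zero _ v.ne_bot) hJ.1, fun w hw => ?_⟩
  rcases w.prime.dvd_or_dvd hw with h | h
  · have := w.prime.dvd_of_dvd_pow h
    have : v.asIdeal = w.asIdeal :=
      (v.isMaximal.eq_of_le w.isPrime.ne_top (Ideal.dvd_iff_le.mp this))
    rw [Finset.mem_insert]; left; exact HeightOneSpectrum.ext this.symm
  · exact Finset.mem_insert_of_mem (hJ.2 w h)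

lemma euler_finite (f : Ideal (𝓞 K) →*₀ ℂ) (hf : Summable fun I => ‖f I‖)
    (P : Finset (HeightOneSpectrum (𝓞 K))) :
    HasSum (fun I : {I : Ideal (𝓞 K) // Smooth P I} => f I) (∏ v ∈ P, (1 - f v.asIdeal)⁻¹) := by
  classical
  have hinj : ∀ v : HeightOneSpectrum (𝓞 K), Function.Injective fun n : ℕ => v.asIdeal ^ n :=
    fun v => pow_injective_of_not_isUnit v.prime.not_isUnit v.ne_bot
  have hpow : ∀ v : HeightOneSpectrum (𝓞 K), Summable fun n : ℕ => ‖(f v.asIdeal) ^ n‖ := by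
    intro v
    have := hf.comp_injective (hinj v)
    simpa [Function.comp_def] using this
  have hlt : ∀ v : HeightOneSpectrum (𝓞 K), ‖f v.asIdeal‖ < 1 := by
    intro v
    have := hpow v
    simp only [norm_pow] at this
    rw [summable_geometric_iff_norm_lt_one] at this
    simpa using this
  induction P using Finset.induction_on with
  | empty =>
    have : Unique {I : Ideal (𝓞 K) // Smooth ∅ I} :=
      ⟨⟨⟨1, (smooth_empty_iff _).2 rfl⟩⟩, fun a => Subtype.ext ((smooth_empty_iff _).1 a.2)⟩
    convert hasSum_fintype (fun I : {I : Ideal (𝓞 K) // Smooth ∅ I} => f I) using 1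
    rw [Fintype.sum_unique]
    have h1 : ((default : {I : Ideal (𝓞 K) // Smooth ∅ I}) : Ideal (𝓞 K)) = 1 :=
      (smooth_empty_iff _).1 (default : {I : Ideal (𝓞 K) // Smooth ∅ I}).2
    rw [h1, map_one, Finset.prod_empty]
  | insert v P hv ih =>
    rw [Finset.prod_insert hv]
    let e : ℕ × {I : Ideal (𝓞 K) // Smooth P I} → {I : Ideal (𝓞 K) // Smooth (insert v P) I} :=
      fun p => ⟨v.asIdeal ^ p.1 * p.2, smooth_pow_mul_iff v p.1 p.2.2⟩
    have he : Function.Bijective e := by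
      constructor
      · rintro ⟨n, I, hI⟩ ⟨k, J, hJ⟩ h
        have h : v.asIdeal ^ n * I = v.asIdeal ^ k * J := congrArg Subtype.val h
        have hvI : ¬ v.asIdeal ∣ I := fun h => hv (hI.2 v h)
        have hvJ : ¬ v.asIdeal ∣ J := fun h => hv (hJ.2 v h)
        have hnk : n = k := by
          apply le_antisymm
          · by_contra hlt
            push Not at hlt
            obtain ⟨d, rfl⟩ := Nat.exists_eq_add_of_lt hlt
            rw [show k + d + 1 = k + (d + 1) by ring, pow_add, mul_assoc] at h
            have := mul_left_cancel₀ (pow_ne_zero k v.ne_bot) h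
            exact hvJ (this ▸ Dvd.dvd.mul_right (dvd_pow_self _ (by omega)) _)
          · by_contra hlt
            push Not at hlt
            obtain ⟨d, rfl⟩ := Nat.exists_eq_add_of_lt hlt
            rw [show n + d + 1 = n + (d + 1) by ring, pow_add, mul_assoc] at h
            have := mul_left_cancel₀ (pow_ne_zero n v.ne_bot) h
            exact hvI (this ▸ Dvd.dvd.mul_right (dvd_pow_self _ (by omega)) _)
        subst hnk
        have := mul_left_cancel₀ (pow_ne_zero n v.ne_bot) h
        simp [this]
      · rintro ⟨I, hI⟩
        obtain ⟨n, J, hJ, rfl⟩ := WfDvdMonoid.max_power_factor hI.1 v.prime.irreducible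
        refine ⟨⟨n, J, right_ne_zero_of_mul hI.1, fun w hw => ?_⟩, rfl⟩
        have := hI.2 w (hw.mul_left _)
        rcases Finset.mem_insert.mp this with rfl | h
        · exact absurd hw hJ
        · exact h
    rw [← (Equiv.ofBijective e he).hasSum_iff]
    have hS : Summable fun I : {I : Ideal (𝓞 K) // Smooth P I} => ‖f I‖ :=
      hf.comp_injective Subtype.val_injective
    have hsm : Summable fun x : ℕ × {I : Ideal (𝓞 K) // Smooth P I} =>
        f v.asIdeal ^ x.1 * f x.2.1 :=
      summable_mul_of_summable_norm (f := fun n : ℕ => f v.asIdeal ^ n)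
        (g := fun I : {I : Ideal (𝓞 K) // Smooth P I} => f I.1) (hpow v) hS
    have hm := HasSum.mul (f := fun n : ℕ => f v.asIdeal ^ n)
      (g := fun I : {I : Ideal (𝓞 K) // Smooth P I} => f I.1)
      (hasSum_geometric_of_norm_lt_one (hlt v)) ih hsm
    refine hm.congr_fun fun p => ?_
    change f (v.asIdeal ^ p.1 * p.2) = _
    rw [map_mul, map_pow]

lemma euler_tendsto (f : Ideal (𝓞 K) →*₀ ℂ) (hf : Summable fun I => ‖f I‖) :
    Tendsto (fun P : Finset (HeightOneSpectrum (𝓞 K)) => ∏ v ∈ P, (1 - f v.asIdeal)⁻¹) atTop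
      (𝓝 (∑' I, f I)) := by
  classical
  have h1 : ∀ P : Finset (HeightOneSpectrum (𝓞 K)), ∏ v ∈ P, (1 - f v.asIdeal)⁻¹ =
      ∑' I, Set.indicator {I | Smooth P I} f I := by
    intro P
    rw [← (euler_finite f hf P).tsum_eq, ← tsum_subtype]
    rfl
  simp_rw [h1]
  refine tendsto_tsum_of_dominated_convergence hf ?_ ?_
  · intro I
    by_cases hI : I = 0
    · subst hI
      simp only [Set.indicator_apply, map_zero, ite_self]
      exact tendsto_const_nhds
    · refine tendsto_const_nhds.congr' ?_
      have hfin := Ideal.finite_factors hI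
      filter_upwards [eventually_ge_atTop hfin.toFinset] with P hP
      rw [Set.indicator_of_mem]
      exact ⟨hI, fun v hv => hP (by simpa using hv)⟩
  · refine Eventually.of_forall fun P I => ?_
    exact norm_indicator_le_norm_self _ _

/-- the norm character `I ↦ N(I)^{-s}` -/
noncomputable def nrm (s : ℝ) (hs : s ≠ 0) : Ideal (𝓞 K) →*₀ ℂ where
  toFun I := (((Ideal.absNorm I : ℝ) ^ (-s) : ℝ) : ℂ)
  map_zero' := by simp [Real.zero_rpow (neg_ne_zero.mpr hs)]
  map_one' := by simp
  map_mul' I J := by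
    simp only [map_mul, Nat.cast_mul]
    rw [Real.mul_rpow (by positivity) (by positivity)]; push_cast; ring

/-- the full zeta sum -/
noncomputable def zet (K : Type*) [Field K] [NumberField K] (s : ℝ) : ℝ :=
  ∑' I : Ideal (𝓞 K), (Ideal.absNorm I : ℝ) ^ (-s)

open scoped Classical in
/-- the trivial multiplicative function -/
noncomputable def trivFun (K : Type*) [Field K] [NumberField K] : Ideal (𝓞 K) →*₀ ℂ where
  toFun := fun I => if I = 0 then 0 else 1
  map_zero' := by simp
  map_one' := by simp
  map_mul' := fun I J => by
    by_cases hI : I = 0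
    · simp [hI]
    · by_cases hJ : J = 0
      · simp [hJ]
      · simp only [mul_eq_zero, hI, hJ, or_self, if_false, mul_one]

/-- the trivial character -/
noncomputable def trivRay (K : Type*) [Field K] [NumberField K] : RayChar K ⊥ where
  toFun := trivFun K
  norm_le := fun I => by
    change ‖(if I = 0 then (0:ℂ) else 1)‖ ≤ 1
    split_ifs <;> simp
  periodic := by
    intro b a a' x x' hb h h' hx
    rw [Ideal.bot_mul, Ideal.mem_bot, sub_eq_zero] at hx
    subst hx
    rw [h] at h'
    rw [mul_left_cancel₀ hb h']

lemma zet_summable {s : ℝ} (hs : 1 < s) :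
    Summable fun I : Ideal (𝓞 K) => (Ideal.absNorm I : ℝ) ^ (-s) := by
  have := ((trivRay K).summable hs).norm
  refine this.congr fun I => ?_
  by_cases hI : I = 0
  · subst hI
    have : (trivRay K).toFun 0 = 0 := map_zero _
    rw [this]
    have hs0 : -s ≠ 0 := by linarith
    simp [Real.zero_rpow hs0]
  · have : (trivRay K).toFun I = 1 := if_neg hI
    rw [this, one_mul, Complex.norm_real, Real.norm_of_nonneg (by positivity)]

lemma zet_eq {s : ℝ} (hs : 1 < s) : dedekindZeta K s = zet K s := by
  have h1 : HasSum (fun I : Ideal (𝓞 K) => (((Ideal.absNorm I : ℝ) ^ (-s) : ℝ) : ℂ)) (zet K s) :=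
    Complex.hasSum_ofReal.mpr (zet_summable hs).hasSum
  rw [← (Equiv.sigmaFiberEquiv (Ideal.absNorm : Ideal (𝓞 K) → ℕ)).hasSum_iff] at h1
  have h2 := h1.sigma (g := LSeries.term
    (fun n ↦ (Nat.card {I : Ideal (𝓞 K) // Ideal.absNorm I = n} : ℂ)) s) ?_
  · exact h2.tsum_eq
  · intro n
    have hfin : Finite {I : Ideal (𝓞 K) // Ideal.absNorm I = n} :=
      Ideal.finite_setOfPred_absNorm_eq n
    have := Fintype.ofFinite {I : Ideal (𝓞 K) // Ideal.absNorm I = n}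
    convert hasSum_fintype _ using 1
    have h3 : ∀ c : {I : Ideal (𝓞 K) // Ideal.absNorm I = n},
        ((fun I : Ideal (𝓞 K) => (((Ideal.absNorm I : ℝ) ^ (-s) : ℝ) : ℂ)) ∘
          ⇑(Equiv.sigmaFiberEquiv (Ideal.absNorm : Ideal (𝓞 K) → ℕ))) ⟨n, c⟩
          = (((n : ℝ) ^ (-s) : ℝ) : ℂ) := by
      intro c
      change (((Ideal.absNorm c.1 : ℝ) ^ (-s) : ℝ) : ℂ) = _
      rw [c.2]
    rw [Finset.sum_congr rfl fun c _ => h3 c, Finset.sum_const, Finset.card_univ, nsmul_eq_mul,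
      ← Nat.card_eq_fintype_card, LSeries.term_def]
    split_ifs with hn
    · subst hn
      simp [Real.zero_rpow (show -s ≠ 0 by linarith)]
    · rw [Complex.ofReal_cpow (by positivity), div_eq_mul_inv]
      congr 1
      push_cast
      rw [Complex.cpow_neg]

lemma zet_tendsto : Tendsto (fun s : ℝ => (s - 1) * zet K s) (𝓝[>] 1)
    (𝓝 (dedekindZeta_residue K)) := by
  have h := tendsto_sub_one_mul_dedekindZeta_nhdsGT K
  have h2 := (Complex.continuous_re.tendsto _).comp h
  rw [Complex.ofReal_re] at h2
  refine h2.congr' ?_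
  filter_upwards [self_mem_nhdsWithin] with s hs
  simp only [Function.comp]
  rw [zet_eq hs, ← Complex.ofReal_one, ← Complex.ofReal_sub, ← Complex.ofReal_mul, Complex.ofReal_re]

end HN


namespace HN
set_option linter.unusedSectionVars false
open NumberField NumberField.Units Module Filter Topology
open IsDedekindDomain (HeightOneSpectrum)

variable {K : Type*} [Field K] [NumberField K]
variable {m : Ideal (𝓞 K)}

/-- the combination `X^(i+1) Y^(j+1)` -/
noncomputable def RayChar.comb (X Y : RayChar K m) (i j : ℕ) : RayChar K m where
  toFun :=
    { toFun := fun I => X.toFun I ^ (i + 1) * Y.toFun I ^ (j + 1)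
      map_zero' := by rw [map_zero, zero_pow (by omega), zero_mul]
      map_one' := by simp only [map_one, one_pow, mul_one]
      map_mul' := fun I J => by simp only [map_mul, mul_pow]; ring }
  norm_le := fun I => by
    change ‖X.toFun I ^ (i + 1) * Y.toFun I ^ (j + 1)‖ ≤ 1
    rw [norm_mul, norm_pow, norm_pow]
    exact mul_le_one₀ (pow_le_one₀ (norm_nonneg _) (X.norm_le I)) (by positivity)
      (pow_le_one₀ (norm_nonneg _) (Y.norm_le I))
  periodic := by
    intro b a a' x x' hb h h' hx
    change X.toFun a ^ (i + 1) * Y.toFun a ^ (j + 1) = X.toFun a' ^ (i + 1) * Y.toFun a' ^ (j + 1)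
    rw [X.periodic b a a' x x' hb h h' hx, Y.periodic b a a' x x' hb h h' hx]

lemma RayChar.comb_apply (X Y : RayChar K m) (i j : ℕ) (I : Ideal (𝓞 K)) :
    (X.comb Y i j).toFun I = X.toFun I ^ (i + 1) * Y.toFun I ^ (j + 1) := rfl

/-- `L`-function as limit of Euler products -/
lemma RayChar.L_tendsto (X : RayChar K m) {s : ℝ} (hs : 1 < s) :
    Tendsto (fun P : Finset (HeightOneSpectrum (𝓞 K)) => ∏ v ∈ P,
      (1 - X.toFun v.asIdeal * (((Ideal.absNorm v.asIdeal : ℝ) ^ (-s) : ℝ) : ℂ))⁻¹) atTop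
      (𝓝 (X.L s)) := by
  let g : Ideal (𝓞 K) →*₀ ℂ := X.toFun * nrm s (by linarith)
  have hap : ∀ I, g I =
      X.toFun I * (((Ideal.absNorm I : ℝ) ^ (-s) : ℝ) : ℂ) := fun I => rfl
  have h := euler_tendsto g (by
    simp only [hap]; exact (X.summable hs).norm)
  simp only [hap] at h
  exact h

lemma zet_euler {s : ℝ} (hs : 1 < s) :
    Tendsto (fun P : Finset (HeightOneSpectrum (𝓞 K)) => ∏ v ∈ P,
      (1 - ((Ideal.absNorm v.asIdeal : ℝ) ^ (-s) : ℝ))⁻¹) atTop (𝓝 (zet K s)) := by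
  have h := euler_tendsto (K := K) (nrm s (by linarith)) (by
    refine (zet_summable (K := K) hs).congr fun I => ?_
    change _ = ‖(((Ideal.absNorm I : ℝ) ^ (-s) : ℝ) : ℂ)‖
    rw [Complex.norm_real, Real.norm_of_nonneg (by positivity)])
  have h2 := (Complex.continuous_re.tendsto _).comp h
  have h3 : (∑' I : Ideal (𝓞 K), (nrm s (by linarith) : Ideal (𝓞 K) →*₀ ℂ) I) = (zet K s : ℂ) := by
    rw [zet, Complex.ofReal_tsum]; rfl
  rw [h3, Complex.ofReal_re] at h2
  refine h2.congr fun P => ?_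
  rw [← Complex.ofReal_re (∏ v ∈ P, (1 - ((Ideal.absNorm v.asIdeal : ℝ) ^ (-s) : ℝ))⁻¹)]
  simp only [Function.comp]
  congr 1
  push_cast
  rfl

lemma zet_nonneg (s : ℝ) : 0 ≤ zet K s := tsum_nonneg fun _ => by positivity

lemma norm_L_le_zet (X : RayChar K m) {s : ℝ} (hs : 1 < s) : ‖X.L s‖ ≤ zet K s := by
  refine tsum_of_norm_bounded (zet_summable hs).hasSum fun I => ?_
  rw [norm_mul, Complex.norm_real, Real.norm_of_nonneg (by positivity)]
  exact mul_le_of_le_one_left (by positivity) (X.norm_le I)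

lemma local_prod_one {x : ℂ} (hx : x ^ 3 = 1) (h1 : x ≠ 1) (z : ℂ) :
    ∏ i ∈ Finset.range 3, (1 - x ^ (i + 1) * z) = 1 - z ^ 3 := by
  have h2 : x ^ 2 + x + 1 = 0 := by
    have : (x - 1) * (x ^ 2 + x + 1) = 0 := by linear_combination hx
    exact (mul_eq_zero.mp this).resolve_left (sub_ne_zero.mpr h1)
  simp only [Finset.prod_range_succ, Finset.prod_range_zero, hx]
  have h4 : x ^ 2 = - x - 1 := by linear_combination h2
  simp only [zero_add, pow_one, one_mul, Nat.reduceAdd]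
  rw [h4]
  linear_combination (z ^ 3 - z ^ 2) * h4

lemma local_prod {x y : ℂ} (hx : x ^ 3 = 1) (hy : y ^ 3 = 1) (h : ¬ (x = 1 ∧ y = 1)) (t : ℂ) :
    ∏ i ∈ Finset.range 3, ∏ j ∈ Finset.range 3, (1 - x ^ (i + 1) * y ^ (j + 1) * t)
      = (1 - t ^ 3) ^ 3 := by
  have pw : ∀ (z : ℂ) (i : ℕ), z ^ 3 = 1 → (z ^ (i + 1)) ^ 3 = 1 := fun z i hz => by
    rw [← pow_mul, mul_comm, pow_mul, hz, one_pow]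
  by_cases h1 : x = 1
  · have hy1 : y ≠ 1 := fun h2 => h ⟨h1, h2⟩
    subst h1
    simp only [one_pow, one_mul]
    rw [Finset.prod_congr rfl fun i _ => local_prod_one hy hy1 t, Finset.prod_const,
      Finset.card_range]
  · rw [Finset.prod_comm]
    simp only [mul_assoc]
    rw [Finset.prod_congr rfl fun j _ => local_prod_one hx h1 _]
    simp only [mul_pow, pw y _ hy, one_mul]
    rw [Finset.prod_const, Finset.card_range]

lemma local_prod_norm_le {x y : ℂ} (hx : x ^ 3 = 1) (hy : y ^ 3 = 1) {t : ℝ} (h0 : 0 ≤ t)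
    (h1 : t < 1) :
    ‖∏ i ∈ Finset.range 3, ∏ j ∈ Finset.range 3, (1 - x ^ (i + 1) * y ^ (j + 1) * (t : ℂ))‖
      ≤ (1 - t ^ 3) ^ 3 := by
  have ht3 : t ^ 3 ≤ t := by nlinarith [mul_nonneg h0 h0]
  by_cases h : x = 1 ∧ y = 1
  · obtain ⟨rfl, rfl⟩ := h
    simp only [one_pow, one_mul, Finset.prod_const, Finset.card_range]
    rw [norm_pow, norm_pow, ← Complex.ofReal_one, ← Complex.ofReal_sub, Complex.norm_real,
      Real.norm_of_nonneg (by linarith)]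
    have : (1 - t) ^ 3 ≤ 1 - t := by
      nlinarith [mul_nonneg h0 (sub_nonneg.mpr h1.le), mul_nonneg (mul_nonneg h0 h0) (sub_nonneg.mpr h1.le)]
    exact pow_le_pow_left₀ (by have := sub_nonneg.mpr h1.le; positivity) (by linarith) 3
  · rw [local_prod hx hy h, ← Complex.ofReal_one, ← Complex.ofReal_pow, ← Complex.ofReal_sub,
      ← Complex.ofReal_pow, Complex.norm_real, Real.norm_of_nonneg]
    exact pow_nonneg (by linarith) 3


lemma prod_le_prod_subset {ι : Type*} {s t : Finset ι} {f : ι → ℝ} (h : s ⊆ t)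
    (h1 : ∀ i, 1 ≤ f i) : ∏ i ∈ s, f i ≤ ∏ i ∈ t, f i := by
  exact Finset.prod_mono_set_of_one_le h1 h

lemma two_le_norm (v : HeightOneSpectrum (𝓞 K)) : 2 ≤ Ideal.absNorm v.asIdeal := by
  have h0 : Ideal.absNorm v.asIdeal ≠ 0 := by
    rw [Ne, Ideal.absNorm_eq_zero_iff]; exact v.ne_bot
  have h1 : Ideal.absNorm v.asIdeal ≠ 1 := by
    rw [Ne, Ideal.absNorm_eq_one_iff]; exact v.isPrime.ne_top
  omega

lemma norm_rpow_le_half (v : HeightOneSpectrum (𝓞 K)) {s : ℝ} (hs : 1 < s) :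
    (Ideal.absNorm v.asIdeal : ℝ) ^ (-s) ≤ 1 / 2 := by
  have h2 : (2 : ℝ) ≤ Ideal.absNorm v.asIdeal := by exact_mod_cast two_le_norm v
  calc (Ideal.absNorm v.asIdeal : ℝ) ^ (-s) ≤ (2 : ℝ) ^ (-s) :=
        Real.rpow_le_rpow_of_nonpos (by norm_num) h2 (by linarith)
    _ ≤ (2 : ℝ) ^ (-1 : ℝ) := Real.rpow_le_rpow_of_exponent_le (by norm_num) (by linarith)
    _ = 1 / 2 := by rw [Real.rpow_neg_one]; norm_num

section contra
variable {F E : Type*} [Field F] [NumberField F] [Field E] [NumberField E]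
    {m : Ideal (𝓞 F)} (hm : m ≠ ⊥) (X Y : RayChar F m)
    (hX0 : ∀ v : HeightOneSpectrum (𝓞 F), v.asIdeal ∣ m → X.toFun v.asIdeal = 0)
    (hX3 : ∀ v : HeightOneSpectrum (𝓞 F), ¬ v.asIdeal ∣ m → X.toFun v.asIdeal ^ 3 = 1)
    (hY3 : ∀ v : HeightOneSpectrum (𝓞 F), ¬ v.asIdeal ∣ m → Y.toFun v.asIdeal ^ 3 = 1)
    (π : HeightOneSpectrum (𝓞 E) → HeightOneSpectrum (𝓞 F)) (hπ : Function.Surjective π)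
    (hfin : ∀ v, (π ⁻¹' {v}).Finite)
    (hsp : ∀ v : HeightOneSpectrum (𝓞 F), ¬ v.asIdeal ∣ m →
      (X.toFun v.asIdeal = 1 ∧ Y.toFun v.asIdeal = 1 ∧ (π ⁻¹' {v}).ncard ≤ 3 ∧
        ∀ w, π w = v → Ideal.absNorm v.asIdeal ≤ Ideal.absNorm w.asIdeal) ∨
      ((π ⁻¹' {v}).ncard ≤ 1 ∧
        ∀ w, π w = v → Ideal.absNorm v.asIdeal ^ 3 ≤ Ideal.absNorm w.asIdeal))

/-- local zeta factor -/
noncomputable def zf (s : ℝ) (v : HeightOneSpectrum (𝓞 K)) : ℝ :=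
  (1 - (Ideal.absNorm v.asIdeal : ℝ) ^ (-s))⁻¹

lemma one_le_zf {s : ℝ} (hs : 1 < s) (v : HeightOneSpectrum (𝓞 K)) : 1 ≤ zf s v := by
  have h := norm_rpow_le_half v hs
  have h0 : 0 ≤ (Ideal.absNorm v.asIdeal : ℝ) ^ (-s) := by positivity
  exact (one_le_inv₀ (by linarith)).mpr (by linarith)

lemma zf_le_two {s : ℝ} (hs : 1 < s) (v : HeightOneSpectrum (𝓞 K)) : zf s v ≤ 2 := by
  have h := norm_rpow_le_half v hs
  rw [zf, show (2 : ℝ) = (1 / 2)⁻¹ by norm_num]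
  exact inv_anti₀ (by norm_num) (by linarith)

lemma zf_le_of {s : ℝ} (hs : 1 < s) (v : HeightOneSpectrum (𝓞 F)) (w : HeightOneSpectrum (𝓞 E))
    (k : ℕ) (hk : k ≠ 0) (h : Ideal.absNorm v.asIdeal ^ k ≤ Ideal.absNorm w.asIdeal) :
    zf s w ≤ (1 - ((Ideal.absNorm v.asIdeal : ℝ) ^ (-s)) ^ k)⁻¹ := by
  have h1 := norm_rpow_le_half v hs
  have h0 : 0 ≤ (Ideal.absNorm v.asIdeal : ℝ) ^ (-s) := by positivity
  have hv : 0 < Ideal.absNorm v.asIdeal := by have := two_le_norm v; omega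
  have h3 : ((Ideal.absNorm v.asIdeal : ℝ) ^ (-s)) ^ k ≤ (Ideal.absNorm v.asIdeal : ℝ) ^ (-s) :=
    pow_le_of_le_one h0 (by linarith) hk
  refine inv_anti₀ (by linarith) ?_
  have h4 : (Ideal.absNorm w.asIdeal : ℝ) ^ (-s) ≤ ((Ideal.absNorm v.asIdeal : ℝ) ^ k) ^ (-s) :=
    Real.rpow_le_rpow_of_nonpos (by positivity) (by exact_mod_cast h) (by linarith)
  have h5 : ((Ideal.absNorm v.asIdeal : ℝ) ^ k) ^ (-s) = ((Ideal.absNorm v.asIdeal : ℝ) ^ (-s)) ^ k := by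
    rw [← Real.rpow_natCast, ← Real.rpow_natCast, ← Real.rpow_mul (by positivity),
      ← Real.rpow_mul (by positivity), mul_comm]
  linarith

open scoped Classical in
lemma local_ineq (X Y : RayChar F m)
    (hX0 : ∀ v : HeightOneSpectrum (𝓞 F), v.asIdeal ∣ m → X.toFun v.asIdeal = 0)
    (hX3 : ∀ v : HeightOneSpectrum (𝓞 F), ¬ v.asIdeal ∣ m → X.toFun v.asIdeal ^ 3 = 1)
    (hY3 : ∀ v : HeightOneSpectrum (𝓞 F), ¬ v.asIdeal ∣ m → Y.toFun v.asIdeal ^ 3 = 1)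
    (π : HeightOneSpectrum (𝓞 E) → HeightOneSpectrum (𝓞 F))
    (hfin : ∀ v, (π ⁻¹' {v}).Finite)
    (hsp : ∀ v : HeightOneSpectrum (𝓞 F), ¬ v.asIdeal ∣ m →
      (X.toFun v.asIdeal = 1 ∧ Y.toFun v.asIdeal = 1 ∧ (π ⁻¹' {v}).ncard ≤ 3 ∧
        ∀ w, π w = v → Ideal.absNorm v.asIdeal ≤ Ideal.absNorm w.asIdeal) ∨
      ((π ⁻¹' {v}).ncard ≤ 1 ∧
        ∀ w, π w = v → Ideal.absNorm v.asIdeal ^ 3 ≤ Ideal.absNorm w.asIdeal))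
    {s : ℝ} (hs : 1 < s) (v : HeightOneSpectrum (𝓞 F)) :
    (∏ w ∈ (hfin v).toFinset, zf s w) ^ 3 ≤
      (if v.asIdeal ∣ m then (2 ^ (hfin v).toFinset.card) ^ 3 else 1) *
      ‖∏ i ∈ Finset.range 3, ∏ j ∈ Finset.range 3, (1 - (X.comb Y i j).toFun v.asIdeal *
        (((Ideal.absNorm v.asIdeal : ℝ) ^ (-s) : ℝ) : ℂ))⁻¹‖ := by
  have h0 : ∀ w : HeightOneSpectrum (𝓞 E), 0 ≤ zf s w := fun w => zero_le_one.trans (one_le_zf hs w)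
  split_ifs with hv
  · simp only [RayChar.comb_apply, hX0 v hv]
    simp only [ne_eq, Nat.add_eq_zero_iff, one_ne_zero, and_false, not_false_eq_true, zero_pow,
      zero_mul, sub_zero, inv_one, Finset.prod_const_one, norm_one, mul_one]
    refine pow_le_pow_left₀ (Finset.prod_nonneg fun w _ => h0 w) ?_ 3
    rw [← Finset.prod_const]
    exact Finset.prod_le_prod (fun w _ => h0 w) fun w _ => zf_le_two hs w
  rw [one_mul]
  set t : ℝ := (Ideal.absNorm v.asIdeal : ℝ) ^ (-s) with ht
  have ht0 : 0 ≤ t := by positivity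
  have ht1 : t ≤ 1 / 2 := norm_rpow_le_half v hs
  have hmem : ∀ w, w ∈ (hfin v).toFinset ↔ π w = v := by simp
  have hcard : (hfin v).toFinset.card = (π ⁻¹' {v}).ncard := (Set.ncard_eq_toFinset_card _ _).symm
  simp only [RayChar.comb_apply, Finset.prod_inv_distrib, norm_inv]
  rcases hsp v hv with ⟨hx, hy, hc, hw⟩ | ⟨hc, hw⟩
  · rw [hx, hy]
    simp only [one_pow, one_mul, Finset.prod_const, Finset.card_range]
    rw [norm_pow, norm_pow, ← Complex.ofReal_one, ← Complex.ofReal_sub, Complex.norm_real,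
      Real.norm_of_nonneg (by linarith), ← inv_pow, ← inv_pow]
    refine pow_le_pow_left₀ (Finset.prod_nonneg fun w _ => h0 w) ?_ 3
    calc ∏ w ∈ (hfin v).toFinset, zf s w ≤ ∏ w ∈ (hfin v).toFinset, (1 - t)⁻¹ := by
          refine Finset.prod_le_prod (fun w _ => h0 w) fun w hwv => ?_
          have := zf_le_of hs v w 1 one_ne_zero (by rw [pow_one]; exact hw w ((hmem w).1 hwv))
          rwa [pow_one] at this
      _ = (1 - t)⁻¹ ^ (hfin v).toFinset.card := by rw [Finset.prod_const]
      _ ≤ (1 - t)⁻¹ ^ 3 := pow_le_pow_right₀ ((one_le_inv₀ (by linarith)).mpr (by linarith))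
          (by omega)
  · have hle := local_prod_norm_le (hX3 v hv) (hY3 v hv) ht0 (by linarith)
    have ht3 : t ^ 3 ≤ 1 / 2 := (pow_le_of_le_one ht0 (by linarith) (by norm_num)).trans ht1
    have ht30 : 0 ≤ t ^ 3 := by positivity
    have hpos : 0 < ‖∏ i ∈ Finset.range 3, ∏ j ∈ Finset.range 3, (1 - X.toFun v.asIdeal ^ (i + 1) *
        Y.toFun v.asIdeal ^ (j + 1) * (t : ℂ))‖ := by
      rw [norm_pos_iff, Finset.prod_ne_zero_iff]
      intro i _
      rw [Finset.prod_ne_zero_iff]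
      intro j _ h
      have h2 : X.toFun v.asIdeal ^ (i + 1) * Y.toFun v.asIdeal ^ (j + 1) * (t : ℂ) = 1 :=
        (sub_eq_zero.mp h).symm
      have h3 := congrArg norm h2
      rw [norm_mul, norm_one, Complex.norm_real, Real.norm_of_nonneg ht0] at h3
      have h4 := (X.comb Y i j).norm_le v.asIdeal
      rw [RayChar.comb_apply] at h4
      have := mul_le_mul_of_nonneg_right h4 ht0
      linarith
    refine le_trans ?_ (inv_anti₀ hpos hle)
    rw [← inv_pow]
    refine pow_le_pow_left₀ (Finset.prod_nonneg fun w _ => h0 w) ?_ 3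
    calc ∏ w ∈ (hfin v).toFinset, zf s w ≤ ∏ w ∈ (hfin v).toFinset, (1 - t ^ 3)⁻¹ := by
          refine Finset.prod_le_prod (fun w _ => h0 w) fun w hwv => ?_
          exact zf_le_of hs v w 3 (by norm_num) (hw w ((hmem w).1 hwv))
      _ = (1 - t ^ 3)⁻¹ ^ (hfin v).toFinset.card := by rw [Finset.prod_const]
      _ ≤ (1 - t ^ 3)⁻¹ ^ 1 := pow_le_pow_right₀ ((one_le_inv₀ (by linarith)).mpr (by linarith))
          (by omega)
      _ = _ := pow_one _

lemma zet_cube_le (hm : m ≠ ⊥) (X Y : RayChar F m)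
    (hX0 : ∀ v : HeightOneSpectrum (𝓞 F), v.asIdeal ∣ m → X.toFun v.asIdeal = 0)
    (hX3 : ∀ v : HeightOneSpectrum (𝓞 F), ¬ v.asIdeal ∣ m → X.toFun v.asIdeal ^ 3 = 1)
    (hY3 : ∀ v : HeightOneSpectrum (𝓞 F), ¬ v.asIdeal ∣ m → Y.toFun v.asIdeal ^ 3 = 1)
    (π : HeightOneSpectrum (𝓞 E) → HeightOneSpectrum (𝓞 F)) (hπ : Function.Surjective π)
    (hfin : ∀ v, (π ⁻¹' {v}).Finite)
    (hsp : ∀ v : HeightOneSpectrum (𝓞 F), ¬ v.asIdeal ∣ m →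
      (X.toFun v.asIdeal = 1 ∧ Y.toFun v.asIdeal = 1 ∧ (π ⁻¹' {v}).ncard ≤ 3 ∧
        ∀ w, π w = v → Ideal.absNorm v.asIdeal ≤ Ideal.absNorm w.asIdeal) ∨
      ((π ⁻¹' {v}).ncard ≤ 1 ∧
        ∀ w, π w = v → Ideal.absNorm v.asIdeal ^ 3 ≤ Ideal.absNorm w.asIdeal)) : ∃ C : ℝ, 0 ≤ C ∧ ∀ s : ℝ, 1 < s → (zet E s) ^ 3 ≤
    C * ∏ i ∈ Finset.range 3, ∏ j ∈ Finset.range 3, ‖(X.comb Y i j).L s‖ := by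
  classical
  have hS := Ideal.finite_factors hm
  let c : HeightOneSpectrum (𝓞 F) → ℝ := fun v =>
    if v.asIdeal ∣ m then (2 ^ (hfin v).toFinset.card) ^ 3 else 1
  have hc1 : ∀ v, 1 ≤ c v := fun v => by
    simp only [c]; split_ifs
    · exact one_le_pow₀ (one_le_pow₀ (by norm_num))
    · exact le_rfl
  refine ⟨∏ v ∈ hS.toFinset, c v, Finset.prod_nonneg fun v _ => zero_le_one.trans (hc1 v),
    fun s hs => ?_⟩
  have h0 : ∀ w : HeightOneSpectrum (𝓞 E), 0 ≤ zf s w := fun w => zero_le_one.trans (one_le_zf hs w)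
  have hlim1 := (zet_euler (K := E) hs).pow 3
  obtain ⟨ι, hι⟩ := hπ.hasRightInverse
  have hT : Tendsto (Finset.image π) atTop atTop := tendsto_finset_image_atTop_atTop (i := ι) hι
  have hlim2 : Tendsto (fun P : Finset (HeightOneSpectrum (𝓞 F)) => ∏ v ∈ P,
      ‖∏ i ∈ Finset.range 3, ∏ j ∈ Finset.range 3, (1 - (X.comb Y i j).toFun v.asIdeal *
        (((Ideal.absNorm v.asIdeal : ℝ) ^ (-s) : ℝ) : ℂ))⁻¹‖) atTop
      (𝓝 (∏ i ∈ Finset.range 3, ∏ j ∈ Finset.range 3, ‖(X.comb Y i j).L s‖)) := by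
    have h3 : Tendsto (fun P : Finset (HeightOneSpectrum (𝓞 F)) => ∏ i ∈ Finset.range 3,
      ∏ j ∈ Finset.range 3, ‖∏ v ∈ P, (1 - (X.comb Y i j).toFun v.asIdeal *
        (((Ideal.absNorm v.asIdeal : ℝ) ^ (-s) : ℝ) : ℂ))⁻¹‖) atTop
      (𝓝 (∏ i ∈ Finset.range 3, ∏ j ∈ Finset.range 3, ‖(X.comb Y i j).L s‖)) := by
      refine tendsto_finsetProd _ fun i _ => tendsto_finsetProd _ fun j _ => ?_
      exact ((X.comb Y i j).L_tendsto hs).norm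
    refine h3.congr fun P => ?_
    simp only [norm_prod]
    symm
    rw [Finset.prod_comm]
    refine Finset.prod_congr rfl fun i _ => ?_
    rw [Finset.prod_comm]
  refine le_of_tendsto_of_tendsto' hlim1 ((hlim2.comp hT).const_mul _) fun Q => ?_
  simp only [Function.comp]
  set P := Finset.image π Q
  calc (∏ v ∈ Q, (1 - ((Ideal.absNorm v.asIdeal : ℝ) ^ (-s) : ℝ))⁻¹) ^ 3
      ≤ (∏ w ∈ P.biUnion fun v => (hfin v).toFinset, zf s w) ^ 3 := by
        refine pow_le_pow_left₀ (Finset.prod_nonneg fun w _ => h0 w) ?_ 3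
        refine prod_le_prod_subset (f := zf s) ?_ (one_le_zf hs)
        intro w hw
        rw [Finset.mem_biUnion]
        exact ⟨π w, Finset.mem_image_of_mem _ hw, by simp⟩
    _ = ∏ v ∈ P, (∏ w ∈ (hfin v).toFinset, zf s w) ^ 3 := by
        rw [Finset.prod_biUnion, Finset.prod_pow]
        intro v _ v' _ hvv
        rw [Function.onFun, Finset.disjoint_left]
        intro w hw hw'
        simp only [Set.Finite.mem_toFinset, Set.mem_preimage, Set.mem_singleton_iff] at hw hw'
        exact hvv (hw.symm.trans hw')
    _ ≤ ∏ v ∈ P, c v * ‖∏ i ∈ Finset.range 3, ∏ j ∈ Finset.range 3,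
        (1 - (X.comb Y i j).toFun v.asIdeal *
        (((Ideal.absNorm v.asIdeal : ℝ) ^ (-s) : ℝ) : ℂ))⁻¹‖ := by
        refine Finset.prod_le_prod (fun v _ => pow_nonneg (Finset.prod_nonneg fun w _ => h0 w) 3)
          fun v _ => ?_
        exact local_ineq X Y hX0 hX3 hY3 π hfin hsp hs v
    _ = (∏ v ∈ P, c v) * _ := Finset.prod_mul_distrib
    _ ≤ _ := by
        refine mul_le_mul_of_nonneg_right ?_ (Finset.prod_nonneg fun v _ => norm_nonneg _)
        have : ∏ v ∈ P, c v = ∏ v ∈ P.filter (fun v => v.asIdeal ∣ m), c v := by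
          refine (Finset.prod_filter_of_ne fun v _ hv => ?_).symm
          by_contra h
          exact hv (if_neg h)
        rw [this]
        refine prod_le_prod_subset ?_ hc1
        intro v hv
        rw [Finset.mem_filter] at hv
        simpa using hv.2

theorem analytic_contra (hm : m ≠ ⊥) (X Y : RayChar F m)
    (hX0 : ∀ v : HeightOneSpectrum (𝓞 F), v.asIdeal ∣ m → X.toFun v.asIdeal = 0)
    (hX3 : ∀ v : HeightOneSpectrum (𝓞 F), ¬ v.asIdeal ∣ m → X.toFun v.asIdeal ^ 3 = 1)
    (hY3 : ∀ v : HeightOneSpectrum (𝓞 F), ¬ v.asIdeal ∣ m → Y.toFun v.asIdeal ^ 3 = 1)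
    (π : HeightOneSpectrum (𝓞 E) → HeightOneSpectrum (𝓞 F)) (hπ : Function.Surjective π)
    (hfin : ∀ v, (π ⁻¹' {v}).Finite)
    (hsp : ∀ v : HeightOneSpectrum (𝓞 F), ¬ v.asIdeal ∣ m →
      (X.toFun v.asIdeal = 1 ∧ Y.toFun v.asIdeal = 1 ∧ (π ⁻¹' {v}).ncard ≤ 3 ∧
        ∀ w, π w = v → Ideal.absNorm v.asIdeal ≤ Ideal.absNorm w.asIdeal) ∨
      ((π ⁻¹' {v}).ncard ≤ 1 ∧
        ∀ w, π w = v → Ideal.absNorm v.asIdeal ^ 3 ≤ Ideal.absNorm w.asIdeal))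
    (hnt : ∀ i j : ℕ, i < 3 → j < 3 → ¬ (i = 2 ∧ j = 2) → ∃ c : Ideal (𝓞 F), c ≠ ⊥ ∧ m ⊔ c = ⊤ ∧
      X.toFun c ^ (i + 1) * Y.toFun c ^ (j + 1) ≠ 1 ∧ X.toFun c ^ 3 = 1 ∧ Y.toFun c ^ 3 = 1) :
    False := by
  obtain ⟨C, hC0, hC⟩ := zet_cube_le hm X Y hX0 hX3 hY3 π hπ hfin hsp
  have hb : ∀ i j : ℕ, ∃ M : ℝ, 0 ≤ M ∧ (i < 3 → j < 3 → ¬ (i = 2 ∧ j = 2) →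
      ∀ s : ℝ, 1 < s → s ≤ 2 → ‖(X.comb Y i j).L s‖ ≤ M) := by
    intro i j
    by_cases h : i < 3 ∧ j < 3 ∧ ¬ (i = 2 ∧ j = 2)
    · obtain ⟨c, hc, hmc, h1, h3, h3'⟩ := hnt i j h.1 h.2.1 h.2.2
      obtain ⟨M, hM⟩ := (X.comb Y i j).L_bounded c hc hmc h1 (by
        rw [RayChar.comb_apply, mul_pow, ← pow_mul, ← pow_mul, mul_comm _ 3, mul_comm _ 3, pow_mul,
          pow_mul, h3, h3', one_pow, one_pow, one_mul])
      exact ⟨M, (norm_nonneg _).trans (hM 2 (by norm_num) le_rfl), fun _ _ _ => hM⟩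
    · exact ⟨0, le_rfl, fun h1 h2 h3 => absurd ⟨h1, h2, h3⟩ h⟩
  choose M hM0 hM using hb
  have hfinal : ∀ s : ℝ, 1 < s → s ≤ 2 → (zet E s) ^ 3 ≤ (C * (M 0 0 * M 0 1 * M 0 2 *
      (M 1 0 * M 1 1 * M 1 2) * (M 2 0 * M 2 1))) * zet F s := by
    intro s hs hs2
    refine (hC s hs).trans ?_
    rw [mul_assoc]
    refine mul_le_mul_of_nonneg_left ?_ hC0
    simp only [Finset.prod_range_succ, Finset.prod_range_zero, one_mul]
    rw [mul_assoc _ (M 2 0 * M 2 1)]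
    have hz := norm_L_le_zet (X.comb Y 2 2) hs
    have hz0 := zet_nonneg (K := F) s
    have := hM0 0 0; have := hM0 0 1; have := hM0 0 2
    have := hM0 1 0; have := hM0 1 1; have := hM0 1 2
    have := hM0 2 0; have := hM0 2 1
    gcongr
    all_goals exact hM _ _ (by norm_num) (by norm_num) (by norm_num) s hs hs2
  set D := (C * (M 0 0 * M 0 1 * M 0 2 * (M 1 0 * M 1 1 * M 1 2) * (M 2 0 * M 2 1))) with hD
  have l1 := (zet_tendsto (K := E)).pow 3
  have l2 : Tendsto (fun s : ℝ => D * (s - 1) ^ 2 * ((s - 1) * zet F s)) (𝓝[>] 1)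
      (𝓝 (D * (1 - 1) ^ 2 * dedekindZeta_residue F)) := by
    refine Tendsto.mul ?_ (zet_tendsto (K := F))
    refine Tendsto.mono_left ?_ nhdsWithin_le_nhds
    exact (by fun_prop : Continuous fun s : ℝ => D * (s - 1) ^ 2).tendsto 1
  have hle := le_of_tendsto_of_tendsto l1 l2 (by
    filter_upwards [Ioc_mem_nhdsGT (show (1:ℝ) < 2 by norm_num)] with s hs
    have h := hfinal s hs.1 hs.2
    have h3 : 0 ≤ (s - 1) ^ 3 := pow_nonneg (by linarith [hs.1]) 3
    have := mul_le_mul_of_nonneg_left h h3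
    calc ((s - 1) * zet E s) ^ 3 = (s - 1) ^ 3 * zet E s ^ 3 := by ring
      _ ≤ _ := this
      _ = _ := by ring)
  have hp := pow_pos (dedekindZeta_residue_pos E) 3
  simp only [sub_self, ne_eq, OfNat.ofNat_ne_zero, not_false_eq_true, zero_pow, mul_zero,
    zero_mul] at hle
  linarith

end contra
end HN


namespace HN
set_option linter.unusedSectionVars false
open NumberField NumberField.Units Module Filter Topology
open IsDedekindDomain (HeightOneSpectrum)

variable {K : Type*} [Field K] [NumberField K]

lemma Smooth.one (P : Finset (HeightOneSpectrum (𝓞 K))) : Smooth P (1 : Ideal (𝓞 K)) :=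
  ⟨one_ne_zero, fun v hv => absurd (isUnit_of_dvd_one hv) v.prime.not_isUnit⟩

lemma Smooth.mul {P : Finset (HeightOneSpectrum (𝓞 K))} {I J : Ideal (𝓞 K)} (hI : Smooth P I)
    (hJ : Smooth P J) : Smooth P (I * J) :=
  ⟨mul_ne_zero hI.1 hJ.1, fun v hv => (v.prime.dvd_or_dvd hv).elim (hI.2 v) (hJ.2 v)⟩

/-- no prime of `S` divides `a` -/
def CopS (S : Finset (HeightOneSpectrum (𝓞 K))) (a : Ideal (𝓞 K)) : Prop :=
  ∀ v ∈ S, ¬ v.asIdeal ∣ a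

lemma CopS.mul_iff {S : Finset (HeightOneSpectrum (𝓞 K))} {a b : Ideal (𝓞 K)} :
    CopS S (a * b) ↔ CopS S a ∧ CopS S b := by
  constructor
  · exact fun h => ⟨fun v hv hd => h v hv (hd.mul_right _), fun v hv hd => h v hv (hd.mul_left _)⟩
  · exact fun h v hv hd => (v.prime.dvd_or_dvd hd).elim (h.1 v hv) (h.2 v hv)

lemma CopS.one (S : Finset (HeightOneSpectrum (𝓞 K))) : CopS S (1 : Ideal (𝓞 K)) :=
  fun v _ hd => absurd (isUnit_of_dvd_one hd) v.prime.not_isUnit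

lemma exists_decomp (S : Finset (HeightOneSpectrum (𝓞 K))) {a : Ideal (𝓞 K)} (ha : a ≠ 0) :
    ∃ c I : Ideal (𝓞 K), CopS S c ∧ Smooth S I ∧ a = c * I := by
  classical
  induction S using Finset.induction_on with
  | empty => exact ⟨a, 1, fun v hv => absurd hv (Finset.notMem_empty v), Smooth.one _, (mul_one a).symm⟩
  | insert v S hv ih =>
    obtain ⟨c, I, hc, hI, rfl⟩ := ih
    obtain ⟨n, c', hc', rfl⟩ := WfDvdMonoid.max_power_factor (left_ne_zero_of_mul ha)
      v.prime.irreducible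
    refine ⟨c', v.asIdeal ^ n * I, ?_, smooth_pow_mul_iff v n hI, by ring⟩
    intro w hw hd
    rcases Finset.mem_insert.mp hw with rfl | hw
    · exact hc' hd
    · exact hc w hw (hd.mul_left _)

/-- the modulus -/
noncomputable def modS (S : Finset (HeightOneSpectrum (𝓞 K))) : Ideal (𝓞 K) := ∏ v ∈ S, v.asIdeal

lemma modS_ne (S : Finset (HeightOneSpectrum (𝓞 K))) : modS S ≠ ⊥ :=
  Finset.prod_ne_zero_iff.mpr fun v _ => v.ne_bot

lemma dvd_modS_iff {S : Finset (HeightOneSpectrum (𝓞 K))} {v : HeightOneSpectrum (𝓞 K)} :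
    v.asIdeal ∣ modS S ↔ v ∈ S := by
  constructor
  · intro h
    obtain ⟨w, hw, hd⟩ := v.prime.exists_mem_finset_dvd h
    have : w = v := HeightOneSpectrum.ext
      (w.isMaximal.eq_of_le v.isPrime.ne_top (Ideal.dvd_iff_le.mp hd))
    exact this ▸ hw
  · exact fun h => Finset.dvd_prod_of_mem _ h

lemma CopS.sup_eq_top {S : Finset (HeightOneSpectrum (𝓞 K))} {c : Ideal (𝓞 K)} (hc : CopS S c) :
    modS S ⊔ c = ⊤ := by
  by_contra h
  obtain ⟨M, hM, hle⟩ := Ideal.exists_le_maximal _ h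
  have hm : modS S ≤ M := le_sup_left.trans hle
  have hM0 : M ≠ ⊥ := by rintro rfl; exact modS_ne S (le_bot_iff.mp hm)
  let v : HeightOneSpectrum (𝓞 K) := ⟨M, hM.isPrime, hM0⟩
  exact hc v (dvd_modS_iff.mp (Ideal.dvd_iff_le.mpr hm)) (Ideal.dvd_iff_le.mpr (le_sup_right.trans hle))

/-- data of a character mod S on elements -/
structure ElChar (S : Finset (HeightOneSpectrum (𝓞 K))) where
  ψ : 𝓞 K →*₀ ℂ
  cube : ∀ α, α ≠ 0 → ψ α ^ 3 = 1
  unit : ∀ α β I J, α ≠ 0 → β ≠ 0 → Smooth S I → Smooth S J →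
    Ideal.span {α} * I = Ideal.span {β} * J → ψ α = ψ β
  near : ∀ α β, α ≠ 0 → β ≠ 0 → (∀ v ∈ S, v.intValuation (α - β) < v.intValuation α) → ψ α = ψ β

section
variable {S : Finset (HeightOneSpectrum (𝓞 K))}
  (hcl : ∀ a : Ideal (𝓞 K), a ≠ 0 → ∃ I α, Smooth S I ∧ a * I = Ideal.span {α})
  (C : ElChar S)

lemma ElChar.exists_val
    (hcl : ∀ a : Ideal (𝓞 K), a ≠ 0 → ∃ I α, Smooth S I ∧ a * I = Ideal.span {α}) (C : ElChar S)
    (a : Ideal (𝓞 K)) (ha : a ≠ 0) :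
    ∃ z : ℂ, ∀ I α, Smooth S I → a * I = Ideal.span {α} → C.ψ α = z := by
  obtain ⟨I, α, hI, h⟩ := hcl a ha
  refine ⟨C.ψ α, fun J β hJ h' => ?_⟩
  have hα : α ≠ 0 := by rintro rfl; simp at h; exact h.elim ha hI.1
  have hβ : β ≠ 0 := by rintro rfl; simp at h'; exact h'.elim ha hJ.1
  refine C.unit β α I J hβ hα hI hJ ?_
  rw [← h, ← h']; ring

open scoped Classical in
/-- value of the character at an ideal -/
noncomputable def ElChar.val (a : Ideal (𝓞 K)) : ℂ :=
  if h : a ≠ 0 ∧ CopS S a then (C.exists_val hcl a h.1).choose else 0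

lemma ElChar.val_eq {a : Ideal (𝓞 K)} (ha : a ≠ 0) (hc : CopS S a) {I : Ideal (𝓞 K)} {α : 𝓞 K}
    (hI : Smooth S I) (h : a * I = Ideal.span {α}) : C.val hcl a = C.ψ α := by
  rw [ElChar.val, dif_pos ⟨ha, hc⟩]
  exact ((C.exists_val hcl a ha).choose_spec I α hI h).symm

lemma ElChar.val_zero {a : Ideal (𝓞 K)} (h : ¬ (a ≠ 0 ∧ CopS S a)) : C.val hcl a = 0 := dif_neg h

/-- as a multiplicative function -/
noncomputable def ElChar.hom : Ideal (𝓞 K) →*₀ ℂ where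
  toFun := C.val hcl
  map_zero' := C.val_zero hcl (by simp)
  map_one' := by
    rw [C.val_eq hcl one_ne_zero (CopS.one S) (Smooth.one S) (α := 1), map_one]
    rw [Ideal.span_singleton_one, mul_one, Ideal.one_eq_top]
  map_mul' a b := by
    by_cases ha : a ≠ 0 ∧ CopS S a
    · by_cases hb : b ≠ 0 ∧ CopS S b
      · obtain ⟨I, α, hI, h⟩ := hcl a ha.1
        obtain ⟨J, β, hJ, h'⟩ := hcl b hb.1
        rw [C.val_eq hcl ha.1 ha.2 hI h, C.val_eq hcl hb.1 hb.2 hJ h', ← map_mul]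
        refine C.val_eq hcl (mul_ne_zero ha.1 hb.1) (CopS.mul_iff.mpr ⟨ha.2, hb.2⟩) (hI.mul hJ) ?_
        rw [← Ideal.span_singleton_mul_span_singleton, ← h, ← h']; ring
      · rw [C.val_zero hcl hb, mul_zero]
        refine C.val_zero hcl fun h => hb ⟨right_ne_zero_of_mul h.1, (CopS.mul_iff.mp h.2).2⟩
    · rw [C.val_zero hcl ha, zero_mul]
      refine C.val_zero hcl fun h => ha ⟨left_ne_zero_of_mul h.1, (CopS.mul_iff.mp h.2).1⟩

lemma ElChar.val_cube {a : Ideal (𝓞 K)} (ha : a ≠ 0) (hc : CopS S a) : C.val hcl a ^ 3 = 1 := by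
  obtain ⟨I, α, hI, h⟩ := hcl a ha
  have hα : α ≠ 0 := by rintro rfl; simp at h; exact h.elim ha hI.1
  rw [C.val_eq hcl ha hc hI h, C.cube α hα]

lemma intVal_lt {b a : Ideal (𝓞 K)} {x y : 𝓞 K} (hb : b ≠ 0) (hx : Ideal.span {x} = b * a)
    {v : HeightOneSpectrum (𝓞 K)} (hv : ¬ v.asIdeal ∣ a) (hy : y ∈ v.asIdeal * b) :
    v.intValuation y < v.intValuation x := by
  obtain ⟨n, c, hc, rfl⟩ := WfDvdMonoid.max_power_factor hb v.prime.irreducible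
  have h1 : v.intValuation y ≤ WithZero.exp (-((n + 1 : ℕ) : ℤ)) := by
    rw [HeightOneSpectrum.intValuation_le_pow_iff_mem]
    have : v.asIdeal * (v.asIdeal ^ n * c) = v.asIdeal ^ (n + 1) * c := by ring
    rw [this] at hy
    exact Ideal.mul_le_left hy
  refine h1.trans_lt ?_
  rw [← not_le, HeightOneSpectrum.intValuation_le_pow_iff_mem, ← Ideal.dvd_span_singleton, hx]
  intro h
  rw [pow_succ, mul_assoc] at h
  have := (mul_dvd_mul_iff_left (pow_ne_zero n v.ne_bot)).mp h
  exact (v.prime.dvd_or_dvd this).elim hc hv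

/-- the ray class character -/
noncomputable def ElChar.ray (hS : S.Nonempty) : RayChar K (modS S) where
  toFun := C.hom hcl
  norm_le a := by
    change ‖C.val hcl a‖ ≤ 1
    by_cases ha : a ≠ 0 ∧ CopS S a
    · have h := congrArg norm (C.val_cube hcl ha.1 ha.2)
      rw [norm_pow, norm_one] at h
      exact ((pow_eq_one_iff_of_nonneg (norm_nonneg _) (by norm_num)).mp h).le
    · rw [C.val_zero hcl ha, norm_zero]; exact zero_le_one
  periodic := by
    intro b a a' x x' hb hx hx' hxx
    change C.val hcl a = C.val hcl a'
    have hne : ∀ c, CopS S c → c ≠ 0 := by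
      rintro c hc rfl
      obtain ⟨v, hv⟩ := hS
      exact hc v hv (dvd_zero _)
    have hmv : ∀ v ∈ S, ∀ z ∈ modS S * b, z ∈ v.asIdeal * b := fun v hv z hz =>
      (Ideal.mul_mono_left (Ideal.dvd_iff_le.mp (dvd_modS_iff.mpr hv)) :
        modS S * b ≤ v.asIdeal * b) hz
    have key : ∀ a a' x x', Ideal.span {x} = b * a → Ideal.span {x'} = b * a' →
        x - x' ∈ modS S * b → CopS S a → CopS S a' := by
      intro a a' x x' hx hx' hxx h v hv hd
      refine h v hv ?_
      have h1 : x' ∈ v.asIdeal * b := by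
        rw [← Ideal.dvd_span_singleton, hx', mul_comm]; exact mul_dvd_mul_left b hd
      have h2 : x ∈ v.asIdeal * b := by
        have := Ideal.add_mem _ (hmv v hv _ hxx) h1
        simpa using this
      rw [← Ideal.dvd_span_singleton, hx, mul_comm] at h2
      exact (mul_dvd_mul_iff_left hb).mp h2
    by_cases ha : CopS S a
    · have ha' : CopS S a' := key a a' x x' hx hx' hxx ha
      have h0 : x ≠ 0 := by
        rintro rfl
        rw [Ideal.span_singleton_zero] at hx
        exact mul_ne_zero hb (hne a ha) hx.symm
      have h0' : x' ≠ 0 := by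
        rintro rfl
        rw [Ideal.span_singleton_zero] at hx'
        exact mul_ne_zero hb (hne a' ha') hx'.symm
      have hψ : C.ψ x = C.ψ x' := C.near x x' h0 h0' fun v hv =>
        intVal_lt hb hx (ha v hv) (hmv v hv _ hxx)
      obtain ⟨J, γ, hJ, hγ⟩ := hcl b hb
      have hγ0 : γ ≠ 0 := by rintro rfl; simp at hγ; exact hγ.elim hb hJ.1
      have hψγ : C.ψ γ ≠ 0 := fun h => by have := C.cube γ hγ0; rw [h] at this; norm_num at this
      have hval : ∀ a x, CopS S a → x ≠ 0 → Ideal.span {x} = b * a →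
          C.ψ x = C.ψ γ * C.val hcl a := by
        intro a x ha hx0 hx
        obtain ⟨I, α, hI, h⟩ := hcl a (hne a ha)
        have hα : α ≠ 0 := by rintro rfl; simp at h; exact h.elim (hne a ha) hI.1
        rw [C.val_eq hcl (hne a ha) ha hI h, ← map_mul]
        refine C.unit x (γ * α) (J * I) 1 hx0 (mul_ne_zero hγ0 hα) (hJ.mul hI) (Smooth.one S) ?_
        rw [hx, ← Ideal.span_singleton_mul_span_singleton, ← hγ, ← h]; ring
      rw [hval a x ha h0 hx, hval a' x' ha' h0' hx'] at hψ
      exact mul_left_cancel₀ hψγ hψ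
    · have ha' : ¬ CopS S a' := fun h => ha (key a' a x' x hx' hx (by
        have := Ideal.neg_mem_iff _ |>.mpr hxx
        simpa using this) h)
      rw [C.val_zero hcl (fun h => ha h.2), C.val_zero hcl (fun h => ha' h.2)]

lemma ElChar.ray_apply (hS : S.Nonempty) (a : Ideal (𝓞 K)) :
    (C.ray hcl hS).toFun a = C.val hcl a := rfl

end

theorem char_contra {F E : Type*} [Field F] [NumberField F] [Field E] [NumberField E]
    {S : Finset (HeightOneSpectrum (𝓞 F))} (hS : S.Nonempty)
    (hcl : ∀ a : Ideal (𝓞 F), a ≠ 0 → ∃ I α, Smooth S I ∧ a * I = Ideal.span {α})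
    (C D : ElChar S)
    (π : HeightOneSpectrum (𝓞 E) → HeightOneSpectrum (𝓞 F)) (hπ : Function.Surjective π)
    (hfin : ∀ v, (π ⁻¹' {v}).Finite)
    (hsp : ∀ v : HeightOneSpectrum (𝓞 F), v ∉ S →
      ((∃ I α, Smooth S I ∧ v.asIdeal * I = Ideal.span {α} ∧ C.ψ α = 1 ∧ D.ψ α = 1) ∧
        (π ⁻¹' {v}).ncard ≤ 3 ∧
        ∀ w, π w = v → Ideal.absNorm v.asIdeal ≤ Ideal.absNorm w.asIdeal) ∨
      ((π ⁻¹' {v}).ncard ≤ 1 ∧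
        ∀ w, π w = v → Ideal.absNorm v.asIdeal ^ 3 ≤ Ideal.absNorm w.asIdeal))
    (hnt : ∀ i j : ℕ, i < 3 → j < 3 → ¬ (i = 2 ∧ j = 2) → ∃ α : 𝓞 F, α ≠ 0 ∧
      C.ψ α ^ (i + 1) * D.ψ α ^ (j + 1) ≠ 1) : False := by
  have hcop : ∀ v : HeightOneSpectrum (𝓞 F), v ∉ S → CopS S v.asIdeal := by
    intro v hv w hw hd
    have : w = v := HeightOneSpectrum.ext
      (v.isMaximal.eq_of_le w.isPrime.ne_top (Ideal.dvd_iff_le.mp hd)).symm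
    exact hv (this ▸ hw)
  refine analytic_contra (modS_ne S) (C.ray hcl hS) (D.ray hcl hS) ?_ ?_ ?_ π hπ hfin ?_ ?_
  · intro v hv
    rw [ElChar.ray_apply]
    exact C.val_zero hcl fun h => h.2 v (dvd_modS_iff.mp hv) dvd_rfl
  · intro v hv
    exact C.val_cube hcl v.ne_bot (hcop v fun h => hv (dvd_modS_iff.mpr h))
  · intro v hv
    exact D.val_cube hcl v.ne_bot (hcop v fun h => hv (dvd_modS_iff.mpr h))
  · intro v hv
    have hv' : v ∉ S := fun h => hv (dvd_modS_iff.mpr h)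
    rcases hsp v hv' with ⟨⟨I, α, hI, h, h1, h2⟩, hc, hw⟩ | h
    · left
      refine ⟨?_, ?_, hc, hw⟩
      · rw [ElChar.ray_apply, C.val_eq hcl v.ne_bot (hcop v hv') hI h, h1]
      · rw [ElChar.ray_apply, D.val_eq hcl v.ne_bot (hcop v hv') hI h, h2]
    · exact Or.inr h
  · intro i j hi hj hij
    obtain ⟨α, hα, hne⟩ := hnt i j hi hj hij
    obtain ⟨c, I, hc, hI, h⟩ := exists_decomp S (a := Ideal.span {α}) (by simpa using hα)
    have hc0 : c ≠ 0 := by rintro rfl; simp at h; exact hα h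
    refine ⟨c, hc0, hc.sup_eq_top, ?_, C.val_cube hcl hc0 hc, D.val_cube hcl hc0 hc⟩
    rw [ElChar.ray_apply, ElChar.ray_apply, C.val_eq hcl hc0 hc hI h.symm,
      D.val_eq hcl hc0 hc hI h.symm]
    exact hne

end HN


namespace HN
set_option linter.unusedSectionVars false
open Module

/-- multiplication by 3 -/
def mul3 (M : Type*) [AddCommGroup M] : M →+ M := zsmulAddGroupHom 3

lemma mul3_apply {M : Type*} [AddCommGroup M] (x : M) : mul3 M x = (3 : ℤ) • x := rfl

lemma torsion_mem_mul3 {M : Type*} [AddCommGroup M] 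
    (h3 : ∀ x : M, (3 : ℤ) • x = 0 → x = 0) (t : M) (n : ℤ) (hn : n ≠ 0) (ht : n • t = 0) :
    ∃ y, (3 : ℤ) • y = t := by
  have hfin : IsOfFinAddOrder t := by
    rw [isOfFinAddOrder_iff_zsmul_eq_zero]
    exact ⟨n, hn, ht⟩
  set k := addOrderOf t with hk
  have hk0 : 0 < k := hfin.addOrderOf_pos
  have hc : Nat.Coprime 3 k := by
    rw [Nat.Prime.coprime_iff_not_dvd Nat.prime_three]
    rintro ⟨d, hd⟩
    have h1 : (d : ℤ) • t = 0 := by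
      apply h3
      rw [smul_smul]
      have : ((3 : ℤ) * d) = ((k : ℕ) : ℤ) := by rw [hd]; push_cast; ring
      rw [this, natCast_zsmul]
      exact addOrderOf_nsmul_eq_zero t
    rw [natCast_zsmul] at h1
    have := Nat.le_of_dvd (by omega) (addOrderOf_dvd_of_nsmul_eq_zero h1)
    omega
  have hb := Nat.gcd_eq_gcd_ab 3 k
  rw [hc] at hb
  refine ⟨(Nat.gcdA 3 k) • t, ?_⟩
  rw [smul_smul]
  have hz : ((k : ℤ)) • t = 0 := by rw [natCast_zsmul]; exact addOrderOf_nsmul_eq_zero t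
  calc ((3 : ℤ) * Nat.gcdA 3 k) • t = ((3 : ℤ) * Nat.gcdA 3 k) • t + (Nat.gcdB 3 k) • ((k : ℤ) • t) := by
        rw [hz, smul_zero, add_zero]
    _ = t := by
        rw [smul_smul, ← add_smul, mul_comm (Nat.gcdB 3 k)]
        have : (3 : ℤ) * Nat.gcdA 3 k + k * Nat.gcdB 3 k = 1 := by exact_mod_cast hb.symm
        rw [this, one_smul]

lemma index_mul3 {M : Type*} [AddCommGroup M] [Module.Finite ℤ M]
    (h3 : ∀ x : M, (3 : ℤ) • x = 0 → x = 0) : (mul3 M).range.index = 3 ^ finrank ℤ M := by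
  classical
  let T := Submodule.torsion ℤ M
  let Q := M ⧸ T
  let r := finrank ℤ Q
  have hrQ : r = finrank ℤ M := by
    have := rank_quotient_eq_of_le_torsion (R := ℤ) (M := M) (M' := T) le_rfl
    exact congrArg Cardinal.toNat this
  let b : Basis (Fin r) ℤ Q := Module.finBasis ℤ Q
  let g : M →+ (Fin r → ZMod 3) :=
    { toFun := fun x i => ((b.repr (T.mkQ x) i : ℤ) : ZMod 3)
      map_zero' := by ext i; simp
      map_add' := fun x y => by ext i; simp }
  have hg : Function.Surjective g := by
    intro f
    choose c hc using fun i => ZMod.intCast_surjective (f i)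
    obtain ⟨x, hx⟩ := T.mkQ_surjective (b.equivFun.symm c)
    refine ⟨x, ?_⟩
    ext i
    change ((b.repr (T.mkQ x) i : ℤ) : ZMod 3) = f i
    rw [hx, ← Basis.equivFun_apply, LinearEquiv.apply_symm_apply, hc]
  have hker : g.ker = (mul3 M).range := by
    ext x
    constructor
    · intro hx
      have hx' : ∀ i, ((b.repr (T.mkQ x) i : ℤ) : ZMod 3) = 0 := fun i => congrFun hx i
      have hd : ∀ i, (3 : ℤ) ∣ b.repr (T.mkQ x) i := fun i => by
        have := (ZMod.intCast_zmod_eq_zero_iff_dvd (b.repr (T.mkQ x) i) 3).mp (hx' i)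
        exact_mod_cast this
      choose c hc using hd
      obtain ⟨y, hy⟩ := T.mkQ_surjective (b.equivFun.symm c)
      have hxy : T.mkQ (x - (3 : ℤ) • y) = 0 := by
        rw [map_sub, map_smul, hy, sub_eq_zero]
        apply b.equivFun.injective
        rw [map_smul, LinearEquiv.apply_symm_apply]
        ext i
        rw [Basis.equivFun_apply, hc i]; simp
      rw [Submodule.mkQ_apply, Submodule.Quotient.mk_eq_zero, Submodule.mem_torsion_iff] at hxy
      obtain ⟨a, ha⟩ := hxy
      obtain ⟨z, hz⟩ := torsion_mem_mul3 h3 _ a.1 (nonZeroDivisors.coe_ne_zero a) ha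
      refine ⟨z + y, ?_⟩
      rw [mul3_apply, smul_add, hz]; abel
    · rintro ⟨y, rfl⟩
      change g _ = 0
      ext i
      change ((b.repr (T.mkQ ((3 : ℤ) • y)) i : ℤ) : ZMod 3) = 0
      rw [map_smul, map_smul, Finsupp.smul_apply, smul_eq_mul, Int.cast_mul]
      have : ((3 : ℤ) : ZMod 3) = 0 := by decide
      rw [this, zero_mul]
  rw [← hker, AddSubgroup.index_ker, AddMonoidHom.range_eq_top_of_surjective g hg, ← hrQ]
  simp

section herbrand
variable {M : Type*} [AddCommGroup M] [Module.Finite ℤ M]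
  (h3 : ∀ x : M, (3 : ℤ) • x = 0 → x = 0) (σ : M →+ M) (hσ : ∀ x, σ (σ (σ x)) = x)
  (h90 : ∀ x, x + σ x + σ (σ x) = 0 → ∃ y, x = y - σ y)

/-- norm map -/
def nmap (σ : M →+ M) : M →+ M := AddMonoidHom.id M + σ + σ.comp σ
/-- `1 - σ` -/
def dmap (σ : M →+ M) : M →+ M := AddMonoidHom.id M - σ

lemma nmap_apply (x : M) : nmap σ x = x + σ x + σ (σ x) := rfl
lemma dmap_apply (x : M) : dmap σ x = x - σ x := rfl

theorem herbrand (h3 : ∀ x : M, (3 : ℤ) • x = 0 → x = 0) (σ : M →+ M) (hσ : ∀ x, σ (σ (σ x)) = x)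
    (h90 : ∀ x, x + σ x + σ (σ x) = 0 → ∃ y, x = y - σ y) : ((nmap σ).range.relIndex (dmap σ).ker) ^ 2 * 3 ^ finrank ℤ M =
    3 ^ (3 * finrank ℤ (dmap σ).ker) := by
  set N := nmap σ
  set D := dmap σ
  have hND : D.range = N.ker := by
    ext x
    constructor
    · rintro ⟨y, rfl⟩
      change nmap σ (dmap σ y) = 0
      rw [nmap_apply, dmap_apply]; simp only [map_sub, hσ]; abel
    · intro hx
      obtain ⟨y, hy⟩ := h90 x hx
      exact ⟨y, hy.symm⟩
  have hind : ∀ H : AddSubgroup M, (H.map (mul3 M)).relIndex H = 3 ^ finrank ℤ H := by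
    intro H
    have : Module.Finite ℤ H := by
      change Module.Finite ℤ (AddSubgroup.toIntSubmodule H)
      infer_instance
    rw [← index_mul3 (M := H) (fun x hx => by
      apply Subtype.ext; apply h3; exact congrArg Subtype.val hx), AddSubgroup.relIndex]
    congr 1
    ext x
    rw [AddSubgroup.mem_addSubgroupOf]
    constructor
    · rintro ⟨y, hy, h⟩; exact ⟨⟨y, hy⟩, Subtype.ext h⟩
    · rintro ⟨y, h⟩; exact ⟨y, y.2, congrArg Subtype.val h⟩
  have hrank : finrank ℤ M = finrank ℤ D.ker + finrank ℤ N.ker := by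
    have h := Submodule.finrank_quotient_add_finrank (LinearMap.ker D.toIntLinearMap)
    rw [D.toIntLinearMap.quotKerEquivRange.finrank_eq] at h
    rw [← hND, ← h, add_comm]
    rfl
  have hσK : ∀ x ∈ N.ker, σ x ∈ N.ker := by
    intro x hx
    have hx : x + σ x + σ (σ x) = 0 := hx
    change nmap σ (σ x) = 0
    rw [nmap_apply, hσ, ← hx]; abel
  have hDDx : ∀ x ∈ N.ker, D (D x) = mul3 M (- σ x) := by
    intro x hx
    have hx : x + σ x + σ (σ x) = 0 := hx
    change dmap σ (dmap σ x) = _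
    rw [mul3_apply, dmap_apply, dmap_apply, map_sub]
    have : σ (σ x) = - x - σ x := by rw [← sub_eq_zero, ← hx]; abel
    rw [this]; abel
  -- f
  set f := (N.ker.map D).relIndex N.ker with hf
  have hf2 : f ^ 2 = 3 ^ finrank ℤ N.ker := by
    rw [← hind N.ker]
    have h1 : (N.ker.map D).map D = N.ker.map (mul3 M) := by
      ext z
      constructor
      · rintro ⟨_, ⟨x, hx, rfl⟩, rfl⟩
        exact ⟨- σ x, neg_mem (hσK x hx), (hDDx x hx).symm⟩
      · rintro ⟨x, hx, rfl⟩
        refine ⟨D (- σ (σ x)), ⟨_, neg_mem (hσK _ (hσK x hx)), rfl⟩, ?_⟩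
        rw [hDDx _ (neg_mem (hσK _ (hσK x hx))), map_neg σ, neg_neg, hσ]
    have h2 : N.ker.map D ≤ N.ker := by
      rw [← hND]; rintro _ ⟨y, _, rfl⟩; exact ⟨y, rfl⟩
    rw [← h1, ← AddSubgroup.relIndex_mul_relIndex _ _ _ (AddSubgroup.map_mono h2) h2, pow_two, ← hf]
    congr 1
    rw [← AddSubgroup.relIndex_comap, hf, ← AddSubgroup.inf_relIndex_right,
      ← AddSubgroup.inf_relIndex_right (AddSubgroup.comap D _)]
    congr 1
    ext x
    simp only [AddSubgroup.mem_inf]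
    refine and_congr_left fun hx => ⟨fun h => ⟨x, h, rfl⟩, ?_⟩
    rintro ⟨y, hy, hyx⟩
    have hd : D (y - x) = 0 := by rw [map_sub, hyx, sub_self]
    have hn : N (y - x) = 0 := by
      rw [map_sub, show N x = 0 from hx, show N y = 0 from h2 hy, sub_self]
    have hs : σ (y - x) = y - x := (sub_eq_zero.mp hd).symm
    have hn' : nmap σ (y - x) = 0 := hn
    rw [nmap_apply, hs, hs] at hn'
    have : y - x = 0 := h3 _ (by rw [← hn']; abel)
    rw [← sub_eq_zero.mp this]; exact hy
  have hDk : ∀ x ∈ D.ker, N x = (3 : ℤ) • x := by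
    intro x hx
    have hx : σ x = x := (sub_eq_zero.mp hx).symm
    change nmap σ x = _
    rw [nmap_apply, hx, hx]; abel
  have hm : D.ker.map (mul3 M) = D.ker.map N := by
    ext x
    constructor
    · rintro ⟨y, hy, rfl⟩; exact ⟨y, hy, hDk y hy⟩
    · rintro ⟨y, hy, rfl⟩; exact ⟨y, hy, (hDk y hy).symm⟩
  have hNle : N.range ≤ D.ker := by
    rintro _ ⟨y, rfl⟩
    change dmap σ (nmap σ y) = 0
    rw [nmap_apply, dmap_apply]; simp only [map_add, hσ]; abel
  have e1 : (D.ker.map N).relIndex N.range = f := by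
    have q1 : N.range = (⊤ : AddSubgroup M).map N := AddMonoidHom.range_eq_map N
    have q2 : f = (N.ker.map D).relIndex ((⊤ : AddSubgroup M).map D) := by
      rw [← AddMonoidHom.range_eq_map D, hND]
    rw [q2, q1, AddSubgroup.relIndex_map_map, AddSubgroup.relIndex_map_map, sup_comm N.ker]
    simp
  have e2 : f * N.range.relIndex D.ker = 3 ^ finrank ℤ D.ker := by
    rw [← hind D.ker, hm, ← e1]
    refine AddSubgroup.relIndex_mul_relIndex _ _ _ ?_ hNle
    rintro _ ⟨y, _, rfl⟩; exact ⟨y, rfl⟩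
  calc N.range.relIndex D.ker ^ 2 * 3 ^ finrank ℤ M
      = (f * N.range.relIndex D.ker) ^ 2 * 3 ^ finrank ℤ D.ker := by
        rw [hrank, pow_add, mul_pow, hf2]; ring
    _ = _ := by rw [e2]; ring

end herbrand
end HN


namespace HN
set_option linter.unusedSectionVars false
open Module NumberField IsDedekindDomain

section
variable {K : Type*} [Field K]

/-- `a`-units of `K` -/
def SU (a : K) : Subgroup Kˣ where
  carrier := {x | (∃ k : ℕ, IsIntegral ℤ (a ^ k * (x : K))) ∧
    ∃ k : ℕ, IsIntegral ℤ (a ^ k * ((x⁻¹ : Kˣ) : K))}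
  one_mem' := ⟨⟨0, by simpa using isIntegral_one⟩, ⟨0, by simpa using isIntegral_one⟩⟩
  mul_mem' := by
    rintro x y ⟨⟨k, hk⟩, ⟨l, hl⟩⟩ ⟨⟨k', hk'⟩, ⟨l', hl'⟩⟩
    refine ⟨⟨k + k', ?_⟩, ⟨l + l', ?_⟩⟩
    · have : a ^ (k + k') * ((x * y : Kˣ) : K) = (a ^ k * (x : K)) * (a ^ k' * (y : K)) := by
        push_cast; ring
      rw [this]; exact hk.mul hk'
    · have : a ^ (l + l') * (((x * y)⁻¹ : Kˣ) : K) =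
          (a ^ l * ((x⁻¹ : Kˣ) : K)) * (a ^ l' * ((y⁻¹ : Kˣ) : K)) := by
        rw [mul_inv]; push_cast; ring
      rw [this]; exact hl.mul hl'
  inv_mem' := by
    rintro x ⟨h1, h2⟩
    exact ⟨h2, by rwa [inv_inv]⟩

lemma mem_SU {a : K} {x : Kˣ} : x ∈ SU a ↔ (∃ k : ℕ, IsIntegral ℤ (a ^ k * (x : K))) ∧
    ∃ k : ℕ, IsIntegral ℤ (a ^ k * ((x⁻¹ : Kˣ) : K)) := Iff.rfl
end

section
variable {K : Type*} [Field K] [NumberField K] {a : 𝓞 K} (ha : a ≠ 0)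

/-- primes dividing `a` -/
def SP (a : 𝓞 K) : Set (HeightOneSpectrum (𝓞 K)) := {v | a ∈ v.asIdeal}

lemma SP_finite (ha : a ≠ 0) : (SP a).Finite := by
  have := Ideal.finite_factors (I := Ideal.span {a}) (by simpa using ha)
  refine this.subset fun v hv => ?_
  change v.asIdeal ∣ _
  rw [Ideal.dvd_span_singleton]; exact hv

lemma val_le_one_of_SU {a : 𝓞 K} {x : K} {k : ℕ} (h : IsIntegral ℤ ((a : K) ^ k * x))
    {v : HeightOneSpectrum (𝓞 K)} (hv : v ∉ SP a) : v.valuation K x ≤ 1 := by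
  have h1 : v.valuation K ((a : K) ^ k * x) ≤ 1 := v.valuation_le_one (⟨_, h⟩ : 𝓞 K)
  rw [map_mul, map_pow] at h1
  have : v.valuation K (a : K) = 1 := v.valuation_eq_one_iff_notMem.mpr hv
  rwa [this, one_pow, one_mul] at h1

lemma val_eq_one_of_SU {a : 𝓞 K} {x : Kˣ} (hx : x ∈ SU (a : K))
    {v : HeightOneSpectrum (𝓞 K)} (hv : v ∉ SP a) : v.valuation K (x : K) = 1 := by
  obtain ⟨⟨k, hk⟩, ⟨l, hl⟩⟩ := hx
  refine le_antisymm (val_le_one_of_SU hk hv) ?_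
  have := val_le_one_of_SU hl hv
  rw [Units.val_inv_eq_inv_val, map_inv₀] at this
  have h0 : 0 < v.valuation K (x : K) := by simp [zero_lt_iff]
  exact (inv_le_one₀ h0).mp this

/-- the valuation map on `a`-units -/
noncomputable def valMap (a : 𝓞 K) : Additive (SU (a : K)) →+ (SP a → ℤ) where
  toFun x v := WithZero.log (v.1.valuation K ((x.toMul : Kˣ) : K))
  map_zero' := by ext v; simp
  map_add' x y := by
    ext v
    simp only [toMul_add, Subgroup.coe_mul, Units.val_mul, map_mul, Pi.add_apply]
    rw [WithZero.log_mul] <;> simp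

/-- units to `a`-units -/
noncomputable def unitsToSU (a : 𝓞 K) : Additive (𝓞 K)ˣ →+ Additive (SU (a : K)) :=
  MonoidHom.toAdditive (MonoidHom.codRestrict (Units.map (algebraMap (𝓞 K) K : 𝓞 K →* K)) _ (fun u =>
    ⟨⟨0, by simpa using (u : 𝓞 K).isIntegral_coe⟩,
     ⟨0, by simpa [-Units.val_inv_eq_inv_val] using ((u⁻¹ : (𝓞 K)ˣ) : 𝓞 K).isIntegral_coe⟩⟩))

lemma unitsToSU_inj (a : 𝓞 K) : Function.Injective (unitsToSU a) := by
  intro x y h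
  have h1 := congrArg (fun z : Additive (SU (a : K)) => ((z.toMul : Kˣ) : K)) h
  apply Additive.toMul.injective
  apply Units.ext
  exact RingOfIntegers.ext h1

lemma unitsToSU_range (a : 𝓞 K) : (unitsToSU a).range = (valMap a).ker := by
  ext x
  constructor
  · rintro ⟨u, rfl⟩
    change valMap a _ = 0
    ext v
    change WithZero.log (v.1.valuation K (((u.toMul : (𝓞 K)ˣ) : 𝓞 K) : K)) = 0
    rw [v.1.valuation_eq_one_iff_notMem.mpr, WithZero.log_one]
    exact fun h => v.1.isPrime.ne_top (Ideal.eq_top_of_isUnit_mem _ h u.toMul.isUnit)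
  · intro hx
    have h1 : ∀ v : HeightOneSpectrum (𝓞 K), v.valuation K ((x.toMul : Kˣ) : K) = 1 := by
      intro v
      by_cases hv : v ∈ SP a
      · have : WithZero.log (v.valuation K ((x.toMul : Kˣ) : K)) = 0 := congrFun hx ⟨v, hv⟩
        have h0 : v.valuation K ((x.toMul : Kˣ) : K) ≠ 0 := by simp
        rw [← WithZero.exp_log h0, this, WithZero.exp_zero]
      · exact val_eq_one_of_SU x.toMul.2 hv
    obtain ⟨α, hα⟩ := HeightOneSpectrum.mem_integers_of_valuation_le_one (R := 𝓞 K) K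
      ((x.toMul : Kˣ) : K) (fun v => (h1 v).le)
    obtain ⟨β, hβ⟩ := HeightOneSpectrum.mem_integers_of_valuation_le_one (R := 𝓞 K) K
      (((x.toMul : Kˣ)⁻¹ : Kˣ) : K) (fun v => by rw [Units.val_inv_eq_inv_val, map_inv₀, h1 v, inv_one])
    have hab : α * β = 1 := by
      apply FaithfulSMul.algebraMap_injective (𝓞 K) K
      rw [map_mul, hα, hβ, map_one]; simp
    refine ⟨Additive.ofMul ⟨α, β, hab, by rw [mul_comm, hab]⟩, ?_⟩
    apply Additive.toMul.injective
    apply Subtype.ext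
    apply Units.ext
    exact hα

lemma exists_pow_principal (I : Ideal (𝓞 K)) : 
    ∃ x : 𝓞 K, I ^ (Fintype.card (ClassGroup (𝓞 K))) = Ideal.span {x} := by
  classical
  by_cases hI : I = 0
  · exact ⟨0, by simp [hI]⟩
  let J : nonZeroDivisors (Ideal (𝓞 K)) := ⟨I, mem_nonZeroDivisors_of_ne_zero hI⟩
  have : ClassGroup.mk0 (J ^ (Fintype.card (ClassGroup (𝓞 K)))) = 1 := by
    rw [map_pow, pow_card_eq_one]
  have := (ClassGroup.mk0_eq_one_iff (J ^ (Fintype.card (ClassGroup (𝓞 K)))).2).mp this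
  obtain ⟨x, hx⟩ := this
  exact ⟨x, hx⟩

open scoped Classical in
lemma valMap_big (v : SP a) : ∃ x : Additive (SU (a : K)), ∃ c : ℤ, c ≠ 0 ∧
    valMap a x = Pi.single v c := by
  classical
  obtain ⟨x, hx⟩ := exists_pow_principal v.1.asIdeal
  set h := Fintype.card (ClassGroup (𝓞 K)) with hh
  have hh0 : 0 < h := Fintype.card_pos
  have hx0 : x ≠ 0 := by
    rintro rfl
    have := pow_ne_zero h v.1.ne_bot
    exact this (by rw [hx]; simp)
  have hxK : (x : K) ≠ 0 := by simpa using hx0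
  obtain ⟨y, hy⟩ : x ∣ a ^ h := by
    rw [← Ideal.mem_span_singleton, ← hx]
    exact Ideal.pow_mem_pow v.2 h
  let X : Kˣ := Units.mk0 (x : K) hxK
  have hX : X ∈ SU (a : K) := by
    refine ⟨⟨0, by simpa [X] using x.isIntegral_coe⟩, ⟨h, ?_⟩⟩
    have : (a : K) ^ h * ((X⁻¹ : Kˣ) : K) = (y : K) := by
      have := congrArg (fun z : 𝓞 K => (z : K)) hy
      simp only [map_pow, map_mul] at this
      simp only [X, Units.val_inv_eq_inv_val, Units.val_mk0]
      rw [this]; field_simp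
    rw [this]; exact y.isIntegral_coe
  have hval : ∀ w : HeightOneSpectrum (𝓞 K), x ∈ w.asIdeal ↔ w = v.1 := by
    intro w
    constructor
    · intro hw
      have : v.1.asIdeal ^ h ≤ w.asIdeal := by rw [hx]; simpa [Ideal.span_le] using hw
      have := w.isPrime.le_of_pow_le this
      have := (v.1.isMaximal.eq_of_le w.isPrime.ne_top this)
      exact HeightOneSpectrum.ext this.symm
    · rintro rfl
      have : x ∈ v.1.asIdeal ^ h := by rw [hx]; exact Ideal.mem_span_singleton_self x
      exact Ideal.pow_le_self hh0.ne' this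
  refine ⟨Additive.ofMul ⟨X, hX⟩, WithZero.log (v.1.valuation K (x : K)), ?_, ?_⟩
  · intro h0
    have hne : v.1.valuation K (x : K) ≠ 0 := by simpa using hx0
    have : v.1.valuation K (x : K) = 1 := by
      rw [← WithZero.exp_log hne, h0, WithZero.exp_zero]
    exact v.1.valuation_eq_one_iff_notMem.mp this ((hval v.1).mpr rfl)
  · ext w
    by_cases hw : w = v
    · subst hw; rw [Pi.single_eq_same]; rfl
    · rw [Pi.single_eq_of_ne hw]
      change WithZero.log (w.1.valuation K (x : K)) = 0
      rw [w.1.valuation_eq_one_iff_notMem.mpr, WithZero.log_one]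
      rw [hval]
      exact fun h => hw (Subtype.ext h)

theorem SU_finite (ha : a ≠ 0) : Module.Finite ℤ (Additive (SU (a : K))) := by
  have : Finite (SP a) := SP_finite ha
  have := Fintype.ofFinite (SP a)
  have h1 : Module.Finite ℤ (LinearMap.range (valMap a).toIntLinearMap) := inferInstance
  have h0 : Module.Finite ℤ (Additive (𝓞 K)ˣ) := by
    rw [Module.Finite.iff_addGroup_fg, ← GroupFG.iff_add_fg]
    exact Group.fg_iff_monoid_fg.mpr inferInstance
  have h2 : Module.Finite ℤ (LinearMap.ker (valMap a).toIntLinearMap) := by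
    have : LinearMap.ker (valMap a).toIntLinearMap = LinearMap.range (unitsToSU a).toIntLinearMap := by
      ext x
      exact (SetLike.ext_iff.mp (unitsToSU_range a) x).symm
    rw [this]; infer_instance
  rw [Module.Finite.iff_fg] at h1 h2
  constructor
  apply Submodule.fg_of_fg_map_of_fg_inf_ker (valMap a).toIntLinearMap
  · rwa [Submodule.map_top]
  · rwa [top_inf_eq]

theorem SU_finrank (ha : a ≠ 0) : finrank ℤ (Additive (SU (a : K))) = Units.rank K + (SP a).ncard := by
  classical
  have : Finite (SP a) := SP_finite ha
  have := Fintype.ofFinite (SP a)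
  have := SU_finite ha
  have h := Submodule.finrank_quotient_add_finrank (LinearMap.ker (valMap a).toIntLinearMap)
  rw [(valMap a).toIntLinearMap.quotKerEquivRange.finrank_eq] at h
  have h2 : finrank ℤ (LinearMap.ker (valMap a).toIntLinearMap) = Units.rank K := by
    have : LinearMap.ker (valMap a).toIntLinearMap = LinearMap.range (unitsToSU a).toIntLinearMap := by
      ext x
      exact (SetLike.ext_iff.mp (unitsToSU_range a) x).symm
    rw [this, LinearMap.finrank_range_of_inj (unitsToSU_inj a), Units.finrank_eq]
  have h1 : finrank ℤ (LinearMap.range (valMap a).toIntLinearMap) = (SP a).ncard := by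
    have hc : (SP a).ncard = finrank ℤ (SP a → ℤ) := by
      rw [finrank_fintype_fun_eq_card, Set.ncard_eq_toFinset_card', Set.toFinset_card]
    apply le_antisymm
    · rw [hc]; exact Submodule.finrank_le _
    · choose x c hc0 hx using fun v : SP a => valMap_big v
      have hli : LinearIndependent ℤ (fun v : SP a =>
          (⟨valMap a (x v), ⟨x v, rfl⟩⟩ : LinearMap.range (valMap a).toIntLinearMap)) := by
        apply LinearIndependent.of_comp (Submodule.subtype _)
        rw [Fintype.linearIndependent_iff]
        intro g hg v
        have := congrFun hg v
        simp only [Function.comp, Submodule.subtype_apply, hx, Finset.sum_apply, Pi.smul_apply,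
          Pi.zero_apply, smul_eq_mul, Pi.single_apply] at this
        simpa [hc0] using this
      have := hli.fintype_card_le_finrank
      rwa [Set.ncard_eq_toFinset_card', Set.toFinset_card]
  rw [← h, h1, h2, add_comm]
end
end HN


namespace HN
set_option linter.unusedSectionVars false
open Module NumberField IsDedekindDomain Pointwise

section
variable (F E : Type*) [Field F] [NumberField F] [Field E] [NumberField E] [Algebra F E]
  [IsGalois F E] 

/-- `v` is unramified in `E` -/
def Unr (v : HeightOneSpectrum (𝓞 F)) : Prop := Ideal.ramificationIdxIn v.asIdeal (𝓞 E) = 1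

/-- the primes over `v` -/
def Fib (v : HeightOneSpectrum (𝓞 F)) : Set (HeightOneSpectrum (𝓞 E)) :=
  (HeightOneSpectrum.under (𝓞 F)) ⁻¹' {v}

variable {F E}

lemma mem_Fib {v : HeightOneSpectrum (𝓞 F)} {w : HeightOneSpectrum (𝓞 E)} :
  w ∈ Fib F E v ↔ w.under (𝓞 F) = v := Iff.rfl

lemma Fib_liesOver {v : HeightOneSpectrum (𝓞 F)} {w : HeightOneSpectrum (𝓞 E)} (h : w ∈ Fib F E v) :
    w.asIdeal.LiesOver v.asIdeal := by
  rw [mem_Fib] at h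
  subst h
  exact ⟨rfl⟩

lemma Fib_image (v : HeightOneSpectrum (𝓞 F)) :
    HeightOneSpectrum.asIdeal '' (Fib F E v) = Ideal.primesOver v.asIdeal (𝓞 E) := by
  ext P
  constructor
  · rintro ⟨w, hw, rfl⟩
    exact ⟨w.isPrime, Fib_liesOver hw⟩
  · rintro ⟨h1, h2⟩
    have hP : P ≠ ⊥ := Ideal.ne_bot_of_liesOver_of_ne_bot v.ne_bot P
    exact ⟨⟨P, h1, hP⟩, HeightOneSpectrum.ext h2.over.symm, rfl⟩

lemma asIdeal_inj : Function.Injective (HeightOneSpectrum.asIdeal (R := 𝓞 E)) :=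
  fun _ _ h => HeightOneSpectrum.ext h

lemma Fib_ncard (v : HeightOneSpectrum (𝓞 F)) :
    (Fib F E v).ncard = (Ideal.primesOver v.asIdeal (𝓞 E)).ncard := by
  rw [← Fib_image, Set.ncard_image_of_injective _ asIdeal_inj]

lemma Fib_finite (v : HeightOneSpectrum (𝓞 F)) : (Fib F E v).Finite := by
  apply Set.Finite.of_finite_image _ asIdeal_inj.injOn
  rw [Fib_image]
  exact IsDedekindDomain.primesOver_finite _ _

lemma Fib_mul (v : HeightOneSpectrum (𝓞 F)) : (Fib F E v).ncard *
    (Ideal.ramificationIdxIn v.asIdeal (𝓞 E) * Ideal.inertiaDegIn v.asIdeal (𝓞 E)) = finrank F E := by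
  rw [Fib_ncard, Ideal.ncard_primesOver_mul_ramificationIdxIn_mul_inertiaDegIn v.asIdeal (𝓞 E) Gal(E/F),
    IsGalois.card_aut_eq_finrank]

lemma relNorm_Fib {v : HeightOneSpectrum (𝓞 F)} {w : HeightOneSpectrum (𝓞 E)} (h : w ∈ Fib F E v) :
    Ideal.relNorm (𝓞 F) w.asIdeal = v.asIdeal ^ Ideal.inertiaDegIn v.asIdeal (𝓞 E) := by
  have := Fib_liesOver h
  have := w.isMaximal
  have := v.isMaximal
  rw [Ideal.inertiaDegIn_eq_inertiaDeg v.asIdeal w.asIdeal Gal(E/F)]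
  exact Ideal.relNorm_eq_pow_of_isMaximal w.asIdeal v.asIdeal

lemma absNorm_Fib {v : HeightOneSpectrum (𝓞 F)} {w : HeightOneSpectrum (𝓞 E)} (h : w ∈ Fib F E v) :
    Ideal.absNorm w.asIdeal = Ideal.absNorm v.asIdeal ^ Ideal.inertiaDegIn v.asIdeal (𝓞 E) := by
  rw [← map_pow, ← relNorm_Fib h, Ideal.absNorm_relNorm]

lemma map_eq_prod {v : HeightOneSpectrum (𝓞 F)} (hv : Unr F E v) :
    v.asIdeal.map (algebraMap (𝓞 F) (𝓞 E)) = ∏ w ∈ (Fib_finite (E := E) v).toFinset, w.asIdeal := by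
  classical
  have := v.isMaximal
  rw [Ideal.map_algebraMap_eq_finsetProd_pow v.ne_bot]
  have : (Ideal.primesOver v.asIdeal (𝓞 E)).toFinset =
      (Fib_finite (E := E) v).toFinset.image HeightOneSpectrum.asIdeal := by
    ext P; simp [← Fib_image]
  rw [this, Finset.prod_image asIdeal_inj.injOn]
  apply Finset.prod_congr rfl
  intro w hw
  have := Fib_liesOver ((Set.Finite.mem_toFinset _).mp hw)
  rw [← Ideal.ramificationIdxIn_eq_ramificationIdx v.asIdeal w.asIdeal Gal(E/F), hv, pow_one]

lemma smul_map (g : Gal(E/F)) (I : Ideal (𝓞 F)) :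
    g • (I.map (algebraMap (𝓞 F) (𝓞 E))) = I.map (algebraMap (𝓞 F) (𝓞 E)) := by
  rw [Ideal.pointwise_smul_def, Ideal.map_map]
  congr 1
  ext x
  exact congrArg (fun y : 𝓞 E => (y : E)) (smul_algebraMap g x)

lemma inv_ext (n : ℕ) : ∀ A : Ideal (𝓞 E), A ≠ 0 → Ideal.absNorm A = n → (∀ g : Gal(E/F), g • A = A) →
    (∀ w : HeightOneSpectrum (𝓞 E), w.asIdeal ∣ A → Unr F E (w.under (𝓞 F))) →
    ∃ A' : Ideal (𝓞 F), A = A'.map (algebraMap (𝓞 F) (𝓞 E)) := by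
  induction n using Nat.strong_induction_on with
  | _ n ih =>
  intro A hA hn hinv hur
  by_cases hA1 : A = ⊤
  · exact ⟨⊤, by rw [hA1, Ideal.map_top]⟩
  obtain ⟨M, hM, hAM⟩ := Ideal.exists_le_maximal A hA1
  have hM0 : M ≠ ⊥ := fun h => hA (by rw [h] at hAM; exact le_bot_iff.mp hAM)
  let w : HeightOneSpectrum (𝓞 E) := ⟨M, hM.isPrime, hM0⟩
  set v := w.under (𝓞 F) with hv
  have hwA : w.asIdeal ∣ A := Ideal.dvd_iff_le.mpr hAM
  have hd : v.asIdeal.map (algebraMap (𝓞 F) (𝓞 E)) ∣ A := by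
    rw [map_eq_prod (hur w hwA)]
    apply Finset.prod_dvd_of_coprime
    · intro w1 _ w2 _ h
      have h1 := w1.isMaximal
      have h2 := w2.isMaximal
      exact (Ideal.isCoprime_iff_sup_eq.mpr (h1.coprime_of_ne h2 fun h' => h (asIdeal_inj h')))
    · intro w' hw'
      have l1 := Fib_liesOver ((Set.Finite.mem_toFinset _).mp hw')
      have l2 : w.asIdeal.LiesOver v.asIdeal := ⟨rfl⟩
      obtain ⟨g, hg⟩ := Ideal.exists_smul_eq_of_isGaloisGroup v.asIdeal w.asIdeal w'.asIdeal Gal(E/F)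
      rw [← hg, Ideal.dvd_iff_le, ← hinv g]
      exact Ideal.pointwise_smul_le_pointwise_smul_iff.mpr hAM
  obtain ⟨A₁, hA₁⟩ := hd
  set V := v.asIdeal.map (algebraMap (𝓞 F) (𝓞 E)) with hV
  have hV0 : V ≠ 0 := fun h => hA (by rw [hA₁, h, zero_mul])
  have hA₁0 : A₁ ≠ 0 := fun h => hA (by rw [hA₁, h, mul_zero])
  have hVt : V ≠ ⊤ := by
    intro h
    have : V ≤ w.asIdeal := Ideal.map_le_iff_le_comap.mpr le_rfl
    rw [h] at this
    exact w.isPrime.ne_top (top_le_iff.mp this)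
  obtain ⟨A', hA'⟩ := ih (Ideal.absNorm A₁) (by
    rw [← hn, hA₁, map_mul]
    have h1 : Ideal.absNorm V ≠ 1 := by rwa [Ne, Ideal.absNorm_eq_one_iff]
    have h2 : Ideal.absNorm V ≠ 0 := by rwa [Ne, Ideal.absNorm_eq_zero_iff]
    have h3 : Ideal.absNorm A₁ ≠ 0 := by rwa [Ne, Ideal.absNorm_eq_zero_iff]
    have : 2 ≤ Ideal.absNorm V := by omega
    nlinarith [Nat.pos_of_ne_zero h3]) A₁ hA₁0 rfl (by
    intro g
    have := hinv g
    rw [hA₁, smul_mul', smul_map] at this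
    exact mul_left_cancel₀ hV0 this) (fun w hw => hur w (hw.trans ⟨V, by rw [hA₁, mul_comm]⟩))
  exact ⟨v.asIdeal * A', by rw [Ideal.map_mul, ← hA', hA₁]⟩

end
end HN


namespace HN
set_option linter.unusedSectionVars false
open Module NumberField IsDedekindDomain Pointwise

/-- saturation of `(z)` at `a` -/
def sat {R : Type*} [CommRing R] (a z : R) : Ideal R where
  carrier := {x | ∃ k : ℕ, z ∣ a ^ k * x}
  zero_mem' := ⟨0, by simp⟩
  add_mem' := by
    rintro x y ⟨k, hk⟩ ⟨l, hl⟩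
    refine ⟨k + l, ?_⟩
    have : a ^ (k + l) * (x + y) = a ^ l * (a ^ k * x) + a ^ k * (a ^ l * y) := by ring
    rw [this]
    exact dvd_add (hk.mul_left _) (hl.mul_left _)
  smul_mem' := by
    rintro c x ⟨k, hk⟩
    refine ⟨k, ?_⟩
    rw [smul_eq_mul, mul_left_comm]
    exact hk.mul_left _

lemma mem_sat {R : Type*} [CommRing R] {a z x : R} : x ∈ sat a z ↔ ∃ k : ℕ, z ∣ a ^ k * x := Iff.rfl

section
variable {F E : Type} [Field F] [NumberField F] [Field E] [NumberField E] [Algebra F E]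
  [IsGalois F E] 

lemma sat_smul_le (g : Gal(E/F)) (a : 𝓞 F) (z : 𝓞 E) (k : ℕ)
    (h : z ∣ (algebraMap (𝓞 F) (𝓞 E) a) ^ k * (g • z)) :
    g • sat (algebraMap (𝓞 F) (𝓞 E) a) z ≤ sat (algebraMap (𝓞 F) (𝓞 E) a) z := by
  intro x hx
  rw [Ideal.mem_pointwise_smul_iff_inv_smul_mem] at hx
  obtain ⟨l, m, hm⟩ := hx
  refine ⟨k + l, ?_⟩
  have h2 := congrArg (fun y => g • y) hm
  simp only [smul_mul', smul_pow', smul_algebraMap, smul_inv_smul] at h2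
  rw [pow_add, mul_assoc, h2, ← mul_assoc]
  exact h.mul_right _

lemma sat_ne_zero (a z : 𝓞 E) (hz : z ≠ 0) : sat a z ≠ 0 := by
  intro h
  have : z ∈ sat a z := ⟨0, by simp⟩
  rw [h] at this
  exact hz this

lemma notMem_of_dvd_sat (a z : 𝓞 E) (hz : z ≠ 0) (w : HeightOneSpectrum (𝓞 E))
    (hw : w.asIdeal ∣ sat a z) : a ∉ w.asIdeal := by
  intro ha
  obtain ⟨C, hC⟩ := hw
  have hC0 : C ≠ 0 := fun h => sat_ne_zero a z hz (by rw [hC, h, mul_zero])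
  have h1 : C ≤ sat a z := by
    intro c hc
    have : a * c ∈ sat a z := by rw [hC]; exact Ideal.mul_mem_mul ha hc
    obtain ⟨k, hk⟩ := this
    exact ⟨k + 1, by rwa [pow_succ, mul_assoc]⟩
  have h2 : sat a z = C := le_antisymm (hC ▸ Ideal.mul_le_right) h1
  rw [h2] at hC
  have : w.asIdeal = 1 := by
    have : w.asIdeal * C = 1 * C := by rw [one_mul, ← hC]
    exact mul_right_cancel₀ hC0 this
  exact w.isPrime.ne_top (by rw [this, Ideal.one_eq_top])

lemma coe_smul_ok (g : Gal(E/F)) (x : 𝓞 E) : ((g • x : 𝓞 E) : E) = g (x : E) := rfl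

theorem h90_SU (a : 𝓞 F) (ha : a ≠ 0)
    (hcl : ∀ A : Ideal (𝓞 F), A ≠ 0 → ∃ I c, (∃ m : ℕ, a ^ m ∈ I) ∧ A * I = Ideal.span {c})
    (hur : ∀ v : HeightOneSpectrum (𝓞 F), a ∉ v.asIdeal → Unr F E v)
    (σ : Gal(E/F)) (hσ : ∀ x, x ∈ Subgroup.zpowers σ)
    (y : Eˣ) (hy : y ∈ SU (algebraMap F E a)) (hN : Algebra.norm F (y : E) = 1) :
    ∃ u ∈ SU (algebraMap F E a), (y : E) = (u : E) / σ (u : E) := by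
  set aE : 𝓞 E := algebraMap (𝓞 F) (𝓞 E) a with haE
  have haE' : (aE : E) = algebraMap F E a := rfl
  have : IsCyclic Gal(E/F) := ⟨σ, hσ⟩
  obtain ⟨z0, hz0⟩ := groupCohomology.exists_div_of_norm_eq_one hσ hN
  obtain ⟨n, hn, hnz⟩ := IsAlgebraic.exists_integral_multiple (R := ℤ) (z := (z0 : E))
    ((IsFractionRing.isAlgebraic_iff ℤ ℚ E).mpr (IsAlgebraic.of_finite ℚ (z0 : E)))
  set z : 𝓞 E := ⟨n • (z0 : E), hnz⟩ with hz
  have hzE : (z : E) = (n : E) * z0 := by simp [hz, RingOfIntegers.map_mk]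
  have hnE : (n : E) ≠ 0 := by exact_mod_cast hn
  have hzne : (z : E) ≠ 0 := by rw [hzE]; exact mul_ne_zero hnE z0.ne_zero
  have hzn : z ≠ 0 := fun h => hzne (by rw [h]; rfl)
  have hσz : σ (z : E) ≠ 0 := by simpa using hzne
  have hyz : (y : E) = z / σ z := by
    rw [hzE, map_mul, map_intCast, ← hz0]
    field_simp
  obtain ⟨⟨k, hk⟩, ⟨l, hl⟩⟩ := hy
  have d1 : σ • z ∣ aE ^ k * z := by
    refine ⟨⟨_, hk⟩, RingOfIntegers.ext ?_⟩
    change (algebraMap F E a) ^ k * (z : E) = σ (z : E) * ((algebraMap F E a) ^ k * y)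
    rw [hyz]
    field_simp
  have d2 : z ∣ aE ^ l * (σ • z) := by
    refine ⟨⟨_, hl⟩, RingOfIntegers.ext ?_⟩
    change (algebraMap F E a) ^ l * σ (z : E) = (z : E) * ((algebraMap F E a) ^ l * ((y⁻¹ : Eˣ) : E))
    rw [Units.val_inv_eq_inv_val, hyz]
    field_simp
  have d3 : z ∣ aE ^ k * (σ⁻¹ • z) := by
    obtain ⟨c, hc⟩ := d1
    refine ⟨σ⁻¹ • c, ?_⟩
    have := congrArg (fun y => σ⁻¹ • y) hc
    simpa only [smul_mul', smul_pow', smul_algebraMap, inv_smul_smul, haE] using this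
  have i1 : σ • sat aE z = sat aE z := by
    apply le_antisymm (sat_smul_le σ a z l d2)
    have := sat_smul_le σ⁻¹ a z k d3
    rw [← Ideal.pointwise_smul_le_pointwise_smul_iff (a := σ), smul_inv_smul] at this
    exact this
  have i2 : ∀ g : Gal(E/F), g • sat aE z = sat aE z := by
    intro g
    have : Subgroup.zpowers σ ≤ MulAction.stabilizer Gal(E/F) (sat aE z) := by
      rw [Subgroup.zpowers_le]; exact i1
    exact this (hσ g)
  obtain ⟨A', hA'⟩ := inv_ext _ (sat aE z) (sat_ne_zero aE z hzn) rfl i2 (by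
    intro w hw
    apply hur
    intro h
    exact notMem_of_dvd_sat aE z hzn w hw h)
  have hA'0 : A' ≠ 0 := by
    rintro rfl
    apply sat_ne_zero aE z hzn
    rw [hA']; exact Ideal.map_bot
  obtain ⟨I, c, ⟨m, hm⟩, hc⟩ := hcl A' hA'0
  have hI : I ≠ 0 := by rintro rfl; exact pow_ne_zero m ha hm
  have hc' : c ∈ A' := Ideal.mul_le_left (hc ▸ Ideal.mem_span_singleton_self c)
  have hcs : algebraMap (𝓞 F) (𝓞 E) c ∈ sat aE z := by rw [hA']; exact Ideal.mem_map_of_mem _ hc'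
  obtain ⟨p, s, hs⟩ := hcs
  have hA2 : sat aE z ≤ Submodule.comap
      (LinearMap.mulLeft (𝓞 E) (aE ^ m)) (Ideal.span {algebraMap (𝓞 F) (𝓞 E) c}) := by
    rw [hA', Ideal.map_le_iff_le_comap]
    intro x hx
    have : a ^ m * x ∈ Ideal.span {c} := by rw [← hc, mul_comm A']; exact Ideal.mul_mem_mul hm hx
    obtain ⟨t, ht⟩ := Ideal.mem_span_singleton.mp this
    change aE ^ m * algebraMap _ _ x ∈ (Ideal.span {algebraMap (𝓞 F) (𝓞 E) c} : Ideal (𝓞 E))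
    rw [haE, ← map_pow, ← map_mul, ht, map_mul]
    exact Ideal.mem_span_singleton.mpr ⟨_, rfl⟩
  have hz2 : z ∈ sat aE z := ⟨0, by simp⟩
  obtain ⟨t, ht⟩ := Ideal.mem_span_singleton.mp (hA2 hz2)
  change aE ^ m * z = _ at ht
  have hc0 : c ≠ 0 := by
    rintro rfl
    exact mul_ne_zero hA'0 hI (by rw [hc]; simp)
  set cE : E := algebraMap F E (c : F) with hcE
  have hcE0 : cE ≠ 0 := by simpa [hcE] using hc0
  have e1 := congrArg (fun x : 𝓞 E => (x : E)) hs
  have e2 := congrArg (fun x : 𝓞 E => (x : E)) ht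
  simp only [map_mul, map_pow] at e1 e2
  change (aE : E) ^ p * cE = z * s at e1
  change (aE : E) ^ m * z = cE * t at e2
  refine ⟨Units.mk0 ((z : E) / cE) (div_ne_zero hzne hcE0), ⟨⟨m, ?_⟩, ⟨p, ?_⟩⟩, ?_⟩
  · rw [Units.val_mk0, ← haE', ← mul_div_assoc, e2, mul_div_cancel_left₀ _ hcE0]
    exact t.isIntegral_coe
  · rw [Units.val_inv_eq_inv_val, Units.val_mk0, ← haE', inv_div, ← mul_div_assoc, e1,
      mul_div_cancel_left₀ _ hzne]
    exact s.isIntegral_coe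
  · rw [Units.val_mk0, map_div₀, hcE, AlgEquiv.commutes, hyz, ← hcE]
    field_simp
end
end HN


namespace HN
set_option linter.unusedSectionVars false
open Module NumberField IsDedekindDomain Pointwise

section
variable {F E : Type} [Field F] [NumberField F] [Field E] [NumberField E] [Algebra F E]
  [IsGalois F E] 

lemma card_SP (h3 : finrank F E = 3) (a : 𝓞 F) (ha : a ≠ 0) :
    (SP (algebraMap (𝓞 F) (𝓞 E) a)).ncard + 2 * {v ∈ SP a | (Fib F E v).ncard ≠ 3}.ncard
      = 3 * (SP a).ncard := by
  classical
  have hE : algebraMap (𝓞 F) (𝓞 E) a ≠ 0 := by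
    simpa using ha
  set A := (SP_finite ha).toFinset with hA
  set B := (SP_finite hE).toFinset with hB
  have e1 : (SP a).ncard = A.card := Set.ncard_eq_toFinset_card _ _
  have e2 : (SP (algebraMap (𝓞 F) (𝓞 E) a)).ncard = B.card := Set.ncard_eq_toFinset_card _ _
  have e3 : {v ∈ SP a | (Fib F E v).ncard ≠ 3}.ncard = (A.filter (fun v => (Fib F E v).ncard ≠ 3)).card := by
    rw [← Set.ncard_coe_finset]; congr 1; ext v; simp [hA]
  have e4 : B.card = ∑ v ∈ A, (Fib F E v).ncard := by
    rw [Finset.card_eq_sum_card_fiberwise (f := HeightOneSpectrum.under (𝓞 F)) (t := A)]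
    · apply Finset.sum_congr rfl
      intro v hv
      rw [← Set.ncard_coe_finset]; congr 1; ext w
      simp only [Finset.coe_filter, Set.mem_ofPred_eq, mem_Fib]
      refine ⟨fun h => h.2, fun h => ⟨?_, h⟩⟩
      subst h
      have : w.under (𝓞 F) ∈ SP a := by simpa [hA] using hv
      exact (Set.Finite.mem_toFinset _).mpr this
    · intro w hw
      have : w ∈ SP (algebraMap (𝓞 F) (𝓞 E) a) := by simpa [hB] using hw
      exact (Set.Finite.mem_toFinset _).mpr this
  have e5 : ∀ v ∈ A, (Fib F E v).ncard + 2 * (if (Fib F E v).ncard ≠ 3 then 1 else 0) = 3 := by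
    intro v _
    have := Fib_mul (E := E) v
    rw [h3] at this
    have hd : (Fib F E v).ncard ∣ 3 := ⟨_, this.symm⟩
    rcases (Nat.dvd_prime Nat.prime_three).mp hd with h | h <;> simp [h]
  rw [e1, e2, e3, e4, Finset.card_filter, Finset.mul_sum, ← Finset.sum_add_distrib,
    Finset.sum_congr rfl e5]
  simp [mul_comm]

lemma rank_E (h3 : finrank F E = 3) : Units.rank E = 3 * Units.rank F + 2 := by
  have := IsUnramifiedAtInfinitePlaces_of_odd_finrank (k := F) (K := E) (by rw [h3]; decide)
  have h := IsUnramifiedAtInfinitePlaces.card_infinitePlace F E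
  rw [h3] at h
  have : 0 < Fintype.card (InfinitePlace F) := Fintype.card_pos
  unfold Units.rank
  omega

lemma norm_eq3 (h3 : finrank F E = 3) (σ : Gal(E/F)) (hσ : ∀ x, x ∈ Subgroup.zpowers σ) (x : E) :
    algebraMap F E (Algebra.norm F x) = x * σ x * σ (σ x) := by
  classical
  rw [Algebra.norm_eq_prod_automorphisms, ← IsCyclic.image_range_card hσ, Finset.prod_image]
  · rw [IsGalois.card_aut_eq_finrank, h3]
    simp [Finset.prod_range_succ, pow_two]
  · have : orderOf σ = Nat.card Gal(E/F) := orderOf_eq_card_of_forall_mem_zpowers hσ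
    rw [← this]
    intro i hi j hj h
    exact pow_injOn_Iio_orderOf (by simpa using hi) (by simpa using hj) h

lemma sigma3 (h3 : finrank F E = 3) (σ : Gal(E/F)) (x : E) : σ (σ (σ x)) = x := by
  have : σ ^ 3 = 1 := by rw [← h3, ← IsGalois.card_aut_eq_finrank, pow_card_eq_one']
  have h := congrArg (fun τ : Gal(E/F) => τ x) this
  simpa [pow_succ] using h

/-- norm on a-units -/
noncomputable def normSU (E : Type) [Field E] [NumberField E] [Algebra F E] (a : F) :
    SU (algebraMap F E a) →* SU a :=
  MonoidHom.codRestrict ((Units.map (Algebra.norm F : E →* F)).comp (SU (algebraMap F E a)).subtype) _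
  (by
    have key : ∀ (x : E) (k : ℕ), IsIntegral ℤ ((algebraMap F E a) ^ k * x) →
        IsIntegral ℤ (a ^ (k * finrank F E) * Algebra.norm F x) := by
      intro x k h
      have := Algebra.isIntegral_norm F h
      rwa [map_mul, ← map_pow, Algebra.norm_algebraMap, ← pow_mul] at this
    rintro ⟨x, ⟨k, hk⟩, ⟨l, hl⟩⟩
    exact ⟨⟨_, key _ _ hk⟩, ⟨_, key _ _ hl⟩⟩)

lemma SU_sigma_mem (σ : Gal(E/F)) (a : F) (x : Eˣ) (hx : x ∈ SU (algebraMap F E a)) :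
    Units.map (σ : E →* E) x ∈ SU (algebraMap F E a) := by
  have key : ∀ (x : E) (k : ℕ), IsIntegral ℤ ((algebraMap F E a) ^ k * x) →
        IsIntegral ℤ ((algebraMap F E a) ^ k * σ x) := by
    intro x k h
    have := h.map (σ.toAlgHom.restrictScalars ℤ)
    simpa using this
  obtain ⟨⟨k, hk⟩, ⟨l, hl⟩⟩ := hx
  exact ⟨⟨k, key _ _ hk⟩, ⟨l, key _ _ hl⟩⟩

/-- Galois action on a-units -/
def sigmaSU (σ : Gal(E/F)) (a : F) : SU (algebraMap F E a) →* SU (algebraMap F E a) :=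
  MonoidHom.codRestrict ((Units.map (σ : E →* E)).comp (SU (algebraMap F E a)).subtype) _
    (fun x => SU_sigma_mem σ a x x.2)

/-- inclusion -/
def inclSU (E : Type) [Field E] [NumberField E] [Algebra F E] (a : F) : SU a →* SU (algebraMap F E a) :=
  MonoidHom.codRestrict ((Units.map (algebraMap F E : F →* E)).comp (SU a).subtype) _
  (by
    have key : ∀ (x : F) (k : ℕ), IsIntegral ℤ (a ^ k * x) →
        IsIntegral ℤ ((algebraMap F E a) ^ k * algebraMap F E x) := by
      intro x k h
      have := h.map (IsScalarTower.toAlgHom ℤ F E)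
      simpa using this
    rintro ⟨x, ⟨k, hk⟩, ⟨l, hl⟩⟩
    exact ⟨⟨_, key _ _ hk⟩, ⟨_, key _ _ hl⟩⟩)

lemma inclSU_inj (a : F) : Function.Injective (inclSU E a) := by
  intro x y h
  have h1 := congrArg (fun z : SU (algebraMap F E a) => ((z : Eˣ) : E)) h
  exact Subtype.ext (Units.ext ((algebraMap F E).injective h1))

lemma inclSU_range (h3 : finrank F E = 3) (σ : Gal(E/F)) (hσ : ∀ x, x ∈ Subgroup.zpowers σ) (a : F)
    (x : SU (algebraMap F E a)) (hx : sigmaSU σ a x = x) : ∃ y, inclSU E a y = x := by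
  have h1 : σ ((x : Eˣ) : E) = ((x : Eˣ) : E) := congrArg (fun z : SU (algebraMap F E a) => ((z : Eˣ) : E)) hx
  have h2 : ∀ g : Gal(E/F), g ((x : Eˣ) : E) = ((x : Eˣ) : E) := by
    intro g
    have : Subgroup.zpowers σ ≤ MulAction.stabilizer Gal(E/F) ((x : Eˣ) : E) := by
      rw [Subgroup.zpowers_le]; exact h1
    exact this (hσ g)
  obtain ⟨y, hy⟩ := (IsGalois.mem_range_algebraMap_iff_fixed (F := F) ((x : Eˣ) : E)).mpr h2
  have hy0 : y ≠ 0 := by rintro rfl; exact (x : Eˣ).ne_zero (by rw [← hy, map_zero])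
  have key : ∀ (z : F) (k : ℕ), IsIntegral ℤ ((algebraMap F E a) ^ k * algebraMap F E z) →
        IsIntegral ℤ (a ^ k * z) := by
      intro z k h
      rw [← map_pow, ← map_mul] at h
      exact (isIntegral_algebraMap_iff (algebraMap F E).injective).mp h
  obtain ⟨⟨k, hk⟩, ⟨l, hl⟩⟩ := x.2
  refine ⟨⟨Units.mk0 y hy0, ⟨k, key _ _ ?_⟩, ⟨l, key _ _ ?_⟩⟩, ?_⟩
  · rwa [Units.val_mk0, hy]
  · rwa [Units.val_inv_eq_inv_val, Units.val_mk0, map_inv₀, hy, ← Units.val_inv_eq_inv_val]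
  · exact Subtype.ext (Units.ext hy)

lemma herb_mul {U V : Type*} [CommGroup U] [CommGroup V] [Module.Finite ℤ (Additive U)]
    (s : U →* U) (j : V →* U) (n : U →* V) (hj : Function.Injective j)
    (hjn : ∀ x, j (n x) = x * s x * s (s x)) (h3 : ∀ x : U, x ^ 3 = 1 → x = 1)
    (hs : ∀ x, s (s (s x)) = x) (h90 : ∀ x, n x = 1 → ∃ y, x = y / s y)
    (hker : ∀ x, s x = x → ∃ y, j y = x) (hsj : ∀ y, s (j y) = j y) :
    n.range.index ^ 2 * 3 ^ finrank ℤ (Additive U) = 3 ^ (3 * finrank ℤ (Additive V)) := by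
  have hH := herbrand (M := Additive U) (fun x hx => h3 x.toMul (by
      have := congrArg Additive.toMul hx
      exact_mod_cast this)) s.toAdditive hs (fun x hx => h90 x.toMul (hj (by
      rw [hjn, map_one]; exact hx)))
  have hjn' : nmap s.toAdditive = j.toAdditive.comp n.toAdditive := by
    ext x
    exact (hjn x).symm
  have hk : (dmap s.toAdditive).ker = j.toAdditive.range := by
    ext x
    rw [AddMonoidHom.mem_ker, dmap_apply, sub_eq_zero, AddMonoidHom.mem_range]
    constructor
    · intro h
      exact hker x.toMul h.symm
    · rintro ⟨y, rfl⟩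
      exact (hsj y.toMul).symm
  have hr1 : finrank ℤ (dmap s.toAdditive).ker = finrank ℤ (Additive V) := by
    rw [hk]
    exact LinearMap.finrank_range_of_inj (f := j.toAdditive.toIntLinearMap) hj
  have hr2 : (nmap s.toAdditive).range.relIndex (dmap s.toAdditive).ker = n.range.index := by
    rw [hjn', hk, AddMonoidHom.range_comp, AddMonoidHom.range_eq_map j.toAdditive,
      AddSubgroup.relIndex_map_map_of_injective _ _ hj, AddSubgroup.relIndex_top_right]
    rfl
  rwa [hr1, hr2] at hH

lemma arith_SU (i r s sE d : ℕ) (hH : i ^ 2 * 3 ^ (3 * r + 2 + sE) = 3 ^ (3 * (r + s)))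
    (hc : sE + 2 * d = 3 * s) : i * 3 = 3 ^ d := by
  have h : 3 * (r + s) = (3 * r + sE) + 2 * d := by omega
  have h' : 3 * r + 2 + sE = (3 * r + sE) + 2 := by omega
  rw [h, h', pow_add _ (3 * r + sE), pow_add _ (3 * r + sE)] at hH
  have hp : 0 < 3 ^ (3 * r + sE) := by positivity
  have : (i * 3) ^ 2 = (3 ^ d) ^ 2 := by
    apply Nat.eq_of_mul_eq_mul_left hp
    calc _ = i ^ 2 * (3 ^ (3 * r + sE) * 3 ^ 2) := by ring
      _ = _ := by rw [hH, mul_comm 2 d, pow_mul]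
  exact Nat.pow_left_injective (n := 2) (by norm_num) this

theorem index_SU (h3 : finrank F E = 3) (hroot : ∀ x : E, x ^ 3 = 1 → x = 1)
    (a : 𝓞 F) (ha : a ≠ 0)
    (hcl : ∀ A : Ideal (𝓞 F), A ≠ 0 → ∃ I c, (∃ m : ℕ, a ^ m ∈ I) ∧ A * I = Ideal.span {c})
    (hur : ∀ v : HeightOneSpectrum (𝓞 F), a ∉ v.asIdeal → Unr F E v)
    (σ : Gal(E/F)) (hσ : ∀ x, x ∈ Subgroup.zpowers σ) :
    (normSU E (a : F)).range.index * 3 = 3 ^ {v ∈ SP a | (Fib F E v).ncard ≠ 3}.ncard := by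
  have hE : algebraMap (𝓞 F) (𝓞 E) a ≠ 0 := by simpa using ha
  have hcoe : ((algebraMap (𝓞 F) (𝓞 E) a : 𝓞 E) : E) = algebraMap F E (a : F) := rfl
  have i1 := SU_finite hE
  have hfE := SU_finrank hE
  rw [hcoe] at i1 hfE
  have hfF := SU_finrank ha
  have hH := herb_mul (sigmaSU σ (a : F)) (inclSU E (a : F)) (normSU E (a : F)) (inclSU_inj _)
    (fun x => Subtype.ext (Units.ext (norm_eq3 h3 σ hσ _)))
    (fun x hx => Subtype.ext (Units.ext (hroot _ (congrArg
      (fun z : SU (algebraMap F E (a : F)) => ((z : Eˣ) : E)) hx))))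
    (fun x => Subtype.ext (Units.ext (sigma3 h3 σ _)))
    (fun x hx => by
      obtain ⟨u, hu, hxu⟩ := h90_SU a ha hcl hur σ hσ x x.2 (congrArg
        (fun z : SU (a : F) => ((z : Fˣ) : F)) hx)
      refine ⟨⟨u, hu⟩, Subtype.ext (Units.ext ?_)⟩
      rw [hxu, div_eq_mul_inv, div_eq_mul_inv]
      simp [sigmaSU]
      rfl)
    (fun x hx => inclSU_range h3 σ hσ _ x hx)
    (fun y => Subtype.ext (Units.ext (σ.commutes _)))
  rw [hfE, hfF, rank_E h3] at hH
  exact arith_SU _ _ _ _ _ hH (card_SP (E := E) h3 a ha)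
end
end HN


namespace HN
set_option linter.unusedSectionVars false
open Module NumberField IsDedekindDomain Pointwise

section
variable {K : Type*} [Field K] [NumberField K]

lemma exists_cl (K : Type*) [Field K] [NumberField K] : ∃ c : 𝓞 K, c ≠ 0 ∧ ∀ A : Ideal (𝓞 K), A ≠ 0 →
    ∃ (I : Ideal (𝓞 K)) (x : 𝓞 K), c ∈ I ∧ A * I = Ideal.span {x} := by
  classical
  choose I hI using fun g : ClassGroup (𝓞 K) => ClassGroup.mk0_surjective g⁻¹
  have hp : (∏ g, (I g : Ideal (𝓞 K))) ≠ ⊥ :=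
    Finset.prod_ne_zero_iff.mpr fun g _ => nonZeroDivisors.ne_zero (I g).2
  obtain ⟨c, hc, hc0⟩ := Submodule.exists_mem_ne_zero_of_ne_bot hp
  refine ⟨c, hc0, fun A hA => ?_⟩
  let A' : nonZeroDivisors (Ideal (𝓞 K)) := ⟨A, mem_nonZeroDivisors_of_ne_zero hA⟩
  have h1 : ClassGroup.mk0 (A' * I (ClassGroup.mk0 A')) = 1 := by
    rw [map_mul, hI, mul_inv_cancel]
  rw [ClassGroup.mk0_eq_one_iff] at h1
  obtain ⟨x, hx⟩ := h1.principal
  refine ⟨I (ClassGroup.mk0 A'), x, ?_, hx⟩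
  have : (∏ g, (I g : Ideal (𝓞 K))) ≤ I (ClassGroup.mk0 A') :=
    Ideal.le_of_dvd (Finset.dvd_prod_of_mem (fun g => (I g : Ideal (𝓞 K))) (Finset.mem_univ _))
  exact this hc

lemma smooth_of_pow {a : 𝓞 K} (ha : a ≠ 0) {I : Ideal (𝓞 K)} {m : ℕ} (h : a ^ m ∈ I) :
    Smooth (SP_finite ha).toFinset I := by
  refine ⟨?_, ?_⟩
  · rintro rfl
    have h' : a ^ m = 0 := by simpa only [Ideal.zero_eq_bot, Ideal.mem_bot] using h
    exact pow_ne_zero m ha h'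
  · intro v hv
    exact (Set.Finite.mem_toFinset _).mpr (v.isPrime.mem_of_pow_mem m (Ideal.le_of_dvd hv h))

lemma pow_of_smooth {a : 𝓞 K} (ha : a ≠ 0) {I : Ideal (𝓞 K)}
    (h : Smooth (SP_finite ha).toFinset I) : ∃ m : ℕ, a ^ m ∈ I := by
  have : a ∈ I.radical := by
    rw [Ideal.radical_eq_sInf, Submodule.mem_sInf]
    rintro P ⟨hP, hPp⟩
    have hP0 : P ≠ ⊥ := by
      rintro rfl
      exact h.1 (le_bot_iff.mp hP)
    have := h.2 ⟨P, hPp, hP0⟩ (Ideal.dvd_iff_le.mpr hP)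
    rw [Set.Finite.mem_toFinset] at this
    exact this
  exact this

/-- nonzero integer as a unit of the field -/
noncomputable def uK (α : 𝓞 K) (h : α ≠ 0) : Kˣ := Units.mk0 (α : K) (by simpa using h)

lemma uK_mul (α β : 𝓞 K) (h : α ≠ 0) (h' : β ≠ 0) : uK (α * β) (mul_ne_zero h h') = uK α h * uK β h' :=
  Units.ext (by simp [uK])

lemma SU_of_smooth {a : 𝓞 K} (ha : a ≠ 0) {I J : Ideal (𝓞 K)}
    (hI : Smooth (SP_finite ha).toFinset I) (hJ : Smooth (SP_finite ha).toFinset J)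
    {α β : 𝓞 K} (hα : α ≠ 0) (hβ : β ≠ 0) (h : Ideal.span {α} * I = Ideal.span {β} * J) :
    uK α hα / uK β hβ ∈ SU (a : K) := by
  have key : ∀ (I J : Ideal (𝓞 K)) (α β : 𝓞 K), β ≠ 0 → Smooth (SP_finite ha).toFinset I →
      Ideal.span {α} * I = Ideal.span {β} * J → ∃ k : ℕ, IsIntegral ℤ ((a : K) ^ k * ((α : K) / β)) := by
    intro I J α β hβ hI h
    obtain ⟨m, hm⟩ := pow_of_smooth ha hI
    have h1 : α * a ^ m ∈ Ideal.span {β} := by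
      have : α * a ^ m ∈ Ideal.span {β} * J := h ▸ Ideal.mul_mem_mul (Ideal.mem_span_singleton_self α) hm
      exact Ideal.mul_le_left this
    obtain ⟨c, hc⟩ := Ideal.mem_span_singleton.mp h1
    refine ⟨m, ?_⟩
    have hβ' : (β : K) ≠ 0 := by simpa using hβ
    have : (a : K) ^ m * ((α : K) / β) = c := by
      have := congrArg (fun z : 𝓞 K => (z : K)) hc
      simp only [map_mul, map_pow] at this
      field_simp
      linear_combination this
    rw [this]
    exact c.isIntegral_coe
  refine ⟨?_, ?_⟩
  · obtain ⟨k, hk⟩ := key I J α β hβ hI h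
    exact ⟨k, by simpa [uK] using hk⟩
  · obtain ⟨k, hk⟩ := key J I β α hα hJ h.symm
    exact ⟨k, by simpa [uK] using hk⟩

open Classical in
/-- character from a functional -/
noncomputable def mkChar {a : 𝓞 K} (ha : a ≠ 0) (χ : Kˣ →* Multiplicative (ZMod 3))
    (h1 : ∀ x ∈ SU (a : K), χ x = 1)
    (h2 : ∀ α β : 𝓞 K, ∀ (hα : α ≠ 0) (hβ : β ≠ 0),
      (∀ v ∈ SP a, v.intValuation (α - β) < v.intValuation α) → χ (uK α hα) = χ (uK β hβ)) :
    ElChar (SP_finite ha).toFinset where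
  ψ := { toFun := fun α => if h : α = 0 then 0 else ZMod.stdAddChar (χ (uK α h)).toAdd
         map_zero' := by simp
         map_one' := by
          have : uK (1 : 𝓞 K) one_ne_zero = 1 := Units.ext (by simp [uK])
          simp [this]
         map_mul' := by
          intro x y
          by_cases hx : x = 0
          · simp [hx]
          by_cases hy : y = 0
          · simp [hy]
          simp [hx, hy, uK_mul x y hx hy, AddChar.map_add_eq_mul] }
  cube := by
    intro α hα
    have : (3 : ℕ) • (χ (uK α hα)).toAdd = 0 := by
      rw [nsmul_eq_mul]; 
      have : ((3 : ℕ) : ZMod 3) = 0 := by decide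
      rw [this, zero_mul]
    simp only [MonoidWithZeroHom.coe_mk, ZeroHom.coe_mk, hα, dif_neg, not_false_eq_true]
    rw [← AddChar.map_nsmul_eq_pow, this, AddChar.map_zero_eq_one]
  unit := by
    intro α β I J hα hβ hI hJ h
    have := h1 _ (SU_of_smooth ha hI hJ hα hβ h)
    rw [map_div, div_eq_one] at this
    simp [hα, hβ, this]
  near := by
    intro α β hα hβ h
    have := h2 α β hα hβ (fun v hv => h v ((Set.Finite.mem_toFinset _).mpr hv))
    simp [hα, hβ, this]

lemma mkChar_apply {a : 𝓞 K} (ha : a ≠ 0) (χ : Kˣ →* Multiplicative (ZMod 3)) (h1 h2)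
    (α : 𝓞 K) (hα : α ≠ 0) :
    (mkChar ha χ h1 h2).ψ α = ZMod.stdAddChar (χ (uK α hα)).toAdd := by
  simp [mkChar, hα]

lemma mkChar_eq_one {a : 𝓞 K} (ha : a ≠ 0) (χ : Kˣ →* Multiplicative (ZMod 3)) (h1 h2)
    (α : 𝓞 K) (hα : α ≠ 0) (h : χ (uK α hα) = 1) :
    (mkChar ha χ h1 h2).ψ α = 1 := by
  simp [mkChar_apply _ _ _ _ _ hα, h]
end

end HN


namespace HN
set_option linter.unusedSectionVars false
open Module NumberField IsDedekindDomain Pointwise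

instance fact3 : Fact (Nat.Prime 3) := ⟨Nat.prime_three⟩

lemma two_functionals {T : Type*} [Fintype T] (R : AddSubgroup (T → ZMod 3))
    (h : Nat.card R * 3 < 3 ^ Fintype.card T) :
    ∃ φ φ' : (T → ZMod 3) →ₗ[ZMod 3] ZMod 3, (∀ x ∈ R, φ x = 0) ∧ (∀ x ∈ R, φ' x = 0) ∧
      ∀ s t : ZMod 3, s • φ + t • φ' = 0 → s = 0 ∧ t = 0 := by
  classical
  let W : Submodule (ZMod 3) (T → ZMod 3) := AddSubgroup.toZModSubmodule 3 R
  have h1 := Subspace.finrank_add_finrank_dualAnnihilator_eq W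
  rw [Module.finrank_fintype_fun_eq_card] at h1
  have h2 : Nat.card R = 3 ^ finrank (ZMod 3) W := by
    have := Module.natCard_eq_pow_finrank (K := ZMod 3) (V := W)
    rw [Nat.card_zmod] at this
    exact this
  rw [h2, ← pow_succ] at h
  have h3 := (Nat.pow_lt_pow_iff_right (by norm_num)).mp h
  have h4 : 1 < finrank (ZMod 3) W.dualAnnihilator := by omega
  have : Nontrivial W.dualAnnihilator := Module.nontrivial_of_finrank_pos (R := ZMod 3) (by omega)
  obtain ⟨x, hx⟩ := exists_ne (0 : W.dualAnnihilator)
  obtain ⟨y, hy⟩ := exists_linearIndependent_pair_of_one_lt_finrank h4 hx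
  refine ⟨x, y, fun r hr => (Submodule.mem_dualAnnihilator _).mp x.2 r hr,
    fun r hr => (Submodule.mem_dualAnnihilator _).mp y.2 r hr, fun s t hst => ?_⟩
  exact LinearIndependent.pair_iff.mp hy s t (Subtype.ext hst)

section
variable {K : Type*} [Field K] [NumberField K]

/-- product of local maps -/
def Lam (T : Finset (HeightOneSpectrum (𝓞 K)))
    (lam : HeightOneSpectrum (𝓞 K) → Kˣ →* Multiplicative (ZMod 3)) :
    Kˣ →* Multiplicative (T → ZMod 3) where
  toFun x := Multiplicative.ofAdd (fun v => (lam v x).toAdd)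
  map_one' := by
    ext v; simp
  map_mul' x y := by
    ext v; simp

/-- character -/
def chi (T : Finset (HeightOneSpectrum (𝓞 K)))
    (lam : HeightOneSpectrum (𝓞 K) → Kˣ →* Multiplicative (ZMod 3))
    (φ : (T → ZMod 3) →ₗ[ZMod 3] ZMod 3) : Kˣ →* Multiplicative (ZMod 3) :=
  (AddMonoidHom.toMultiplicative φ.toAddMonoidHom).comp (Lam T lam)

lemma chi_apply (T : Finset (HeightOneSpectrum (𝓞 K)))
    (lam : HeightOneSpectrum (𝓞 K) → Kˣ →* Multiplicative (ZMod 3))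
    (φ : (T → ZMod 3) →ₗ[ZMod 3] ZMod 3) (x : Kˣ) :
    (chi T lam φ x).toAdd = φ (fun v => (lam v x).toAdd) := rfl

lemma chi_ne (T : Finset (HeightOneSpectrum (𝓞 K)))
    (lam : HeightOneSpectrum (𝓞 K) → Kˣ →* Multiplicative (ZMod 3))
    (hnear : ∀ v, ∀ α β : 𝓞 K, ∀ (hα : α ≠ 0) (hβ : β ≠ 0),
      v.intValuation (α - β) < v.intValuation α → lam v (uK α hα) = lam v (uK β hβ))
    (hns : ∀ v ∈ T, ∃ x, lam v x ≠ 1)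
    (φ : (T → ZMod 3) →ₗ[ZMod 3] ZMod 3) (hφ : φ ≠ 0) :
    ∃ (α : 𝓞 K) (hα : α ≠ 0), chi T lam φ (uK α hα) ≠ 1 := by
  classical
  obtain ⟨v, hv⟩ : ∃ v : T, φ (Pi.single v 1) ≠ 0 := by
    by_contra! h
    apply hφ
    apply LinearMap.pi_ext'
    intro v
    ext
    simpa using h v
  obtain ⟨x, hx⟩ := hns v v.2
  -- integral representative
  obtain ⟨y, hy, hly⟩ : ∃ (y : 𝓞 K) (hy : y ≠ 0), lam v (uK y hy) ≠ 1 := by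
    obtain ⟨n, d, hd, hnd⟩ := IsFractionRing.div_surjective (A := 𝓞 K) (x : K)
    have hd0 : d ≠ 0 := nonZeroDivisors.ne_zero hd
    have hn0 : n ≠ 0 := by
      rintro rfl
      exact x.ne_zero (by rw [← hnd]; simp)
    by_contra! h
    have e : x = uK n hn0 / uK d hd0 := Units.ext (by rw [← hnd]; simp [uK])
    rw [e, map_div, h, h, div_one] at hx
    exact hx rfl
  obtain ⟨N, hN⟩ : ∃ N : ℕ, v.1.intValuation y > WithZero.exp (-(N:ℤ)) := by
    have h0 := v.1.intValuation_ne_zero y hy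
    by_contra! h
    have h1 : ∀ N : ℕ, y ∈ v.1.asIdeal ^ N := fun N => (v.1.intValuation_le_pow_iff_mem y N).mp (h N)
    have h2 : y ∈ ⨅ N, v.1.asIdeal ^ N := by simpa using h1
    rw [Ideal.iInf_pow_eq_bot_of_isDomain _ v.1.isPrime.ne_top] at h2
    exact hy h2
  obtain ⟨α, hα⟩ := IsDedekindDomain.exists_forall_sub_mem_ideal (s := T) (fun w => w.asIdeal)
    (fun w => if w = v then N else 1) (fun w _ => w.prime)
    (fun i _ j _ hij h => hij (HeightOneSpectrum.ext h)) (fun w => if w = v then y else 1)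
  have hv1 : v.1.intValuation (y - α) < v.1.intValuation y := by
    have := hα v v.2
    simp only [if_true] at this
    rw [← neg_mem_iff, neg_sub] at this
    exact lt_of_le_of_lt ((v.1.intValuation_le_pow_iff_mem _ N).mpr this) hN
  have hα0 : α ≠ 0 := by
    rintro rfl
    simp at hv1
  refine ⟨α, hα0, fun h => ?_⟩
  have h1 : (fun w : T => (lam w (uK α hα0)).toAdd) = (lam v (uK y hy)).toAdd • Pi.single v 1 := by
    ext w
    by_cases hw : w = v
    · subst hw
      simp [hnear _ _ _ hy hα0 hv1]
    · have hw' : w.1 ≠ v.1 := fun h => hw (Subtype.ext h)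
      have := hα w w.2
      simp only [hw, hw', if_false, pow_one] at this
      have h2 : w.1.intValuation (1 - α) < w.1.intValuation 1 := by
        rw [map_one, HeightOneSpectrum.intValuation_lt_one_iff_mem, ← neg_mem_iff, neg_sub]
        exact this
      have h3 := hnear _ _ _ one_ne_zero hα0 h2
      have h4 : uK (1 : 𝓞 K) one_ne_zero = 1 := Units.ext (by simp [uK])
      rw [h4, map_one] at h3
      simp [← h3, hw]
  have h2 : φ (fun w : T => (lam w (uK α hα0)).toAdd) = 0 := by
    rw [← chi_apply, h]; rfl
  rw [h1, map_smul, smul_eq_mul, mul_eq_zero] at h2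
  rcases h2 with h2 | h2
  · exact hly (by exact h2)
  · exact hv h2

end
end HN


namespace HN
set_option linter.unusedSectionVars false
open Module NumberField IsDedekindDomain Pointwise

section
variable {F E : Type} [Field F] [NumberField F] [Field E] [NumberField E] [Algebra F E]
  [IsGalois F E] 

lemma exists_a (E : Type) [Field E] [NumberField E] [Algebra F E] [IsGalois F E]
    (b : Fˣ) (r : 𝓞 F) (hr : r ≠ 0) : ∃ a : 𝓞 F, a ≠ 0 ∧ r ∣ a ∧ b ∈ SU (a : F) ∧
    (∀ A : Ideal (𝓞 F), A ≠ 0 → ∃ (I : Ideal (𝓞 F)) (x : 𝓞 F), a ∈ I ∧ A * I = Ideal.span {x}) ∧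
    (∀ A : Ideal (𝓞 E), A ≠ 0 → ∃ (I : Ideal (𝓞 E)) (x : 𝓞 E), algebraMap (𝓞 F) (𝓞 E) a ∈ I ∧
      A * I = Ideal.span {x}) := by
  obtain ⟨c, hc, hc'⟩ := exists_cl F
  obtain ⟨e, he, he'⟩ := exists_cl E
  obtain ⟨n, d, hd, hnd⟩ := IsFractionRing.div_surjective (A := 𝓞 F) (b : F)
  have hd0 : d ≠ 0 := nonZeroDivisors.ne_zero hd
  have hn0 : n ≠ 0 := by
    rintro rfl
    exact b.ne_zero (by rw [← hnd]; simp)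
  have hN : Algebra.intNorm (𝓞 F) (𝓞 E) e ≠ 0 := by
    rwa [Ne, Algebra.intNorm_eq_zero]
  have hdF : (d : F) ≠ 0 := by simpa using hd0
  have hnF : (n : F) ≠ 0 := by simpa using hn0
  refine ⟨r * c * Algebra.intNorm (𝓞 F) (𝓞 E) e * n * d, ?_, ?_, ⟨⟨1, ?_⟩, ⟨1, ?_⟩⟩, ?_, ?_⟩
  · simp [hr, hc, hN, hn0, hd0]
  · simp [mul_assoc]
  · have : ((r * c * Algebra.intNorm (𝓞 F) (𝓞 E) e * n * d : 𝓞 F) : F) ^ 1 * (b : F) =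
        ((r * c * Algebra.intNorm (𝓞 F) (𝓞 E) e * n * n : 𝓞 F) : F) := by
      rw [← hnd]; simp only [map_mul, pow_one]; field_simp
    rw [this]; exact RingOfIntegers.isIntegral_coe _
  · have : ((r * c * Algebra.intNorm (𝓞 F) (𝓞 E) e * n * d : 𝓞 F) : F) ^ 1 * ((b⁻¹ : Fˣ) : F) =
        ((r * c * Algebra.intNorm (𝓞 F) (𝓞 E) e * d * d : 𝓞 F) : F) := by
      rw [Units.val_inv_eq_inv_val, ← hnd]; simp only [map_mul, pow_one]; field_simp
    rw [this]; exact RingOfIntegers.isIntegral_coe _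
  · intro A hA
    obtain ⟨I, x, h1, h2⟩ := hc' A hA
    refine ⟨I, x, I.mem_of_dvd ?_ h1, h2⟩
    exact ⟨r * Algebra.intNorm (𝓞 F) (𝓞 E) e * n * d, by ring⟩
  · intro A hA
    obtain ⟨I, x, h1, h2⟩ := he' A hA
    refine ⟨I, x, I.mem_of_dvd ?_ h1, h2⟩
    refine (Algebra.dvd_algebraMap_intNorm_self (𝓞 F) (𝓞 E) e).trans (map_dvd _ ?_)
    exact ⟨r * c * n * d, by ring⟩

lemma intNorm_coe (x : 𝓞 E) : ((Algebra.intNorm (𝓞 F) (𝓞 E) x : 𝓞 F) : F) = Algebra.norm F (x : E) :=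
  Algebra.algebraMap_intNorm (A := 𝓞 F) (K := F) (L := E) (B := 𝓞 E) x

lemma split_char (h3 : finrank F E = 3) (a : 𝓞 F) (ha : a ≠ 0)
    (hE : ∀ A : Ideal (𝓞 E), A ≠ 0 → ∃ (I : Ideal (𝓞 E)) (x : 𝓞 E), algebraMap (𝓞 F) (𝓞 E) a ∈ I ∧
      A * I = Ideal.span {x}) (v : HeightOneSpectrum (𝓞 F))
    (hv : (Fib F E v).ncard = 3) : ∃ (I : Ideal (𝓞 F)) (α : 𝓞 F) (y : Eˣ) (hα : α ≠ 0),
      Smooth (SP_finite ha).toFinset I ∧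
      v.asIdeal * I = Ideal.span {α} ∧ uK α hα = Units.map (Algebra.norm F : E →* F) y := by
  have hm := Fib_mul (E := E) v
  rw [h3, hv] at hm
  have hf : Ideal.inertiaDegIn v.asIdeal (𝓞 E) = 1 := Nat.eq_one_of_mul_eq_one_left (Nat.eq_of_mul_eq_mul_left (by norm_num : 0 < 3) (by rw [hm]))
  obtain ⟨w, hw⟩ : (Fib F E v).Nonempty := by
    apply Set.nonempty_of_ncard_ne_zero; omega
  obtain ⟨J, β, hJ, hβ⟩ := hE w.asIdeal w.ne_bot
  have hJ0 : J ≠ 0 := by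
    rintro rfl
    rw [Ideal.zero_eq_bot, Ideal.mem_bot] at hJ
    exact ha (by simpa using hJ)
  have hβ0 : β ≠ 0 := by
    rintro rfl
    have : w.asIdeal * J = 0 := by rw [hβ]; simp
    exact (mul_ne_zero w.ne_bot hJ0) this
  have hN : Algebra.intNorm (𝓞 F) (𝓞 E) β ≠ 0 := by
    rwa [Ne, Algebra.intNorm_eq_zero]
  refine ⟨Ideal.relNorm (𝓞 F) J, Algebra.intNorm (𝓞 F) (𝓞 E) β, uK β hβ0, hN, ?_, ?_, ?_⟩
  · apply smooth_of_pow ha (m := 3)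
    have h1 : Ideal.relNorm (𝓞 F) J ∣ Ideal.relNorm (𝓞 F) (Ideal.span {algebraMap (𝓞 F) (𝓞 E) a}) := by
      apply map_dvd
      rw [Ideal.dvd_iff_le, Ideal.span_singleton_le_iff_mem]
      exact hJ
    rw [Ideal.relNorm_singleton] at h1
    have h2 : Algebra.intNorm (𝓞 F) (𝓞 E) (algebraMap (𝓞 F) (𝓞 E) a) = a ^ 3 := by
      apply RingOfIntegers.ext
      rw [intNorm_coe]
      have : ((algebraMap (𝓞 F) (𝓞 E) a : 𝓞 E) : E) = algebraMap F E (a : F) := rfl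
      rw [this, Algebra.norm_algebraMap, h3]
      exact (map_pow (algebraMap (𝓞 F) F) a 3).symm
    rw [h2, Ideal.dvd_iff_le, Ideal.span_singleton_le_iff_mem] at h1
    exact h1
  · rw [← Ideal.relNorm_singleton, ← hβ, map_mul, relNorm_Fib hw, hf, pow_one]
  · apply Units.ext
    simp only [uK, Units.val_mk0, Units.coe_map, MonoidHom.coe_coe]
    exact intNorm_coe β

theorem hasse_norm (h3 : finrank F E = 3) (hroot : ∀ x : E, x ^ 3 = 1 → x = 1)
    (r : 𝓞 F) (hr : r ≠ 0) (hur : ∀ v : HeightOneSpectrum (𝓞 F), r ∉ v.asIdeal → Unr F E v)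
    (σ : Gal(E/F)) (hσ : ∀ x, x ∈ Subgroup.zpowers σ)
    (lam : HeightOneSpectrum (𝓞 F) → Fˣ →* Multiplicative (ZMod 3))
    (hN : ∀ v (x : Eˣ), lam v (Units.map (Algebra.norm F : E →* F) x) = 1)
    (hnear : ∀ v, ∀ α β : 𝓞 F, ∀ (hα : α ≠ 0) (hβ : β ≠ 0),
      v.intValuation (α - β) < v.intValuation α → lam v (uK α hα) = lam v (uK β hβ))
    (hns : ∀ v, (Fib F E v).ncard ≠ 3 → ∃ x, lam v x ≠ 1)
    (b : Fˣ) (hb : ∀ v, lam v b = 1) : ∃ y : Eˣ, Units.map (Algebra.norm F : E →* F) y = b := by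
  classical
  obtain ⟨a, ha, hra, hba, hF, hE⟩ := exists_a E b r hr
  have hur' : ∀ v : HeightOneSpectrum (𝓞 F), a ∉ v.asIdeal → Unr F E v :=
    fun v hv => hur v (fun h => hv (v.asIdeal.mem_of_dvd hra h))
  have hidx := index_SU (E := E) h3 hroot a ha (fun A hA => by
    obtain ⟨I, c, h1, h2⟩ := hF A hA
    exact ⟨I, c, ⟨1, by simpa using h1⟩, h2⟩) hur' σ hσ
  have hTf : {v ∈ SP a | (Fib F E v).ncard ≠ 3}.Finite := (SP_finite ha).subset (fun _ h => h.1)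
  set T : Finset (HeightOneSpectrum (𝓞 F)) := hTf.toFinset with hT
  have hTm : ∀ v, v ∈ T ↔ v ∈ SP a ∧ (Fib F E v).ncard ≠ 3 := by
    intro v; rw [hT, Set.Finite.mem_toFinset]; rfl
  rw [Set.ncard_eq_toFinset_card _ hTf, ← hT] at hidx
  let Λ : SU (a : F) →* Multiplicative (T → ZMod 3) := (Lam T lam).comp (SU (a : F)).subtype
  have hle : (normSU E (a : F)).range ≤ Λ.ker := by
    rintro _ ⟨x, rfl⟩
    rw [MonoidHom.mem_ker]
    ext v
    exact hN v x
  have hcard : 3 ^ T.card ≤ Λ.ker.index * 3 := by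
    by_contra! hlt
    rw [Subgroup.index_ker] at hlt
    let R : AddSubgroup (T → ZMod 3) := Subgroup.toAddSubgroup' Λ.range
    obtain ⟨φ, φ', h1, h2, h3'⟩ := two_functionals R (by
      rw [Fintype.card_coe]; exact hlt)
    have hS : (SP_finite ha).toFinset.Nonempty := by
      by_contra hne
      rw [Finset.not_nonempty_iff_eq_empty] at hne
      have : T = ∅ := by
        apply Finset.eq_empty_of_forall_notMem
        intro v hv
        have := (Set.Finite.mem_toFinset (SP_finite ha)).mpr ((hTm v).mp hv).1
        simp [hne] at this
      have hT0 : T.card = 0 := by rw [this]; rfl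
      rw [hT0, pow_zero] at hlt
      have : 0 < Nat.card Λ.range := Nat.card_pos
      omega
    have hU : ∀ φ : (T → ZMod 3) →ₗ[ZMod 3] ZMod 3, (∀ x ∈ R, φ x = 0) →
        ∀ x ∈ SU (a : F), chi T lam φ x = 1 := fun φ h x hx => h _ ⟨⟨x, hx⟩, rfl⟩
    have hnr : ∀ φ : (T → ZMod 3) →ₗ[ZMod 3] ZMod 3,
        ∀ α β : 𝓞 F, ∀ (hα : α ≠ 0) (hβ : β ≠ 0),
      (∀ v ∈ SP a, v.intValuation (α - β) < v.intValuation α) →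
        chi T lam φ (uK α hα) = chi T lam φ (uK β hβ) := by
      intro φ α β hα hβ h
      have : (fun v : T => (lam v (uK α hα)).toAdd) = (fun v : T => (lam v (uK β hβ)).toAdd) := by
        ext v
        rw [hnear v α β hα hβ (h v ((hTm v).mp v.2).1)]
      have h' := congrArg φ this
      rw [← chi_apply, ← chi_apply] at h'
      exact h'
    have hNm : ∀ φ : (T → ZMod 3) →ₗ[ZMod 3] ZMod 3, ∀ x : Eˣ,
        chi T lam φ (Units.map (Algebra.norm F : E →* F) x) = 1 := by
      intro φ x
      have : (fun v : T => (lam v (Units.map (Algebra.norm F : E →* F) x)).toAdd) = 0 := by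
        ext v
        rw [hN v x]; rfl
      have h' := congrArg φ this
      rw [← chi_apply, map_zero] at h'
      exact h'
    let C := mkChar ha (chi T lam φ) (hU φ h1) (hnr φ)
    let D := mkChar ha (chi T lam φ') (hU φ' h2) (hnr φ')
    refine char_contra hS (fun A hA => ?_) C D (HeightOneSpectrum.under (𝓞 F) (B := 𝓞 E)) ?_
      (fun v => Fib_finite v) ?_ ?_
    · obtain ⟨I, c, h1, h2⟩ := hF A hA
      exact ⟨I, c, smooth_of_pow ha (m := 1) (by simpa using h1), h2⟩
    · intro v
      have hm := Fib_mul (E := E) v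
      rw [h3] at hm
      obtain ⟨w, hw⟩ : (Fib F E v).Nonempty := by
        apply Set.nonempty_of_ncard_ne_zero
        intro h; rw [h] at hm; omega
      exact ⟨w, hw⟩
    · intro v hv
      have hva : a ∉ v.asIdeal := fun h => hv ((Set.Finite.mem_toFinset _).mpr h)
      have hm := Fib_mul (E := E) v
      have he : Ideal.ramificationIdxIn v.asIdeal (𝓞 E) = 1 := hur' v hva
      rw [h3, he, one_mul] at hm
      have hd : (Fib F E v).ncard ∣ 3 := ⟨_, hm.symm⟩
      rcases (Nat.dvd_prime Nat.prime_three).mp hd with h | h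
      · right
        refine ⟨h.le, fun w hw => ?_⟩
        rw [h, one_mul] at hm
        rw [absNorm_Fib (v := v) hw, hm]
      · left
        refine ⟨?_, h.le, fun w hw => ?_⟩
        · obtain ⟨I, α, y, hα, hI, hvI, hy⟩ := split_char (E := E) h3 a ha hE v h
          exact ⟨I, α, hI, hvI, mkChar_eq_one _ _ _ _ _ hα (by rw [hy, hNm]),
            mkChar_eq_one _ _ _ _ _ hα (by rw [hy, hNm])⟩
        · have : Ideal.inertiaDegIn v.asIdeal (𝓞 E) = 1 := by rw [h] at hm; omega
          rw [absNorm_Fib (v := v) hw, this, pow_one]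
    · intro i j hi hj hij
      have hne : ((i + 1 : ℕ) : ZMod 3) • φ + ((j + 1 : ℕ) : ZMod 3) • φ' ≠ 0 := by
        intro h
        obtain ⟨h4, h5⟩ := h3' _ _ h
        rw [ZMod.natCast_eq_zero_iff] at h4 h5
        apply hij
        omega
      obtain ⟨α, hα, hχ⟩ := chi_ne T lam hnear (fun v hv => hns v ((hTm v).mp hv).2) _ hne
      refine ⟨α, hα, fun h => hχ ?_⟩
      rw [mkChar_apply _ _ _ _ _ hα, mkChar_apply _ _ _ _ _ hα, ← AddChar.map_nsmul_eq_pow,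
        ← AddChar.map_nsmul_eq_pow, ← AddChar.map_add_eq_mul, ← AddChar.map_zero_eq_one (ZMod.stdAddChar (N := 3))] at h
      have h' := ZMod.injective_stdAddChar h
      rw [chi_apply, chi_apply, nsmul_eq_mul, nsmul_eq_mul] at h'
      exact h'
  have hrel := Subgroup.relIndex_mul_index hle
  have h1 : (normSU E (a : F)).range.relIndex Λ.ker = 1 := by
    have hpos : 0 < (normSU E (a : F)).range.index := by
      by_contra h
      have : (normSU E (a : F)).range.index = 0 := by omega
      rw [this] at hidx
      have : 0 < 3 ^ T.card := by positivity
      omega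
    have h4 : (normSU E (a : F)).range.index ≤ Λ.ker.index := by omega
    rw [← hrel] at h4 hpos
    have h5 : 0 < Λ.ker.index := Nat.pos_of_mul_pos_left hpos
    have h6 : 0 < (normSU E (a : F)).range.relIndex Λ.ker := Nat.pos_of_mul_pos_right hpos
    nlinarith
  rw [Subgroup.relIndex_eq_one] at h1
  obtain ⟨y, hy⟩ := h1 (show (⟨b, hba⟩ : SU (a : F)) ∈ Λ.ker by
    rw [MonoidHom.mem_ker]
    ext v
    exact hb v)
  exact ⟨y, congrArg Subtype.val hy⟩
end
end HN


namespace HN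
set_option linter.unusedSectionVars false
open Module NumberField IsDedekindDomain Pointwise

section
variable {F E : Type} [Field F] [NumberField F] [Field E] [NumberField E] [Algebra F E]
  [IsGalois F E] 

lemma surj_of_deg_one {v : HeightOneSpectrum (𝓞 F)} {w : HeightOneSpectrum (𝓞 E)} (h : w ∈ Fib F E v)
    (hf : Ideal.inertiaDegIn v.asIdeal (𝓞 E) = 1) (x : 𝓞 E) :
    ∃ n : 𝓞 F, x - algebraMap (𝓞 F) (𝓞 E) n ∈ w.asIdeal := by
  have hn := absNorm_Fib h
  rw [hf, pow_one] at hn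
  have := v.isMaximal
  have := w.isMaximal
  have := Fib_liesOver h
  let _ : Field (𝓞 F ⧸ v.asIdeal) := Ideal.Quotient.field _
  have : Finite (𝓞 F ⧸ v.asIdeal) := Ideal.finiteQuotientOfFreeOfNeBot _ v.ne_bot
  have : Finite (𝓞 E ⧸ w.asIdeal) := Ideal.finiteQuotientOfFreeOfNeBot _ w.ne_bot
  have hb : Function.Bijective (algebraMap (𝓞 F ⧸ v.asIdeal) (𝓞 E ⧸ w.asIdeal)) := by
    rw [Nat.bijective_iff_injective_and_card]
    refine ⟨(algebraMap (𝓞 F ⧸ v.asIdeal) (𝓞 E ⧸ w.asIdeal)).injective, ?_⟩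
    rw [Ideal.absNorm_apply, Ideal.absNorm_apply] at hn
    exact hn.symm
  obtain ⟨n, hn⟩ := hb.2 (Ideal.Quotient.mk _ x)
  obtain ⟨n, rfl⟩ := Ideal.Quotient.mk_surjective n
  refine ⟨n, ?_⟩
  rw [← Ideal.Quotient.eq_zero_iff_mem, map_sub, ← hn, sub_eq_zero]
  rfl

lemma smul_Fib {v : HeightOneSpectrum (𝓞 F)} {w : HeightOneSpectrum (𝓞 E)} (h : w ∈ Fib F E v)
    (hc : (Fib F E v).ncard = 1) (g : Gal(E/F)) : g • w.asIdeal = w.asIdeal := by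
  obtain ⟨w0, hw0⟩ := Set.ncard_eq_one.mp hc
  have hp := w.isPrime
  let w' : HeightOneSpectrum (𝓞 E) := ⟨g • w.asIdeal, inferInstance, by
    intro h0
    apply w.ne_bot
    have := congrArg (fun I => g⁻¹ • I) h0
    simpa using this⟩
  have hw' : w' ∈ Fib F E v := by
    rw [mem_Fib] at h ⊢
    rw [← h]
    apply HeightOneSpectrum.ext
    ext x
    change algebraMap (𝓞 F) (𝓞 E) x ∈ g • w.asIdeal ↔ algebraMap (𝓞 F) (𝓞 E) x ∈ w.asIdeal
    rw [Ideal.mem_pointwise_smul_iff_inv_smul_mem, smul_algebraMap]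
  rw [hw0] at h hw'
  have : w' = w := by rw [Set.mem_singleton_iff.mp h, Set.mem_singleton_iff.mp hw']
  exact congrArg HeightOneSpectrum.asIdeal this

lemma val_smul {v : HeightOneSpectrum (𝓞 F)} {w : HeightOneSpectrum (𝓞 E)} (h : w ∈ Fib F E v)
    (hc : (Fib F E v).ncard = 1) (g : Gal(E/F)) (x : E) : w.valuation E (g x) = w.valuation E x := by
  have key : ∀ (g : Gal(E/F)) (x : 𝓞 E), w.intValuation (g • x) ≤ w.intValuation x := by
    intro g x
    by_cases hx : x = 0
    · simp [hx]
    rw [w.intValuation_eq_exp_neg_multiplicity hx, w.intValuation_le_pow_iff_mem]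
    have h1 : x ∈ w.asIdeal ^ (multiplicity w.asIdeal (Ideal.span {x})) := by
      rw [← w.intValuation_le_pow_iff_mem, w.intValuation_eq_exp_neg_multiplicity hx]
    have h2 := Ideal.smul_mem_pointwise_smul g _ _ h1
    have h3 : ∀ n : ℕ, g • (w.asIdeal ^ n) = w.asIdeal ^ n := by
      intro n
      rw [smul_pow', smul_Fib h hc]
    rwa [h3] at h2
  have key2 : ∀ (g : Gal(E/F)) (x : 𝓞 E), w.intValuation (g • x) = w.intValuation x := by
    intro g x
    refine le_antisymm (key g x) ?_
    have := key g⁻¹ (g • x)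
    rwa [inv_smul_smul] at this
  have key3 : ∀ (x : 𝓞 E), w.valuation E (g (x : E)) = w.valuation E (x : E) := by
    intro x
    have e : g (x : E) = ((g • x : 𝓞 E) : E) := (coe_smul_ok g x).symm
    rw [e]
    exact ((w.valuation_of_algebraMap (K := E) (g • x)).trans (key2 g x)).trans
      (w.valuation_of_algebraMap x).symm
  obtain ⟨s, t, ht, rfl⟩ := IsFractionRing.div_surjective (A := 𝓞 E) x
  rw [map_div₀, map_div₀, map_div₀]
  rw [key3, key3]

lemma val_norm (h3 : finrank F E = 3) (σ : Gal(E/F)) (hσ : ∀ x, x ∈ Subgroup.zpowers σ)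
    {v : HeightOneSpectrum (𝓞 F)} {w : HeightOneSpectrum (𝓞 E)} (h : w ∈ Fib F E v)
    (hc : (Fib F E v).ncard = 1) (x : E) :
    w.valuation E (algebraMap F E (Algebra.norm F x)) = w.valuation E x ^ 3 := by
  rw [norm_eq3 h3 σ hσ, map_mul, map_mul, val_smul h hc, val_smul h hc, val_smul h hc]
  rw [pow_succ, pow_two]

lemma val_restrict {v : HeightOneSpectrum (𝓞 F)} {w : HeightOneSpectrum (𝓞 E)} (h : w ∈ Fib F E v)
    (x : F) : w.valuation E (algebraMap F E x) = v.valuation F x ^ Ideal.ramificationIdxIn v.asIdeal (𝓞 E) := by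
  have := Fib_liesOver h
  have := w.isMaximal
  have := v.isMaximal
  rw [Ideal.ramificationIdxIn_eq_ramificationIdx v.asIdeal w.asIdeal Gal(E/F)]
  rw [← HeightOneSpectrum.valuation_liesOver E v w]
  rw [Ideal.ramificationIdx'_eq_ramificationIdx v.asIdeal w.asIdeal v.ne_bot]

end
end HN


namespace HN
set_option linter.unusedSectionVars false
open Module NumberField IsDedekindDomain Pointwise

section
variable {F E : Type} [Field F] [NumberField F] [Field E] [NumberField E] [Algebra F E]
  [IsGalois F E] 

/-- valuation mod 3 -/
noncomputable def lval (v : HeightOneSpectrum (𝓞 F)) : Fˣ →* Multiplicative (ZMod 3) where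
  toFun x := Multiplicative.ofAdd ((WithZero.log (v.valuation F (x : F)) : ℤ) : ZMod 3)
  map_one' := by simp
  map_mul' x y := by
    rw [Units.val_mul, map_mul, WithZero.log_mul (by simp) (by simp), Int.cast_add, ofAdd_add]

lemma lval_eq_one (v : HeightOneSpectrum (𝓞 F)) (x : Fˣ) :
    lval v x = 1 ↔ (3 : ℤ) ∣ WithZero.log (v.valuation F (x : F)) := by
  exact ZMod.intCast_zmod_eq_zero_iff_dvd (WithZero.log (v.valuation F (x : F))) 3

/-- principal units -/
def U1 (v : HeightOneSpectrum (𝓞 F)) : Subgroup Fˣ where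
  carrier := {x | v.valuation F ((x : F) - 1) < 1}
  one_mem' := by simp
  mul_mem' := by
    intro x y hx hy
    have hy1 : v.valuation F (y : F) = 1 := by
      have := Valuation.map_one_add_of_lt (v := v.valuation F) hy
      simpa using this
    change v.valuation F (((x * y : Fˣ) : F) - 1) < 1
    have e : ((x * y : Fˣ) : F) - 1 = ((x : F) - 1) * y + ((y : F) - 1) := by push_cast; ring
    rw [e]
    refine lt_of_le_of_lt (Valuation.map_add _ _ _) (max_lt ?_ hy)
    rw [map_mul, hy1, mul_one]; exact hx
  inv_mem' := by
    intro x hx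
    have hx1 : v.valuation F (x : F) = 1 := by
      have := Valuation.map_one_add_of_lt (v := v.valuation F) hx
      simpa using this
    change v.valuation F (((x⁻¹ : Fˣ) : F) - 1) < 1
    have e : ((x⁻¹ : Fˣ) : F) - 1 = -((x : F)⁻¹ * ((x : F) - 1)) := by
      rw [Units.val_inv_eq_inv_val]; field_simp; ring
    rw [e, Valuation.map_neg, map_mul, map_inv₀, hx1, inv_one, one_mul]; exact hx

lemma val_one_of_U1 {v : HeightOneSpectrum (𝓞 F)} {x : Fˣ} (hx : x ∈ U1 v) :
    v.valuation F (x : F) = 1 := by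
  have := Valuation.map_one_add_of_lt (v := v.valuation F) hx
  simpa using this

lemma exists_hom_of_ne_top {G : Type*} [CommGroup G] (H : Subgroup G) (hH : H ≠ ⊤)
    (h3 : ∀ x : G, x ^ 3 ∈ H) : ∃ l : G →* Multiplicative (ZMod 3), (∀ x ∈ H, l x = 1) ∧ ∃ x, l x ≠ 1 := by
  let Q := Additive (G ⧸ H)
  let _ : Module (ZMod 3) Q := AddCommGroup.zmodModule (n := 3) (by
    intro q
    obtain ⟨x, hx⟩ := QuotientGroup.mk_surjective q.toMul
    have : (q.toMul) ^ 3 = 1 := by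
      rw [← hx, ← QuotientGroup.mk_pow, QuotientGroup.eq_one_iff]; exact h3 x
    exact this)
  obtain ⟨x, hx⟩ : ∃ x, x ∉ H := by
    by_contra! h
    exact hH ((Subgroup.eq_top_iff' H).mpr h)
  have hx0 : (Additive.ofMul (x : G ⧸ H) : Q) ≠ 0 := by
    intro h
    exact hx ((QuotientGroup.eq_one_iff x).mp h)
  have := (Module.forall_dual_apply_eq_zero_iff (ZMod 3) (Additive.ofMul (x : G ⧸ H) : Q)).not.mpr hx0
  push Not at this
  obtain ⟨φ, hφ⟩ := this
  refine ⟨(AddMonoidHom.toMultiplicativeRight φ.toAddMonoidHom).comp (QuotientGroup.mk' H), ?_, x, ?_⟩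
  · intro y hy
    have : (QuotientGroup.mk' H) y = 1 := (QuotientGroup.eq_one_iff y).mpr hy
    rw [MonoidHom.comp_apply, this, map_one]
  · exact hφ

lemma not_all_cubes (v : HeightOneSpectrum (𝓞 F)) (h7 : (7 : 𝓞 F) ∈ v.asIdeal) :
    ∃ c : 𝓞 F, c ∉ v.asIdeal ∧ ∀ z : 𝓞 F, c - z ^ 3 ∉ v.asIdeal := by
  have := v.isMaximal
  let _ : Field (𝓞 F ⧸ v.asIdeal) := Ideal.Quotient.field _
  have : Finite (𝓞 F ⧸ v.asIdeal) := Ideal.finiteQuotientOfFreeOfNeBot _ v.ne_bot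
  have := Fintype.ofFinite (𝓞 F ⧸ v.asIdeal)
  have hz : (7 : 𝓞 F ⧸ v.asIdeal) = 0 := by
    have := Ideal.Quotient.eq_zero_iff_mem.mpr h7
    rwa [map_ofNat] at this
  have h7' : (2:𝓞 F ⧸ v.asIdeal) ≠ 1 := by
    intro h
    have : (1 : 𝓞 F ⧸ v.asIdeal) = 0 := by linear_combination h
    exact one_ne_zero this
  have hni : ¬ Function.Injective (fun x : 𝓞 F ⧸ v.asIdeal => x ^ 3) := by
    intro h
    refine h7' (h ?_)
    change (2 : 𝓞 F ⧸ v.asIdeal) ^ 3 = 1 ^ 3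
    linear_combination hz
  rw [Finite.injective_iff_surjective] at hni
  unfold Function.Surjective at hni
  push Not at hni
  obtain ⟨c, hc⟩ := hni
  obtain ⟨c, rfl⟩ := Ideal.Quotient.mk_surjective c
  refine ⟨c, ?_, fun z hz => ?_⟩
  · intro h
    rw [← Ideal.Quotient.eq_zero_iff_mem] at h
    exact hc 0 (by simp [h])
  · rw [← Ideal.Quotient.eq_zero_iff_mem, map_sub, map_pow, sub_eq_zero] at hz
    exact hc _ hz.symm

lemma ramified_ne_top (h3 : finrank F E = 3) (σ : Gal(E/F)) (hσ : ∀ x, x ∈ Subgroup.zpowers σ)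
    (v : HeightOneSpectrum (𝓞 F)) (hr : ¬ Unr F E v) (h7 : (7 : 𝓞 F) ∈ v.asIdeal) :
    (Units.map (Algebra.norm F : E →* F)).range ⊔ U1 v ≠ ⊤ := by
  intro htop
  have hm := Fib_mul (E := E) v
  rw [h3] at hm
  have he : Ideal.ramificationIdxIn v.asIdeal (𝓞 E) = 3 := by
    have : Ideal.ramificationIdxIn v.asIdeal (𝓞 E) ∣ 3 :=
      ⟨(Fib F E v).ncard * Ideal.inertiaDegIn v.asIdeal (𝓞 E), by rw [← hm]; ring⟩
    exact ((Nat.dvd_prime Nat.prime_three).mp this).resolve_left hr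
  have hgf : (Fib F E v).ncard * Ideal.inertiaDegIn v.asIdeal (𝓞 E) = 1 := by
    rw [he] at hm
    nlinarith
  have hc : (Fib F E v).ncard = 1 := Nat.eq_one_of_mul_eq_one_right hgf
  have hf : Ideal.inertiaDegIn v.asIdeal (𝓞 E) = 1 := Nat.eq_one_of_mul_eq_one_left hgf
  obtain ⟨w, hw⟩ : (Fib F E v).Nonempty := by
    apply Set.nonempty_of_ncard_ne_zero; omega
  obtain ⟨c, hcv, hcz⟩ := not_all_cubes v h7
  have hc0 : c ≠ 0 := by rintro rfl; exact hcv (zero_mem _)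
  have hmem : uK c hc0 ∈ (Units.map (Algebra.norm F : E →* F)).range ⊔ U1 v := by rw [htop]; trivial
  obtain ⟨_, ⟨y, rfl⟩, u, hu, hyu⟩ := Subgroup.mem_sup.mp hmem
  have hyu' : Algebra.norm F (y : E) * (u : F) = (c : F) := congrArg Units.val hyu
  have hvc : v.valuation F (c : F) = 1 := v.valuation_eq_one_iff_notMem.mpr hcv
  have hvN : v.valuation F (Algebra.norm F (y : E)) = 1 := by
    have := congrArg (v.valuation F) hyu'
    rwa [map_mul, val_one_of_U1 hu, mul_one, hvc] at this
  have hwy : w.valuation E (y : E) = 1 := by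
    have h1 := val_norm h3 σ hσ hw hc (y : E)
    rw [val_restrict hw, hvN, one_pow] at h1
    exact (pow_eq_one_iff.mp h1.symm).resolve_right (by norm_num)
  obtain ⟨s, hs⟩ := w.exists_valuation_sub_lt_of_integer (x := (y : E)) hwy.le 1
  obtain ⟨n, hn⟩ := surj_of_deg_one hw hf s
  have hn' : w.valuation E ((s : E) - algebraMap F E (n : F)) < 1 := by
    have := (w.valuation_lt_one_iff_mem (K := E) (s - algebraMap (𝓞 F) (𝓞 E) n)).mpr hn
    have e : ((s - algebraMap (𝓞 F) (𝓞 E) n : 𝓞 E) : E) = (s : E) - algebraMap F E (n : F) :=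
      map_sub (algebraMap (𝓞 E) E) _ _
    rw [← e]; exact this
  have hyn : w.valuation E ((y : E) - algebraMap F E (n : F)) < 1 := by
    have e : (y : E) - algebraMap F E (n : F) = ((s : E) - algebraMap F E (n : F)) - ((s : E) - (y : E)) := by ring
    rw [e]
    exact Valuation.map_sub_lt _ hn' (by simpa using hs)
  -- set up: y ≡ n, σ y ≡ n, σ² y ≡ n
  have hg : ∀ g : Gal(E/F), w.valuation E (g (y : E) - algebraMap F E (n : F)) < 1 := by
    intro g
    have := val_smul hw hc g ((y : E) - algebraMap F E (n : F))
    rw [map_sub g, g.commutes] at this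
    rw [this]; exact hyn
  have hn1 : w.valuation E (algebraMap F E (n : F)) ≤ 1 :=
    w.valuation_le_one (K := E) (algebraMap (𝓞 F) (𝓞 E) n)
  have hprod : w.valuation E (algebraMap F E (Algebra.norm F (y : E) - (n : F) ^ 3)) < 1 := by
    rw [map_sub, norm_eq3 h3 σ hσ, map_pow]
    set N := algebraMap F E (n : F)
    have e : (y : E) * σ y * σ (σ (y : E)) - N ^ 3 =
      (y : E) * σ y * (σ (σ (y : E)) - N) + (y : E) * N * (σ y - N) + N * N * ((y : E) - N) := by ring
    have hσy : w.valuation E (σ (y : E)) = 1 := by rw [val_smul hw hc, hwy]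
    have hlt : ∀ {p q : WithZero (Multiplicative ℤ)}, p ≤ 1 → q < 1 → p * q < 1 := fun hp hq =>
      lt_of_le_of_lt (mul_le_of_le_one_left zero_le hp) hq
    rw [e]
    refine Valuation.map_add_lt _ (Valuation.map_add_lt _ ?_ ?_) ?_
    · rw [map_mul, map_mul, hwy, hσy]
      exact hlt (by simp) (hg (σ * σ))
    · rw [map_mul, map_mul, hwy, one_mul]
      exact hlt hn1 (hg σ)
    · rw [map_mul, map_mul]
      exact hlt (mul_le_one' hn1 hn1) hyn
  have hprod' : v.valuation F (Algebra.norm F (y : E) - (n : F) ^ 3) < 1 := by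
    rw [val_restrict hw, he] at hprod
    by_contra! h
    exact absurd hprod (not_lt.mpr (one_le_pow₀ h))
  apply hcz n
  rw [← v.valuation_lt_one_iff_mem (K := F)]
  have e : ((c - n ^ 3 : 𝓞 F) : F) = Algebra.norm F (y : E) * ((u : F) - 1) +
      (Algebra.norm F (y : E) - (n : F) ^ 3) := by
    have e1 : ((c - n ^ 3 : 𝓞 F) : F) = (c : F) - (n : F) ^ 3 :=
      (map_sub (algebraMap (𝓞 F) F) _ _).trans (congrArg _ (map_pow (algebraMap (𝓞 F) F) _ _))
    rw [e1, ← hyu']; ring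
  suffices h : v.valuation F ((c - n ^ 3 : 𝓞 F) : F) < 1 from h
  rw [e]
  refine Valuation.map_add_lt _ ?_ hprod'
  rw [map_mul, hvN, one_mul]
  exact hu

theorem hasse2 (h3 : finrank F E = 3) (hroot : ∀ x : E, x ^ 3 = 1 → x = 1)
    (hram : ∀ v, ¬ Unr F E v → (7 : 𝓞 F) ∈ v.asIdeal)
    (σ : Gal(E/F)) (hσ : ∀ x, x ∈ Subgroup.zpowers σ)
    (c b : Fˣ) (hc : ∃ y : Eˣ, Units.map (Algebra.norm F : E →* F) y = c)
    (H1 : ∀ v, lval v c = 1 → lval v b = 1)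
    (H2 : ∀ v : HeightOneSpectrum (𝓞 F), (7 : 𝓞 F) ∈ v.asIdeal → b / c ∈ U1 v) :
    ∃ y : Eˣ, Units.map (Algebra.norm F : E →* F) y = b := by
  have key : ∀ v : HeightOneSpectrum (𝓞 F), ∃ l : Fˣ →* Multiplicative (ZMod 3),
      (∀ y : Eˣ, l (Units.map (Algebra.norm F : E →* F) y) = 1) ∧ (∀ x ∈ U1 v, l x = 1) ∧
      ((Fib F E v).ncard ≠ 3 → ∃ x, l x ≠ 1) ∧ l b = 1 := by
    intro v
    by_cases hs : (Fib F E v).ncard = 3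
    · exact ⟨1, fun _ => rfl, fun _ _ => rfl, fun h => absurd hs h, rfl⟩
    have hm := Fib_mul (E := E) v
    rw [h3] at hm
    have hd : (Fib F E v).ncard ∣ 3 := ⟨_, hm.symm⟩
    have hc1 : (Fib F E v).ncard = 1 := ((Nat.dvd_prime Nat.prime_three).mp hd).resolve_right hs
    by_cases hu : Unr F E v
    · have hN : ∀ y : Eˣ, lval v (Units.map (Algebra.norm F : E →* F) y) = 1 := by
        intro y
        obtain ⟨w, hw⟩ : (Fib F E v).Nonempty := by
          apply Set.nonempty_of_ncard_ne_zero; omega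
        have h1 := val_norm h3 σ hσ hw hc1 (y : E)
        have he : Ideal.ramificationIdxIn v.asIdeal (𝓞 E) = 1 := hu
        rw [val_restrict hw, he, pow_one] at h1
        rw [lval_eq_one, Units.coe_map]
        change (3 : ℤ) ∣ WithZero.log (v.valuation F (Algebra.norm F (y : E)))
        rw [h1, WithZero.log_pow]
        exact ⟨WithZero.log (w.valuation E (y : E)), by simp⟩
      refine ⟨lval v, hN, ?_, fun _ => ?_, ?_⟩
      · intro x hx
        rw [lval_eq_one, val_one_of_U1 hx]
        simp
      · obtain ⟨π, hπ⟩ := v.valuation_exists_uniformizer F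
        have hπ0 : π ≠ 0 := by rintro rfl; rw [map_zero] at hπ; exact WithZero.exp_ne_zero hπ.symm
        refine ⟨Units.mk0 π hπ0, ?_⟩
        rw [Ne, lval_eq_one, Units.val_mk0, hπ, WithZero.log_exp]
        decide
      · apply H1
        obtain ⟨y, rfl⟩ := hc
        exact hN y
    · obtain ⟨l, hl1, hl2⟩ := exists_hom_of_ne_top _ (ramified_ne_top h3 σ hσ v hu (hram v hu)) (by
        intro x
        apply Subgroup.mem_sup_left
        refine ⟨Units.map (algebraMap F E : F →* E) x, Units.ext ?_⟩
        have := Algebra.norm_algebraMap (R := F) (S := E) (x : F)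
        rw [h3] at this
        exact this)
      have hN : ∀ y : Eˣ, l (Units.map (Algebra.norm F : E →* F) y) = 1 := fun y =>
        hl1 _ (Subgroup.mem_sup_left ⟨y, rfl⟩)
      refine ⟨l, hN, fun x hx => hl1 _ (Subgroup.mem_sup_right hx), fun _ => hl2, ?_⟩
      have h1 := hl1 _ (Subgroup.mem_sup_right (H2 v (hram v hu)))
      obtain ⟨y, rfl⟩ := hc
      rwa [map_div, hN, div_one] at h1
  choose lam hN hU hns hb using key
  refine hasse_norm h3 hroot 7 (by norm_num) (fun v hv => by_contra fun h => hv (hram v h)) σ hσ lam hN ?_ hns b hb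
  intro v α β hα hβ h
  have h1 : uK β hβ / uK α hα ∈ U1 v := by
    change v.valuation F (((uK β hβ / uK α hα : Fˣ) : F) - 1) < 1
    have hα' : (α : F) ≠ 0 := by simpa using hα
    have e : ((uK β hβ / uK α hα : Fˣ) : F) - 1 = -((α : F) - β) / α := by
      simp only [uK, Units.val_div_eq_div_val, Units.val_mk0]
      field_simp; ring
    rw [← v.valuation_of_algebraMap (K := F), ← v.valuation_of_algebraMap (K := F)] at h
    rw [e, map_div₀, Valuation.map_neg]
    rw [div_lt_one₀]
    · have e2 : (α : F) - β = ((α - β : 𝓞 F) : F) := (map_sub (algebraMap (𝓞 F) F) _ _).symm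
      rw [e2]; exact h
    · exact lt_of_le_of_lt zero_le h
  have h2 := hU v _ h1
  rw [map_div, div_eq_one] at h2
  exact h2.symm
end
end HN


namespace HN
set_option linter.unusedSectionVars false
open Module NumberField IsDedekindDomain Pointwise Polynomial

section
variable {k E : Type} [Field k] [Field E] [Algebra k E]

/-- `E = k(θ)`, `θ` a root of `X³+X²-2X-1` which has no root in `k`. -/
structure Cyc (k E : Type) [Field k] [Field E] [Algebra k E] (θ : E) : Prop where
  root : θ ^ 3 + θ ^ 2 - 2 * θ - 1 = 0
  noroot : ∀ x : k, x ^ 3 + x ^ 2 - 2 * x - 1 ≠ 0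
  fr : finrank k E = 3

/-- the cubic -/
noncomputable def cf (k : Type) [Field k] : k[X] := X ^ 3 + X ^ 2 - 2 * X - 1

lemma cf_natDegree : (cf k).natDegree = 3 := by unfold cf; compute_degree!

lemma cf_monic : (cf k).Monic := by unfold cf; monicity!

lemma cf_aeval (x : E) : aeval x (cf k) = x ^ 3 + x ^ 2 - 2 * x - 1 := by
  simp only [cf, map_sub, map_add, map_mul, map_pow, aeval_X, map_ofNat, map_one]

lemma cf_irr (h : ∀ x : k, x ^ 3 + x ^ 2 - 2 * x - 1 ≠ 0) : Irreducible (cf k) := by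
  rw [irreducible_iff_roots_eq_zero_of_degree_le_three (by rw [cf_natDegree]; norm_num)
    (by rw [cf_natDegree])]
  rw [Multiset.eq_zero_iff_forall_notMem]
  intro x hx
  have := (mem_roots'.mp hx).2
  apply h x
  simpa [cf, IsRoot] using this

variable {θ : E}

lemma Cyc.minpoly_eq (h : Cyc k E θ) : minpoly k θ = cf k :=
  (minpoly.eq_of_irreducible_of_monic (cf_irr h.noroot) (by rw [cf_aeval, h.root]) cf_monic).symm

lemma Cyc.fin (h : Cyc k E θ) : FiniteDimensional k E :=
  FiniteDimensional.of_finrank_pos (by rw [h.fr]; norm_num)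

lemma Cyc.adjoin (h : Cyc k E θ) : Algebra.adjoin k {θ} = ⊤ := by
  have := h.fin
  have h1 : IntermediateField.adjoin k {θ} = ⊤ := by
    rw [Field.primitive_element_iff_minpoly_natDegree_eq, h.minpoly_eq, cf_natDegree, h.fr]
  have h2 := IntermediateField.adjoin_simple_toSubalgebra_of_isAlgebraic (Algebra.IsAlgebraic.isAlgebraic (R := k) θ)
  rw [h1] at h2
  exact h2.symm

/-- power basis -/
noncomputable def Cyc.pb (h : Cyc k E θ) : PowerBasis k E :=
  PowerBasis.ofAdjoinEqTop (x := θ) (by have := h.fin; exact Algebra.IsIntegral.isIntegral θ) h.adjoin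

lemma Cyc.pb_gen (h : Cyc k E θ) : h.pb.gen = θ := PowerBasis.ofAdjoinEqTop_gen _ _

lemma Cyc.root2 (h : Cyc k E θ) :
    (θ ^ 2 - 2) ^ 3 + (θ ^ 2 - 2) ^ 2 - 2 * (θ ^ 2 - 2) - 1 = 0 := by
  linear_combination (θ ^ 3 - θ ^ 2 - 2 * θ + 1) * h.root

/-- automorphism -/
noncomputable def Cyc.sig (h : Cyc k E θ) : Gal(E/k) :=
  AlgEquiv.ofBijective (h.pb.lift (θ ^ 2 - 2) (by
    rw [h.pb_gen, h.minpoly_eq, cf_aeval, h.root2])) (by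
      have := h.fin; exact AlgHom.bijective _)

lemma Cyc.sig_th (h : Cyc k E θ) : h.sig θ = θ ^ 2 - 2 := by
  have := h.pb.lift_gen (θ ^ 2 - 2) (by rw [h.pb_gen, h.minpoly_eq, cf_aeval, h.root2])
  have e : h.sig θ = h.sig h.pb.gen := by rw [h.pb_gen]
  rw [e]; exact this

lemma Cyc.ext (h : Cyc k E θ) {S : Type*} [Ring S] [Algebra k S] {f g : E →ₐ[k] S}
    (hfg : f θ = g θ) : f = g := h.pb.algHom_ext (by rw [h.pb_gen]; exact hfg)

lemma Cyc.th_ne (h : Cyc k E θ) (x : k) : algebraMap k E x ≠ θ := by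
  rintro rfl
  apply h.noroot x
  apply (algebraMap k E).injective
  have := h.root
  simpa only [map_sub, map_add, map_mul, map_pow, map_ofNat, map_one, map_zero] using this

lemma Cyc.seven (h : Cyc k E θ) : (θ ^ 2 - θ - 2) * ((θ ^ 2 + 3 * θ + 4) * (θ ^ 2 - 2)) = 7 := by
  linear_combination (θ^3+θ^2-2*θ-9) * h.root

lemma Cyc.sig_ne (h : Cyc k E θ) (h7 : (7 : E) ≠ 0) : h.sig ≠ 1 := by
  intro h1
  have := h.sig_th
  rw [h1, AlgEquiv.one_apply] at this
  apply h7
  rw [← h.seven]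
  linear_combination (-((θ ^ 2 + 3 * θ + 4) * (θ ^ 2 - 2))) * this

lemma Cyc.sig_pow (h : Cyc k E θ) : h.sig ^ 3 = 1 := by
  have : (h.sig ^ 3).toAlgHom = (1 : Gal(E/k)).toAlgHom := by
    apply h.ext
    change h.sig (h.sig (h.sig θ)) = θ
    simp only [h.sig_th, map_sub, map_pow, map_ofNat]
    linear_combination (θ^5-θ^4-5*θ^3+4*θ^2+5*θ-2) * h.root
  ext x
  exact DFunLike.congr_fun this x

lemma Cyc.order (h : Cyc k E θ) (h7 : (7 : E) ≠ 0) : orderOf h.sig = 3 :=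
  orderOf_eq_prime h.sig_pow (h.sig_ne h7)

lemma Cyc.card (h : Cyc k E θ) (h7 : (7 : E) ≠ 0) : Nat.card Gal(E/k) = 3 := by
  have := h.fin
  have h1 : 3 ∣ Nat.card Gal(E/k) := by rw [← h.order h7]; exact orderOf_dvd_natCard _
  have h2 := AlgEquiv.card_le (F := k) (K := E)
  rw [← Nat.card_eq_fintype_card, h.fr] at h2
  exact le_antisymm h2 (Nat.le_of_dvd Nat.card_pos h1)

lemma Cyc.galois (h : Cyc k E θ) (h7 : (7 : E) ≠ 0) : IsGalois k E := by
  have := h.fin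
  exact IsGalois.of_card_aut_eq_finrank _ _ (by rw [h.card h7, h.fr])

lemma Cyc.zpow (h : Cyc k E θ) (h7 : (7 : E) ≠ 0) (x : Gal(E/k)) : x ∈ Subgroup.zpowers h.sig :=
  mem_zpowers_of_prime_card (p := 3) (h.card h7) (h.sig_ne h7)

end
end HN


namespace HN
set_option linter.unusedSectionVars false
open Module NumberField IsDedekindDomain Pointwise Polynomial

lemma seven_of {R : Type*} [CommRing R] (x : R) (h : x ^ 3 + x ^ 2 - 2 * x - 1 = 0) :
    (x ^ 2 - x - 2) * ((x ^ 2 + 3 * x + 4) * (x ^ 2 - 2)) = 7 := by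
  linear_combination (x^3+x^2-2*x-9) * h

lemma frob_aux {K : Type*} [Field K] (p : ℕ) [Fact p.Prime] [CharP K p] (hp : p % 7 = 2) (m t : K)
    (ht : t ^ 2 - m * t + 1 = 0)
    (hf : m ^ 3 + m ^ 2 - 2 * m - 1 = 0) (hmp : m ^ p = m) : m ^ 2 - m - 2 = 0 := by
  have ht0 : t ≠ 0 := by rintro rfl; simp at ht
  have hmt : m = t + t⁻¹ := by
    field_simp; linear_combination -ht
  have h6 : t ^ 6 + t ^ 5 + t ^ 4 + t ^ 3 + t ^ 2 + t + 1 = 0 := by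
    rw [hmt] at hf
    field_simp at hf
    linear_combination hf
  have h7 : t ^ 7 = 1 := by linear_combination (t - 1) * h6
  have hpp : t ^ p = t ^ 2 := by
    conv_lhs => rw [← Nat.div_add_mod p 7, hp, pow_add, pow_mul, h7, one_pow, one_mul]
  have h1 : m ^ p = t ^ 2 + (t ^ 2)⁻¹ := by
      rw [hmt, add_pow_char, inv_pow, hpp]
  rw [hmp] at h1
  have h2 : m ^ 2 = t ^ 2 + (t ^ 2)⁻¹ + 2 := by
      rw [hmt]; field_simp; ring
  rw [h2, ← h1]; ring

lemma frob_lemma {k : Type*} [Field k] (p : ℕ) [Fact p.Prime] [CharP k p] (hp : p % 7 = 2) (n : k)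
    (h : n ^ 3 + n ^ 2 - 2 * n - 1 = 0) (hn : n ^ p = n) : (7 : k) = 0 := by
  let K := AlgebraicClosure k
  have : CharP K p := charP_of_injective_algebraMap (algebraMap k K).injective p
  obtain ⟨t, ht⟩ : ∃ t : K, t ^ 2 - algebraMap k K n * t + 1 = 0 := by
    obtain ⟨t, ht⟩ := IsAlgClosed.exists_root (X ^ 2 - C (algebraMap k K n) * X + 1 : K[X]) (by
      have : (X ^ 2 - C (algebraMap k K n) * X + 1 : K[X]).degree = 2 := by compute_degree!
      rw [this]; decide)
    exact ⟨t, by simpa [IsRoot] using ht⟩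
  set m := algebraMap k K n with hm
  have hf : m ^ 3 + m ^ 2 - 2 * m - 1 = 0 := by
    have := congrArg (algebraMap k K) h
    simpa only [map_sub, map_add, map_mul, map_pow, map_ofNat, map_one, map_zero] using this
  have hmp : m ^ p = m := by rw [hm, ← map_pow, hn]
  have hz := frob_aux p hp m t ht hf hmp
  have := seven_of m hf
  rw [hz, zero_mul] at this
  apply (algebraMap k K).injective
  rw [map_ofNat, map_zero, ← this]

section
variable {F E : Type} [Field F] [NumberField F] [Field E] [NumberField E] [Algebra F E]
  [IsGalois F E] {θ : E}

lemma isInt_th (h : Cyc F E θ) : IsIntegral ℤ θ := by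
  refine ⟨X ^ 3 + X ^ 2 - 2 * X - 1, by monicity!, ?_⟩
  have := h.root
  simpa only [eval₂_sub, eval₂_add, eval₂_mul, eval₂_pow, eval₂_X, eval₂_ofNat, eval₂_one] using this

lemma coe7 : ((7 : 𝓞 F) : F) = 7 := map_ofNat (algebraMap (𝓞 F) F) 7

lemma mem_iff_val (v : HeightOneSpectrum (𝓞 F)) (x : 𝓞 F) :
    x ∈ v.asIdeal ↔ v.valuation F (x : F) < 1 := (v.valuation_lt_one_iff_mem x).symm

lemma th_cong (h : Cyc F E θ) {v : HeightOneSpectrum (𝓞 F)} {w : HeightOneSpectrum (𝓞 E)}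
    (hw : w ∈ Fib F E v) (hf : Ideal.inertiaDegIn v.asIdeal (𝓞 E) = 1) :
    ∃ n : 𝓞 F, w.valuation E (θ - algebraMap F E (n : F)) < 1 := by
  obtain ⟨n, hn⟩ := surj_of_deg_one hw hf (⟨θ, isInt_th h⟩ : 𝓞 E)
  refine ⟨n, ?_⟩
  rw [mem_iff_val] at hn
  exact hn

lemma val_th (h : Cyc F E θ) (w : HeightOneSpectrum (𝓞 E)) : w.valuation E θ ≤ 1 :=
  w.valuation_le_one (K := E) (⟨θ, isInt_th h⟩ : 𝓞 E)

lemma hram_of (h : Cyc F E θ) (v : HeightOneSpectrum (𝓞 F)) (hr : ¬ Unr F E v) :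
    (7 : 𝓞 F) ∈ v.asIdeal := by
  have hm := Fib_mul (E := E) v
  rw [h.fr] at hm
  have he : Ideal.ramificationIdxIn v.asIdeal (𝓞 E) = 3 := by
    have : Ideal.ramificationIdxIn v.asIdeal (𝓞 E) ∣ 3 :=
      ⟨(Fib F E v).ncard * Ideal.inertiaDegIn v.asIdeal (𝓞 E), by rw [← hm]; ring⟩
    exact ((Nat.dvd_prime Nat.prime_three).mp this).resolve_left hr
  have hgf : (Fib F E v).ncard * Ideal.inertiaDegIn v.asIdeal (𝓞 E) = 1 := by
    rw [he] at hm
    nlinarith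
  have hc : (Fib F E v).ncard = 1 := Nat.eq_one_of_mul_eq_one_right hgf
  have hf : Ideal.inertiaDegIn v.asIdeal (𝓞 E) = 1 := Nat.eq_one_of_mul_eq_one_left hgf
  obtain ⟨w, hw⟩ : (Fib F E v).Nonempty := by
    apply Set.nonempty_of_ncard_ne_zero; omega
  obtain ⟨n, hn⟩ := th_cong h hw hf
  have h2 := val_smul hw hc h.sig (θ - algebraMap F E (n : F))
  rw [map_sub h.sig, h.sig.commutes, h.sig_th] at h2
  have h3 : w.valuation E (θ ^ 2 - θ - 2) < 1 := by
    have e : θ ^ 2 - θ - 2 = (θ ^ 2 - 2 - algebraMap F E (n : F)) - (θ - algebraMap F E (n : F)) := by ring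
    rw [e]
    exact Valuation.map_sub_lt _ (by rw [h2]; exact hn) hn
  have h4 : w.valuation E ((θ ^ 2 + 3 * θ + 4) * (θ ^ 2 - 2)) ≤ 1 := by
    let t : 𝓞 E := ⟨θ, isInt_th h⟩
    have e : (θ ^ 2 + 3 * θ + 4) * (θ ^ 2 - 2) = algebraMap (𝓞 E) E ((t ^ 2 + 3 * t + 4) * (t ^ 2 - 2)) := by
      simp only [map_sub, map_add, map_mul, map_pow, map_ofNat]; rfl
    rw [e]
    exact w.valuation_le_one (K := E) _
  have h5 : w.valuation E 7 < 1 := by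
    rw [← h.seven, map_mul]
    exact lt_of_le_of_lt (mul_le_of_le_one_right zero_le h4) h3
  rw [mem_iff_val, coe7]
  have h6 := val_restrict hw (7 : F)
  rw [map_ofNat] at h6
  rw [h6, he] at h5
  by_contra! h'
  exact absurd h5 (not_lt.mpr (one_le_pow₀ h'))

end

section
variable {L : Type} [Field L] [NumberField L] [IsGalois ℚ L] {θ : L}

lemma exists_int (x : 𝓞 ℚ) : ∃ n : ℤ, x = n := by
  refine ⟨Rat.ringOfIntegersEquiv x, ?_⟩
  apply Rat.ringOfIntegersEquiv.injective
  simp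

lemma exists_place (p : ℕ) (hp : p.Prime) : ∃ v : HeightOneSpectrum (𝓞 ℚ),
    v.valuation ℚ (p : ℚ) = WithZero.exp (-1) ∧ (p : 𝓞 ℚ) ∈ v.asIdeal ∧ ∀ n : ℤ, (n : 𝓞 ℚ) ∈ v.asIdeal ↔ (p : ℤ) ∣ n := by
  have hp0 : (p : 𝓞 ℚ) ≠ 0 := by exact_mod_cast hp.ne_zero
  have hprime : Prime (p : 𝓞 ℚ) := by
    rw [← MulEquiv.prime_iff (Rat.ringOfIntegersEquiv : 𝓞 ℚ ≃+* ℤ)]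
    simpa using Nat.prime_iff_prime_int.mp hp
  let v : HeightOneSpectrum (𝓞 ℚ) := ⟨Ideal.span {(p : 𝓞 ℚ)}, (Ideal.span_singleton_prime hp0).mpr hprime,
    by simpa using hp0⟩
  refine ⟨v, ?_, Ideal.mem_span_singleton_self _, fun n => ?_⟩
  · have e : ((p : 𝓞 ℚ) : ℚ) = p := map_natCast (algebraMap (𝓞 ℚ) ℚ) p
    rw [← e]
    exact (v.valuation_of_algebraMap (K := ℚ) _).trans (v.intValuation_singleton hp0 rfl)
  · change (n : 𝓞 ℚ) ∈ Ideal.span {(p : 𝓞 ℚ)} ↔ _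
    rw [Ideal.mem_span_singleton]
    constructor
    · intro h
      have := map_dvd (Rat.ringOfIntegersEquiv : 𝓞 ℚ ≃+* ℤ) h
      simpa using this
    · intro h
      have := map_dvd (Int.castRingHom (𝓞 ℚ)) h
      simpa using this

lemma inert_of (h : Cyc ℚ L θ) (p : ℕ) (hp : p.Prime) (h7 : p % 7 = 2) (v : HeightOneSpectrum (𝓞 ℚ))
    (hpv : (p : 𝓞 ℚ) ∈ v.asIdeal) (hv : ∀ n : ℤ, (n : 𝓞 ℚ) ∈ v.asIdeal ↔ (p : ℤ) ∣ n) :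
    (Fib ℚ L v).ncard = 1 ∧ Ideal.ramificationIdxIn v.asIdeal (𝓞 L) = 1 := by
  have h7v : (7 : 𝓞 ℚ) ∉ v.asIdeal := by
    intro h
    have : (p : ℤ) ∣ 7 := (hv 7).mp (by exact_mod_cast h)
    have : p ∣ 7 := by exact_mod_cast this
    rcases (Nat.dvd_prime (by norm_num)).mp this with h | h <;> subst h <;> norm_num at h7
  have he : Ideal.ramificationIdxIn v.asIdeal (𝓞 L) = 1 := by
    by_contra hr
    exact h7v (hram_of h v hr)
  refine ⟨?_, he⟩
  have hm := Fib_mul (E := L) v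
  rw [h.fr, he, one_mul] at hm
  have hf : Ideal.inertiaDegIn v.asIdeal (𝓞 L) ≠ 1 := by
    intro hf
    obtain ⟨w, hw⟩ : (Fib ℚ L v).Nonempty := by
      apply Set.nonempty_of_ncard_ne_zero; rintro h0; rw [h0] at hm; omega
    obtain ⟨n, hn⟩ := th_cong h hw hf
    set N := algebraMap ℚ L (n : ℚ) with hN
    have hNle : w.valuation L N ≤ 1 := w.valuation_le_one (K := L) (algebraMap (𝓞 ℚ) (𝓞 L) n)
    have h1 : w.valuation L (N ^ 3 + N ^ 2 - 2 * N - 1) < 1 := by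
      have e : N ^ 3 + N ^ 2 - 2 * N - 1 = -((θ - N) * (θ ^ 2 + θ * N + N ^ 2 + θ + N - 2)) := by
        linear_combination h.root
      have hle : w.valuation L (θ ^ 2 + θ * N + N ^ 2 + θ + N - 2) ≤ 1 := by
        let t : 𝓞 L := ⟨θ, isInt_th h⟩
        let M : 𝓞 L := algebraMap (𝓞 ℚ) (𝓞 L) n
        have e : θ ^ 2 + θ * N + N ^ 2 + θ + N - 2 = algebraMap (𝓞 L) L (t ^ 2 + t * M + M ^ 2 + t + M - 2) := by
          simp only [map_sub, map_add, map_mul, map_pow, map_ofNat]; rfl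
        rw [e]
        exact w.valuation_le_one (K := L) _
      rw [e, Valuation.map_neg, map_mul]
      exact lt_of_le_of_lt (mul_le_of_le_one_right zero_le hle) hn
    have e2 : N ^ 3 + N ^ 2 - 2 * N - 1 = algebraMap ℚ L ((n ^ 3 + n ^ 2 - 2 * n - 1 : 𝓞 ℚ) : ℚ) := by
      have : ((n ^ 3 + n ^ 2 - 2 * n - 1 : 𝓞 ℚ) : ℚ) = (n : ℚ) ^ 3 + (n : ℚ) ^ 2 - 2 * (n : ℚ) - 1 := by
        change algebraMap (𝓞 ℚ) ℚ _ = _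
        simp only [map_sub, map_add, map_mul, map_pow, map_ofNat, map_one]
      rw [this]
      simp only [map_sub, map_add, map_mul, map_pow, map_ofNat, map_one, hN]
    rw [e2, val_restrict hw, he, pow_one, ← mem_iff_val] at h1
    -- pass to the quotient
    have := v.isMaximal
    let _ : Field (𝓞 ℚ ⧸ v.asIdeal) := Ideal.Quotient.field _
    have : Fact p.Prime := ⟨hp⟩
    have hp0 : ((p : ℕ) : 𝓞 ℚ ⧸ v.asIdeal) = 0 := by
      have := Ideal.Quotient.eq_zero_iff_mem.mpr hpv
      rwa [map_natCast] at this
    have : CharP (𝓞 ℚ ⧸ v.asIdeal) p := (CharP.charP_iff_prime_eq_zero hp).mpr hp0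
    have h0 := Ideal.Quotient.eq_zero_iff_mem.mpr h1
    simp only [map_sub, map_add, map_mul, map_pow, map_ofNat, map_one] at h0
    apply h7v
    rw [← Ideal.Quotient.eq_zero_iff_mem, map_ofNat]
    refine frob_lemma p h7 _ h0 ?_
    obtain ⟨m, rfl⟩ := exists_int n
    rw [map_intCast]
    have := ZMod.pow_card (p := p) (m : ZMod p)
    have := congrArg (ZMod.castHom dvd_rfl (𝓞 ℚ ⧸ v.asIdeal)) this
    rwa [map_pow, map_intCast] at this
  have hd : (Fib ℚ L v).ncard ∣ 3 := ⟨_, hm.symm⟩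
  rcases (Nat.dvd_prime Nat.prime_three).mp hd with h' | h'
  · exact h'
  · rw [h'] at hm
    exact absurd (by omega) hf

theorem exists_val (h : Cyc ℚ L θ) (p : ℕ) (hp : p.Prime) (h7 : p % 7 = 2) :
    ∃ w : Valuation L (WithZero (Multiplicative ℤ)), (∀ x, w (h.sig x) = w x) ∧
      w (p : L) = WithZero.exp (-1) ∧ ∀ n : ℕ, ¬ p ∣ n → w (n : L) = 1 := by
  obtain ⟨v, h1, h2, h3⟩ := exists_place p hp
  obtain ⟨hc, he⟩ := inert_of h p hp h7 v h2 h3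
  obtain ⟨w, hw⟩ : (Fib ℚ L v).Nonempty := by
    apply Set.nonempty_of_ncard_ne_zero; omega
  refine ⟨w.valuation L, val_smul hw hc h.sig, ?_, fun n hn => ?_⟩
  · rw [← map_natCast (algebraMap ℚ L), val_restrict hw, he, pow_one, h1]
  · rw [← map_natCast (algebraMap ℚ L), val_restrict hw, he, pow_one]
    have e : ((n : 𝓞 ℚ) : ℚ) = n := map_natCast (algebraMap (𝓞 ℚ) ℚ) n
    rw [← e]
    refine v.valuation_eq_one_iff_notMem.mpr ?_
    rw [← Int.cast_natCast, h3]
    exact_mod_cast hn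

end
end HN


namespace HN
set_option linter.unusedSectionVars false
open Module NumberField IsDedekindDomain Pointwise Polynomial

lemma hroot_of {E : Type} [Field E] [Algebra ℚ E] (h9 : finrank ℚ E = 9) (x : E) (hx : x ^ 3 = 1) : x = 1 := by
  by_contra h1
  have hfin : FiniteDimensional ℚ E := FiniteDimensional.of_finrank_pos (by omega)
  have h2 : x ^ 2 + x + 1 = 0 := by
    have : (x - 1) * (x ^ 2 + x + 1) = 0 := by linear_combination hx
    exact (mul_eq_zero.mp this).resolve_left (sub_ne_zero.mpr h1)
  have hd : (minpoly ℚ x).natDegree ∣ 9 := by rw [← h9]; exact minpoly.degree_dvd (Algebra.IsIntegral.isIntegral x)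
  have hle : (minpoly ℚ x).natDegree ≤ 2 := by
    have h3 : minpoly ℚ x ∣ (X ^ 2 + X + 1 : ℚ[X]) := minpoly.dvd _ _ (by simpa using h2)
    have h4 : (X ^ 2 + X + 1 : ℚ[X]).natDegree = 2 := by compute_degree!
    rw [← h4]
    refine natDegree_le_of_dvd h3 ?_
    intro h0; rw [h0] at h4; simp at h4
  have h1' : (minpoly ℚ x).natDegree = 1 := by
    generalize (minpoly ℚ x).natDegree = d at *
    interval_cases d <;> omega
  obtain ⟨q, rfl⟩ := minpoly.natDegree_eq_one_iff.mp h1'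
  have h5 : q ^ 2 + q + 1 = 0 := by
    apply (algebraMap ℚ E).injective
    simpa only [map_add, map_pow, map_one, map_zero] using h2
  nlinarith [sq_nonneg (q + 1/2)]

/-- the parameters of the algebras -/
def Aval {N : ℕ} (p : Fin N → ℕ) (i : Fin N) : ℕ := 2 * (∏ k, p k) * p i

section
variable {N : ℕ} {p : Fin N → ℕ} 

lemma Aval_mod (h7 : ∀ i, p i % 7 = 2) (i : Fin N) : ((Aval p i : ℕ) : ZMod 7) = 2 ^ (N + 2) := by
  have h : ∀ i, ((p i : ℕ) : ZMod 7) = 2 := fun i => by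
    have := ZMod.natCast_mod (p i) 7
    rw [h7 i] at this
    exact this.symm
  unfold Aval
  push_cast
  rw [Finset.prod_congr rfl (fun k _ => h k), h i, Finset.prod_const, Finset.card_univ, Fintype.card_fin]
  ring

variable {F E : Type} [Field F] [NumberField F] [Field E] [NumberField E] [Algebra F E]
  [IsGalois F E] {θ : E}

lemma lval_nat (v : HeightOneSpectrum (𝓞 F)) (n : ℕ) (u : Fˣ) (hu : (u : F) = n) (h : lval v u ≠ 1) :
    (n : 𝓞 F) ∈ v.asIdeal := by
  by_contra hn
  apply h
  rw [lval_eq_one, hu]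
  have e : ((n : 𝓞 F) : F) = n := map_natCast (algebraMap (𝓞 F) F) n
  have : v.valuation F ((n : 𝓞 F) : F) = 1 := v.valuation_eq_one_iff_notMem.mpr hn
  rw [← e, this]
  simp

lemma coprime_place (v : HeightOneSpectrum (𝓞 F)) {m n : ℕ} (h : m.Coprime n) (hm : (m : 𝓞 F) ∈ v.asIdeal)
    (hn : (n : 𝓞 F) ∈ v.asIdeal) : False := by
  have h1 : IsCoprime (m : 𝓞 F) (n : 𝓞 F) := by
    have := (Nat.isCoprime_iff_coprime.mpr h).map (Int.castRingHom (𝓞 F))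
    simpa using this
  obtain ⟨a, b, hab⟩ := h1
  apply v.isPrime.ne_top
  rw [Ideal.eq_top_iff_one, ← hab]
  exact add_mem (Ideal.mul_mem_left _ _ hm) (Ideal.mul_mem_left _ _ hn)

lemma sq_ne {x : Multiplicative (ZMod 3)} (hx : x ≠ 1) : x * x ≠ 1 := by
  revert x; decide

theorem norm_transfer (h : Cyc F E θ) (h9 : finrank ℚ E = 9) (hp : ∀ i, (p i).Prime)
    (h7 : ∀ i, p i % 7 = 2) (h2 : ∀ i, p i ≠ 2) (hinj : Function.Injective p) (i j : Fin N)
    (e : E) (he : e * h.sig e * h.sig (h.sig e) = (Aval p i : E)) :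
    ∃ e' : E, e' * h.sig e' * h.sig (h.sig e') = (Aval p j : E) := by
  classical
  have h70 : (7 : E) ≠ 0 := by norm_num
  have hA0 : ∀ i, Aval p i ≠ 0 := fun i => by
    unfold Aval
    refine mul_ne_zero (mul_ne_zero two_ne_zero (Finset.prod_ne_zero_iff.mpr fun k _ => (hp k).ne_zero)) (hp i).ne_zero
  let U : ℕ → Fˣ := fun n => if hn : (n : F) = 0 then 1 else Units.mk0 (n : F) hn
  have hU : ∀ n : ℕ, n ≠ 0 → ((U n : Fˣ) : F) = n := by
    intro n hn
    have : (n : F) ≠ 0 := by exact_mod_cast hn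
    simp only [U, dif_neg this, Units.val_mk0]
  have hUA : ∀ i, U (Aval p i) = U 2 * (∏ k, U (p k)) * U (p i) := by
    intro i
    ext
    rw [hU _ (hA0 i), Units.val_mul, Units.val_mul, hU 2 two_ne_zero, hU _ (hp i).ne_zero, Units.coe_prod,
      Finset.prod_congr rfl (fun k _ => hU _ (hp k).ne_zero)]
    unfold Aval
    push_cast; rfl
  have he0 : e ≠ 0 := by
    rintro rfl
    simp at he
    exact hA0 i (by exact_mod_cast he.symm)
  have key := hasse2 h.fr (hroot_of h9) (hram_of h) h.sig (h.zpow h70) (U (Aval p i)) (U (Aval p j)) ?_ ?_ ?_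
  · obtain ⟨y, hy⟩ := key
    refine ⟨y, ?_⟩
    have h1 := norm_eq3 h.fr h.sig (h.zpow h70) (y : E)
    have h2 : Algebra.norm F (y : E) = (Aval p j : F) := by
      rw [← hU _ (hA0 j), ← hy]; rfl
    rw [← h1, h2, map_natCast]
  · refine ⟨Units.mk0 e he0, ?_⟩
    ext
    change Algebra.norm F e = _
    apply (algebraMap F E).injective
    rw [norm_eq3 h.fr h.sig (h.zpow h70), he, hU _ (hA0 i), map_natCast]
  · intro v hv
    rw [hUA i] at hv
    rw [hUA j]
    simp only [map_mul, map_prod] at hv ⊢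
    by_cases h2v : lval v (U 2) = 1
    · by_cases hall : ∀ k, lval v (U (p k)) = 1
      · simp [h2v, hall]
      · exfalso
        push Not at hall
        obtain ⟨k, hk⟩ := hall
        have hothers : ∀ l, l ≠ k → lval v (U (p l)) = 1 := by
          intro l hl
          by_contra hc
          exact coprime_place v ((Nat.coprime_primes (hp l) (hp k)).mpr (fun h => hl (hinj h)))
            (lval_nat v _ _ (hU _ (hp l).ne_zero) hc) (lval_nat v _ _ (hU _ (hp k).ne_zero) hk)
        rw [h2v, one_mul, Finset.prod_eq_single k (fun l _ hl => hothers l hl) (by simp)] at hv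
        by_cases hik : i = k
        · subst hik; exact sq_ne hk hv
        · rw [hothers i hik, mul_one] at hv; exact hk hv
    · exfalso
      have hothers : ∀ l, lval v (U (p l)) = 1 := by
        intro l
        by_contra hc
        exact coprime_place v ((Nat.coprime_primes (hp l) Nat.prime_two).mpr (h2 l))
          (lval_nat v _ _ (hU _ (hp l).ne_zero) hc) (lval_nat v 2 _ (hU _ two_ne_zero) h2v)
      simp [hothers] at hv
      exact h2v hv
  · intro v hv
    have hd : (7 : ℤ) ∣ (Aval p j : ℤ) - Aval p i := by
      refine (ZMod.intCast_zmod_eq_zero_iff_dvd _ 7).mp ?_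
      push_cast
      rw [Aval_mod h7, Aval_mod h7, sub_self]
    have h20 : (2 : ZMod 7) ≠ 0 := by decide
    have hnd : ¬ 7 ∣ Aval p i := by
      rw [← ZMod.natCast_eq_zero_iff, Aval_mod h7]
      have : Fact (Nat.Prime 7) := ⟨by norm_num⟩
      exact pow_ne_zero _ h20
    have hcop : Nat.Coprime 7 (Aval p i) := (Nat.Prime.coprime_iff_not_dvd (by norm_num)).mpr hnd
    have hAi : v.valuation F (Aval p i : F) = 1 := by
      have e : ((Aval p i : 𝓞 F) : F) = Aval p i := map_natCast (algebraMap (𝓞 F) F) _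
      rw [← e]
      refine v.valuation_eq_one_iff_notMem.mpr fun hc => coprime_place v hcop (by exact_mod_cast hv) hc
    obtain ⟨c, hc⟩ := hd
    change v.valuation F (((U (Aval p j) / U (Aval p i) : Fˣ) : F) - 1) < 1
    have hi0 : (Aval p i : F) ≠ 0 := by exact_mod_cast hA0 i
    have e : ((U (Aval p j) / U (Aval p i) : Fˣ) : F) - 1 = (((7 * c : ℤ) : 𝓞 F) : F) / (Aval p i : F) := by
      rw [Units.val_div_eq_div_val, hU _ (hA0 j), hU _ (hA0 i), ← hc]
      have : ((((Aval p j : ℤ) - Aval p i : ℤ) : 𝓞 F) : F) = Aval p j - Aval p i := by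
        rw [show ((((Aval p j : ℤ) - Aval p i : ℤ) : 𝓞 F) : F) = (((Aval p j : ℤ) - Aval p i : ℤ) : F) from
          map_intCast (algebraMap (𝓞 F) F) _]
        push_cast; rfl
      rw [this]
      field_simp
    rw [e, map_div₀, hAi, div_one, ← mem_iff_val]
    push_cast
    exact Ideal.mul_mem_right _ _ hv

end
end HN


namespace HN
set_option linter.unusedSectionVars false
open Module

section
variable {k L : Type} [Field k] [Field L] [Algebra k L]

/-- the cyclic algebra `(L/k, σ, a)` of degree 3 -/
def CA (σ : Gal(L/k)) (_h3 : ∀ x, σ (σ (σ x)) = x) (_a : k) : Type := L × L × L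

variable {σ : Gal(L/k)} {h3 : ∀ x, σ (σ (σ x)) = x} {a : k}

noncomputable instance : AddCommGroup (CA σ h3 a) := inferInstanceAs (AddCommGroup (L × L × L))
noncomputable instance : Module k (CA σ h3 a) := inferInstanceAs (Module k (L × L × L))

namespace CA

/-- constructor -/
def mk (x y z : L) : CA σ h3 a := ((x, y, z) : L × L × L)
/-- coordinate -/
def x (d : CA σ h3 a) : L := (show L × L × L from d).1
/-- coordinate -/
def y (d : CA σ h3 a) : L := (show L × L × L from d).2.1
/-- coordinate -/
def z (d : CA σ h3 a) : L := (show L × L × L from d).2.2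

lemma ext' {d e : CA σ h3 a} (hx : d.x = e.x) (hy : d.y = e.y) (hz : d.z = e.z) : d = e :=
  Prod.ext hx (Prod.ext hy hz)

@[simp] lemma mk_x (x y z : L) : (mk x y z : CA σ h3 a).x = x := rfl
@[simp] lemma mk_y (x y z : L) : (mk x y z : CA σ h3 a).y = y := rfl
@[simp] lemma mk_z (x y z : L) : (mk x y z : CA σ h3 a).z = z := rfl
@[simp] lemma add_x (d e : CA σ h3 a) : (d + e).x = d.x + e.x := rfl
@[simp] lemma add_y (d e : CA σ h3 a) : (d + e).y = d.y + e.y := rfl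
@[simp] lemma add_z (d e : CA σ h3 a) : (d + e).z = d.z + e.z := rfl
@[simp] lemma zero_x : (0 : CA σ h3 a).x = 0 := rfl
@[simp] lemma zero_y : (0 : CA σ h3 a).y = 0 := rfl
@[simp] lemma zero_z : (0 : CA σ h3 a).z = 0 := rfl
@[simp] lemma smul_x (r : k) (d : CA σ h3 a) : (r • d).x = algebraMap k L r * d.x := Algebra.smul_def _ _
@[simp] lemma smul_y (r : k) (d : CA σ h3 a) : (r • d).y = algebraMap k L r * d.y := Algebra.smul_def _ _
@[simp] lemma smul_z (r : k) (d : CA σ h3 a) : (r • d).z = algebraMap k L r * d.z := Algebra.smul_def _ _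

instance : Mul (CA σ h3 a) := ⟨fun d e => mk
  (d.x * e.x + algebraMap k L a * (d.y * σ e.z) + algebraMap k L a * (d.z * σ (σ e.y)))
  (d.x * e.y + d.y * σ e.x + algebraMap k L a * (d.z * σ (σ e.z)))
  (d.x * e.z + d.y * σ e.y + d.z * σ (σ e.x))⟩

instance : One (CA σ h3 a) := ⟨mk 1 0 0⟩

@[simp] lemma mul_x (d e : CA σ h3 a) : (d * e).x =
  d.x * e.x + algebraMap k L a * (d.y * σ e.z) + algebraMap k L a * (d.z * σ (σ e.y)) := rfl
@[simp] lemma mul_y (d e : CA σ h3 a) : (d * e).y =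
  d.x * e.y + d.y * σ e.x + algebraMap k L a * (d.z * σ (σ e.z)) := rfl
@[simp] lemma mul_z (d e : CA σ h3 a) : (d * e).z =
  d.x * e.z + d.y * σ e.y + d.z * σ (σ e.x) := rfl
@[simp] lemma one_x : (1 : CA σ h3 a).x = 1 := rfl
@[simp] lemma one_y : (1 : CA σ h3 a).y = 0 := rfl
@[simp] lemma one_z : (1 : CA σ h3 a).z = 0 := rfl

noncomputable instance : Ring (CA σ h3 a) :=
  { (inferInstance : AddCommGroup (CA σ h3 a)), (inferInstance : Mul (CA σ h3 a)), (inferInstance : One (CA σ h3 a)) with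
    left_distrib := fun d e f => by
      apply ext' <;> simp <;> ring
    right_distrib := fun d e f => by
      apply ext' <;> simp <;> ring
    zero_mul := fun d => by apply ext' <;> simp
    mul_zero := fun d => by apply ext' <;> simp
    mul_assoc := fun d e f => by
      apply ext' <;> simp [h3] <;> ring
    one_mul := fun d => by apply ext' <;> simp
    mul_one := fun d => by apply ext' <;> simp }

noncomputable instance : Algebra k (CA σ h3 a) := Algebra.ofModule
  (fun r d e => by apply ext' <;> simp <;> ring)
  (fun r d e => by apply ext' <;> simp <;> ring)

@[simp] lemma neg_x (d : CA σ h3 a) : (-d).x = -d.x := rfl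
@[simp] lemma neg_y (d : CA σ h3 a) : (-d).y = -d.y := rfl
@[simp] lemma neg_z (d : CA σ h3 a) : (-d).z = -d.z := rfl
@[simp] lemma sub_x (d e : CA σ h3 a) : (d - e).x = d.x - e.x := by simp [sub_eq_add_neg]
@[simp] lemma sub_y (d e : CA σ h3 a) : (d - e).y = d.y - e.y := by simp [sub_eq_add_neg]
@[simp] lemma sub_z (d e : CA σ h3 a) : (d - e).z = d.z - e.z := by simp [sub_eq_add_neg]

lemma algebraMap_eq (r : k) : algebraMap k (CA σ h3 a) r = mk (algebraMap k L r) 0 0 := by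
  rw [Algebra.algebraMap_eq_smul_one]
  apply ext' <;> simp

instance : Nontrivial (CA σ h3 a) := ⟨⟨0, 1, fun h => by
  have := congrArg x h
  simp at this⟩⟩

instance [FiniteDimensional k L] : FiniteDimensional k (CA σ h3 a) :=
  inferInstanceAs (FiniteDimensional k (L × L × L))

lemma finrank_eq [FiniteDimensional k L] (h : finrank k L = 3) : finrank k (CA σ h3 a) = 9 := by
  have : finrank k (CA σ h3 a) = finrank k (L × L × L) := rfl
  rw [this, finrank_prod, finrank_prod, h]

variable (σ h3 a) in
/-- embedding of `L` -/
noncomputable def inc : L →ₐ[k] CA σ h3 a where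
  toFun l := mk l 0 0
  map_one' := rfl
  map_zero' := rfl
  map_mul' l m := by apply ext' <;> simp
  map_add' l m := by apply ext' <;> simp
  commutes' r := (algebraMap_eq r).symm

variable (σ h3 a) in
/-- generator -/
def u : CA σ h3 a := mk 0 1 0

lemma inc_def (l : L) : inc σ h3 a l = mk l 0 0 := rfl

lemma u_inc (l : L) : u σ h3 a * inc σ h3 a l = inc σ h3 a (σ l) * u σ h3 a := by
  apply ext' <;> simp [inc_def, u]

lemma u_cube : u σ h3 a ^ 3 = algebraMap k _ a := by
  rw [algebraMap_eq, pow_succ, pow_two]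
  apply ext' <;> simp [u]

lemma center_eq {θ : L} (h1 : σ θ ≠ θ) (h2 : σ (σ θ) ≠ θ)
    (hfix : ∀ l, σ l = l → l ∈ Set.range (algebraMap k L)) :
    Subalgebra.center k (CA σ h3 a) = ⊥ := by
  rw [eq_bot_iff]
  intro d hd
  rw [Subalgebra.mem_center_iff] at hd
  have e1 := hd (inc σ h3 a θ)
  have e2 := hd (u σ h3 a)
  have hy := congrArg y e1
  have hz := congrArg z e1
  have hx := congrArg y e2
  simp [inc_def, u] at hx hy hz
  have hy0 : d.y = 0 := by
    rw [mul_comm] at hy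
    by_contra h
    exact h1 (mul_left_cancel₀ h hy).symm
  have hz0 : d.z = 0 := by
    rw [mul_comm] at hz
    by_contra h
    exact h2 (mul_left_cancel₀ h hz).symm
  obtain ⟨r, hr⟩ := hfix _ hx
  rw [Algebra.mem_bot]
  refine ⟨r, ?_⟩
  rw [algebraMap_eq]
  apply ext'
  · simp [hr]
  · simp [hy0]
  · simp [hz0]

/-- leading `x` -/
def Lead (w : Valuation L (WithZero (Multiplicative ℤ))) (d : CA σ h3 a) : Prop :=
  d.x ≠ 0 ∧ w d.y ≤ w d.x ∧ w d.z ≤ w d.x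

lemma Lead.mul_ne {w : Valuation L (WithZero (Multiplicative ℤ))} (hw : ∀ x, w (σ x) = w x)
    (ha : w (algebraMap k L a) = WithZero.exp (-1)) {d e : CA σ h3 a} (hd : Lead w d) (he : Lead w e) :
    d * e ≠ 0 := by
  intro h
  have hx := congrArg x h
  rw [mul_x, zero_x] at hx
  have hpos : w (d.x * e.x) ≠ 0 := (Valuation.ne_zero_iff _).mpr (mul_ne_zero hd.1 he.1)
  have hlt : WithZero.exp (-1) * w (d.x * e.x) < w (d.x * e.x) := by
    have : (WithZero.exp (-1) : WithZero (Multiplicative ℤ)) < 1 := by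
      rw [← WithZero.exp_zero, WithZero.exp_lt_exp]; norm_num
    exact mul_lt_of_lt_one_left (zero_lt_iff.mpr hpos) this
  have h1 : w (algebraMap k L a * (d.y * σ e.z)) < w (d.x * e.x) := by
    refine lt_of_le_of_lt ?_ hlt
    rw [map_mul, map_mul, map_mul, ha, hw]
    exact mul_le_mul_right (mul_le_mul' hd.2.1 he.2.2) _
  have h2 : w (algebraMap k L a * (d.z * σ (σ e.y))) < w (d.x * e.x) := by
    refine lt_of_le_of_lt ?_ hlt
    rw [map_mul, map_mul, map_mul, ha, hw, hw]
    exact mul_le_mul_right (mul_le_mul' hd.2.2 he.2.1) _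
  have h3 : w (d.x * e.x) < w (d.x * e.x) := by
    have e0 : d.x * e.x = -(algebraMap k L a * (d.y * σ e.z) + algebraMap k L a * (d.z * σ (σ e.y))) := by
      linear_combination hx
    conv_lhs => rw [e0, Valuation.map_neg]
    exact Valuation.map_add_lt _ h1 h2
  exact lt_irrefl _ h3

lemma le_of_lt' {s t : WithZero (Multiplicative ℤ)} (h : s < t) : s ≤ WithZero.exp (-1) * t := by
  have ht : t ≠ 0 := (lt_of_le_of_lt zero_le h).ne'
  rw [← WithZero.lt_mul_exp_iff_le (mul_ne_zero WithZero.exp_ne_zero ht), mul_right_comm, ← WithZero.exp_add]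
  simpa using h

lemma exists_lead {w : Valuation L (WithZero (Multiplicative ℤ))} (hw : ∀ x, w (σ x) = w x)
    (ha : w (algebraMap k L a) = WithZero.exp (-1)) {d : CA σ h3 a} (hd : d ≠ 0) :
    (∃ c, Lead w (c * d)) ∧ ∃ c, Lead w (d * c) := by
  have ha0 : algebraMap k L a ≠ 0 := by
    intro h; rw [h, map_zero] at ha; exact WithZero.exp_ne_zero ha.symm
  have hz0 : ∀ {l : L} {s : WithZero (Multiplicative ℤ)}, s < w l → l ≠ 0 := by
    rintro l s h rfl; rw [map_zero] at h; exact not_lt_zero h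
  by_cases hx : w d.y ≤ w d.x ∧ w d.z ≤ w d.x
  · have : Lead w d := by
      refine ⟨?_, hx⟩
      intro h0
      rw [h0, map_zero] at hx
      apply hd
      have h1 : d.y = 0 := (Valuation.zero_iff _).mp (le_antisymm hx.1 zero_le)
      have h2 : d.z = 0 := (Valuation.zero_iff _).mp (le_antisymm hx.2 zero_le)
      exact ext' h0 h1 h2
    exact ⟨⟨1, by rwa [one_mul]⟩, ⟨1, by rwa [mul_one]⟩⟩
  · by_cases hy : w d.x < w d.y ∧ w d.z ≤ w d.y
    · refine ⟨⟨mk 0 0 1, ?_⟩, ⟨mk 0 0 1, ?_⟩⟩ <;>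
      refine ⟨?_, ?_, ?_⟩ <;> simp [ha0, hz0 hy.1, ha, hw]
      · exact hy.2
      · exact le_of_lt' hy.1
      · exact hy.2
      · exact le_of_lt' hy.1
    · have h1 : w d.x < w d.z ∧ w d.y < w d.z := by
        rcases lt_or_ge (w d.x) (w d.y) with h | h
        · have := lt_of_not_ge (fun h' => hy ⟨h, h'⟩)
          exact ⟨h.trans this, this⟩
        · have := lt_of_not_ge (fun h' => hx ⟨h, h'⟩)
          exact ⟨this, lt_of_le_of_lt h this⟩
      refine ⟨⟨mk 0 1 0, ?_⟩, ⟨mk 0 1 0, ?_⟩⟩ <;>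
      refine ⟨?_, ?_, ?_⟩ <;> simp [ha0, hz0 h1.1, ha, hw]
      · exact le_of_lt' h1.1
      · exact le_of_lt' h1.2
      · exact le_of_lt' h1.1
      · exact le_of_lt' h1.2

lemma noZeroDiv {w : Valuation L (WithZero (Multiplicative ℤ))} (hw : ∀ x, w (σ x) = w x)
    (ha : w (algebraMap k L a) = WithZero.exp (-1)) : NoZeroDivisors (CA σ h3 a) := by
  refine ⟨fun {d e} h => ?_⟩
  by_contra! hc
  obtain ⟨c, hc1⟩ := (exists_lead hw ha hc.1).1
  obtain ⟨c', hc2⟩ := (exists_lead hw ha hc.2).2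
  apply hc1.mul_ne hw ha hc2
  rw [mul_assoc, ← mul_assoc d, h, zero_mul, mul_zero]

end CA
end
end HN


namespace HN
set_option linter.unusedSectionVars false
open Module

lemma exists_inv {k D : Type} [Field k] [Ring D] [Nontrivial D] [Algebra k D] [FiniteDimensional k D]
    [NoZeroDivisors D] (d : D) (hd : d ≠ 0) : ∃ e, d * e = 1 ∧ e * d = 1 := by
  have : IsDomain D := NoZeroDivisors.to_isDomain D
  let := divisionRingOfFiniteDimensional k D
  exact ⟨d⁻¹, mul_inv_cancel₀ hd, inv_mul_cancel₀ hd⟩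

/-- A5 -/
theorem embed_norm {k F E D : Type} [Field k] [Field F] [Field E] [Algebra k F] [Algebra F E]
    [Ring D] [Nontrivial D] [Algebra k D] {θ : E} (h : Cyc F E θ) (hF : finrank k F = 3) (hD : finrank k D = 9)
    (T u : D) (hT : T ^ 3 + T ^ 2 - 2 * T - 1 = 0) (huT : u * T = (T ^ 2 - 2) * u) (a : k)
    (hu : u ^ 3 = algebraMap k D a) (ι : F →ₐ[k] D) :
    ∃ e : E, e * h.sig e * h.sig (h.sig e) = algebraMap F E (algebraMap k F a) := by
  let : Module F D :=
    { smul := fun f d => d * ι f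
      one_smul := fun d => by change d * ι 1 = d; simp
      mul_smul := fun f g d => by
        change d * ι (f * g) = d * ι g * ι f
        rw [mul_comm f g, map_mul, mul_assoc]
      smul_zero := fun f => zero_mul _
      smul_add := fun f d e => add_mul _ _ _
      add_smul := fun f g d => by
        change d * ι (f + g) = d * ι f + d * ι g
        rw [map_add, mul_add]
      zero_smul := fun d => by change d * ι 0 = 0; simp }
  have smul_def : ∀ (f : F) (d : D), f • d = d * ι f := fun _ _ => rfl
  have : IsScalarTower k F D := ⟨fun r f d => by
    rw [smul_def, smul_def, map_smul, mul_smul_comm]⟩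
  have hFD : finrank F D = 3 := by
    have := finrank_mul_finrank k F D
    rw [hF, hD] at this; omega
  let Lm : D → Module.End F D := fun c =>
    { toFun := fun d => c * d
      map_add' := mul_add c
      map_smul' := fun f d => by simp only [smul_def, RingHom.id_apply, mul_assoc] }
  have Lm_def : ∀ c d, Lm c d = c * d := fun _ _ => rfl
  have hroot : (Lm T) ^ 3 + (Lm T) ^ 2 - 2 * Lm T - 1 = 0 := by
    ext d
    have e2 : ∀ d : D, (2 : Module.End F D) d = 2 * d := fun d => by
      rw [← one_add_one_eq_two, ← one_add_one_eq_two, add_mul]; simp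
    have := congrArg (· * d) hT
    simp only [sub_mul, add_mul, zero_mul, pow_succ, pow_zero, one_mul, mul_assoc] at this
    simp only [LinearMap.sub_apply, LinearMap.add_apply, pow_succ, pow_zero, one_mul, Module.End.mul_apply, Lm_def, e2,
      Module.End.one_apply, LinearMap.zero_apply]
    exact this
  have haev : Polynomial.aeval (Lm T) (minpoly F h.pb.gen) = 0 := by
    rw [h.pb_gen, h.minpoly_eq]
    simpa only [cf, map_sub, map_add, map_mul, map_pow, Polynomial.aeval_X, map_ofNat, map_one] using hroot
  let ρ : E →ₐ[F] Module.End F D := h.pb.lift (Lm T) haev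
  have hρθ : ρ θ = Lm T := by
    have := h.pb.lift_gen (Lm T) haev
    rw [← this]
    change _ = ρ h.pb.gen
    rw [h.pb_gen]
  let Φ : E →ₗ[F] D := (LinearMap.applyₗ (1 : D)).comp ρ.toLinearMap
  have Φ_def : ∀ e, Φ e = ρ e 1 := fun _ => rfl
  have hinj : Function.Injective Φ := by
    rw [injective_iff_map_eq_zero]
    intro e he
    by_contra h0
    have h1 : ρ e⁻¹ (ρ e 1) = 1 := by
      rw [← Module.End.mul_apply, ← map_mul, inv_mul_cancel₀ h0, map_one ρ, Module.End.one_apply]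
    rw [← Φ_def, he, map_zero] at h1
    exact zero_ne_one h1
  have := h.fin
  have : FiniteDimensional F D := FiniteDimensional.of_finrank_pos (by omega)
  have hsurj : Function.Surjective Φ :=
    (LinearMap.injective_iff_surjective_of_finrank_eq_finrank (by rw [h.fr, hFD])).mp hinj
  have hcomm : ∀ e : E, Lm u * ρ e = ρ (h.sig e) * Lm u := by
    intro e
    have he : e ∈ Algebra.adjoin F {θ} := by rw [h.adjoin]; trivial
    induction he using Algebra.adjoin_induction with
    | mem x hx =>
      rw [Set.mem_singleton_iff] at hx
      subst hx
      rw [h.sig_th, map_sub, map_pow, map_ofNat, hρθ]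
      ext d
      have e2 : ∀ d : D, (2 : Module.End F D) d = 2 * d := fun d => by
        rw [← one_add_one_eq_two, ← one_add_one_eq_two, add_mul]; simp
      have := congrArg (· * d) huT
      simp only [sub_mul, pow_two, mul_assoc] at this
      simp only [LinearMap.sub_apply, pow_two, Module.End.mul_apply, Lm_def, e2]
      exact this
    | algebraMap r => rw [h.sig.commutes, ρ.commutes, Algebra.commutes]
    | add x y _ _ hx hy => rw [map_add, map_add, map_add, mul_add, add_mul, hx, hy]
    | mul x y _ _ hx hy => rw [map_mul, map_mul, map_mul, ← mul_assoc, hx, mul_assoc, hy, mul_assoc]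
  have hcomm' : ∀ (e : E) (d : D), u * ρ e d = ρ (h.sig e) (u * d) := fun e d =>
    DFunLike.congr_fun (hcomm e) d
  obtain ⟨e, he⟩ := hsurj u
  rw [Φ_def] at he
  refine ⟨e, hinj ?_⟩
  have hu2 : u * u = ρ (h.sig e * e) 1 := by
    conv_lhs => rw [← he, he, ← he]
    rw [he]
    conv_lhs => arg 2; rw [← he]
    rw [hcomm', mul_one, map_mul, Module.End.mul_apply, he]
  have hu3 : u * (u * u) = ρ (h.sig (h.sig e) * h.sig e * e) 1 := by
    rw [hu2, hcomm', mul_one, map_mul h.sig, map_mul ρ _ e, Module.End.mul_apply, he]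
  rw [Φ_def, Φ_def, show e * h.sig e * h.sig (h.sig e) = h.sig (h.sig e) * h.sig e * e by ring, ← hu3,
    ρ.commutes, Module.algebraMap_end_apply, smul_def, one_mul, ι.commutes, ← hu, pow_succ, pow_two, mul_assoc]

/-- A6 -/
theorem norm_embed {k F E L : Type} [Field k] [Field F] [Field E] [Field L] [Algebra k F] [Algebra F E] [Algebra k E]
    [IsScalarTower k F E] [Algebra k L] (σ : Gal(L/k)) (h3 : ∀ x, σ (σ (σ x)) = x) (a : k)
    (τ : Gal(E/F)) (j : L →ₐ[k] E) (hj : ∀ l, j (σ l) = τ (j l))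
    [FiniteDimensional k L] [FiniteDimensional k E]
    [NoZeroDivisors (CA σ h3 a)] (hD : finrank k (CA σ h3 a) = finrank k E) (e : E)
    (hτ : ∀ x, τ (τ (τ x)) = x)
    (he : e * τ e * τ (τ e) = algebraMap k E a) : Nonempty (F →ₐ[k] CA σ h3 a) := by
  let act : CA σ h3 a → E → E := fun d m => j d.x * m + j d.y * (τ m * e) + j d.z * (τ (τ m) * τ e * e)
  have act_def : ∀ d m, act d m = j d.x * m + j d.y * (τ m * e) + j d.z * (τ (τ m) * τ e * e) := fun _ _ => rfl
  have act_mul : ∀ c d m, act (c * d) m = act c (act d m) := by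
    intro c d m
    simp only [act_def, CA.mul_x, CA.mul_y, CA.mul_z, map_add, map_mul, hj, j.commutes, hτ, ← he]
    ring
  have act_F : ∀ d (f : F) m, act d (algebraMap F E f * m) = algebraMap F E f * act d m := by
    intro d f m
    simp only [act_def, map_mul, τ.commutes]
    ring
  have act_one : ∀ m, act 1 m = m := by
    intro m; simp [act_def]
  let Ψ : CA σ h3 a →ₗ[k] E :=
    { toFun := fun d => act d 1
      map_add' := fun c d => by simp only [act_def, CA.add_x, CA.add_y, CA.add_z, map_add]; ring
      map_smul' := fun r d => by
        simp only [act_def, CA.smul_x, CA.smul_y, CA.smul_z, map_mul, j.commutes, RingHom.id_apply, Algebra.smul_def (A := E)]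
        ring }
  have Ψ_def : ∀ d, Ψ d = act d 1 := fun _ => rfl
  have act_zero : ∀ d, act d 0 = 0 := by intro d; simp [act_def]
  have hinj : Function.Injective Ψ := by
    rw [injective_iff_map_eq_zero]
    intro d hd
    by_contra h0
    obtain ⟨c, -, hc⟩ := exists_inv (k := k) d h0
    have : act (c * d) 1 = 0 := by rw [act_mul, ← Ψ_def, hd, act_zero]
    rw [hc, act_one] at this
    exact one_ne_zero this
  have hsurj : Function.Surjective Ψ :=
    (LinearMap.injective_iff_surjective_of_finrank_eq_finrank hD).mp hinj
  choose g hg using fun f : F => hsurj (algebraMap F E f)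
  refine ⟨{ toFun := g, map_one' := ?_, map_mul' := ?_, map_zero' := ?_, map_add' := ?_, commutes' := ?_ }⟩
  · apply hinj; rw [hg, Ψ_def, act_one, map_one]
  · intro f f'
    apply hinj
    rw [hg, Ψ_def, act_mul, ← Ψ_def (g f'), hg, ← mul_one (algebraMap F E f'), act_F, ← Ψ_def, hg, map_mul, mul_comm]
  · apply hinj; rw [hg, map_zero, map_zero]
  · intro f f'
    apply hinj; rw [hg, map_add, map_add, hg, hg]
  · intro r
    apply hinj
    rw [hg, ← IsScalarTower.algebraMap_apply, Algebra.algebraMap_eq_smul_one (A := CA σ h3 a), map_smul, Ψ_def, act_one, Algebra.algebraMap_eq_smul_one]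

end HN


namespace HN
set_option linter.unusedSectionVars false
open Module

section
variable {k L : Type} [Field k] [Field L] [Algebra k L] {θ : L}

lemma Cyc.sig3 (h : Cyc k L θ) (x : L) : h.sig (h.sig (h.sig x)) = x :=
  DFunLike.congr_fun h.sig_pow x

/-- the algebra attached to `a` -/
abbrev DA (h : Cyc k L θ) (a : k) : Type := CA h.sig h.sig3 a

lemma third_root {R : Type} [Ring R] {s T : R} (c3 : s * (s * s) = 1 + 2 * s - s * s)
    (hT : T ^ 3 + T ^ 2 - 2 * T - 1 = 0) :
    T * (T * (T - s) - (T - s) * (s * s - 2)) -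
      (T * (T - s) - (T - s) * (s * s - 2)) * (1 - s - s * s) = 0 := by
  have c4 : (s * s - 2) * (1 - s - s * s) = s * s + s - 2 := by
    calc (s * s - 2) * (1 - s - s * s) = 3 * (s * s) + 2 * s - 2 - s * (s * s) - s * (s * (s * s)) := by
          noncomm_ring
      _ = 3 * (s * s) + 2 * s - 2 - (1 + 2 * s - s * s) - s * (1 + 2 * s - s * s) := by rw [c3]
      _ = 2 * (s * s) - s - (2 + 1) + s * (s * s) := by noncomm_ring
      _ = 2 * (s * s) - s - (2 + 1) + (1 + 2 * s - s * s) := by rw [c3]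
      _ = s * s + s - 2 := by noncomm_ring
  calc _ = T ^ 3 - T ^ 2 * s + T * (T - s) * (1 + s) + (T - s) * ((s * s - 2) * (1 - s - s * s)) := by
          noncomm_ring
    _ = T ^ 3 + T ^ 2 - 2 * T - s * (s * s) - s * s + 2 * s := by rw [c4]; noncomm_ring
    _ = T ^ 3 + T ^ 2 - 2 * T - 1 := by rw [c3]; noncomm_ring
    _ = 0 := hT

/-- A4 -/
theorem norm_of_iso (h : Cyc k L θ) (h7 : (7 : L) ≠ 0) (a b : k) [NoZeroDivisors (DA h b)]
    (φ : DA h a ≃ₐ[k] DA h b) :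
    ∃ y : L, algebraMap k L a = y * h.sig y * h.sig (h.sig y) * algebraMap k L b := by
  have hfin := h.fin
  let i : L →ₐ[k] DA h b := CA.inc _ _ _
  let T : DA h b := φ (CA.inc _ _ _ θ)
  let U : DA h b := φ (CA.u _ _ _)
  have hT : T ^ 3 + T ^ 2 - 2 * T - 1 = 0 := by
    have := congrArg (φ.toAlgHom.comp (CA.inc h.sig h.sig3 a)) h.root
    simp only [map_sub, map_add, map_mul, map_pow, map_ofNat, map_one, map_zero] at this
    exact this
  have hUT : U * T = (T ^ 2 - 2) * U := by
    have := congrArg φ (CA.u_inc (σ := h.sig) (h3 := h.sig3) (a := a) θ)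
    rw [h.sig_th] at this
    simpa only [map_sub, map_mul, map_pow, map_ofNat] using this
  have hU : U ^ 3 = algebraMap k _ a := by
    have := congrArg φ (CA.u_cube (σ := h.sig) (h3 := h.sig3) (a := a))
    rwa [map_pow, φ.commutes] at this
  have hs1 : h.sig (θ ^ 2 - 2) = (θ ^ 2 - 2) ^ 2 - 2 := by
    rw [map_sub, map_pow, h.sig_th, map_ofNat]
  -- roots
  have key : ∃ t : L, ∃ d : DA h b, d ≠ 0 ∧ T * d = d * i t ∧ h.sig t = t ^ 2 - 2 ∧
      t ^ 3 + t ^ 2 - 2 * t - 1 = 0 := by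
    by_cases h1 : T - i θ = 0
    · refine ⟨θ, 1, one_ne_zero, ?_, h.sig_th, h.root⟩
      rw [mul_one, one_mul]; exact sub_eq_zero.mp h1
    by_cases h2 : T * (T - i θ) - (T - i θ) * i (θ ^ 2 - 2) = 0
    · exact ⟨θ ^ 2 - 2, _, h1, sub_eq_zero.mp h2, hs1, h.root2⟩
    · have hr3 : h.sig (θ ^ 2 - 2) = -1 - θ - (θ ^ 2 - 2) := by
        rw [hs1]; linear_combination (θ - 1) * h.root
      refine ⟨h.sig (θ ^ 2 - 2), _, h2, ?_, ?_, ?_⟩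
      · rw [← sub_eq_zero, hr3]
        have c1 : i (-1 - θ - (θ ^ 2 - 2)) = 1 - i θ - i θ * i θ := by
          rw [← map_mul, ← map_one i, ← map_sub, ← map_sub]; congr 1; ring
        have c2 : i (θ ^ 2 - 2) = i θ * i θ - 2 := by
          rw [map_sub, map_pow, map_ofNat, pow_two]
        have c3 : i θ * (i θ * i θ) = 1 + 2 * i θ - i θ * i θ := by
          have := congrArg i h.root
          simp only [map_sub, map_add, map_mul, map_pow, map_ofNat, map_one, map_zero] at this
          have e : i θ ^ 3 = i θ * (i θ * i θ) := by rw [pow_succ, pow_two, mul_assoc]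
          rw [← e, ← sub_eq_zero, ← this, pow_two]
          abel
        rw [c1, c2]; exact third_root c3 hT
      · rw [← h.sig_th, h.sig3, h.sig_th]
        have := h.sig3 θ
        rw [h.sig_th, hs1, map_sub, map_pow, hs1, map_ofNat] at this
        rw [hs1]; exact this.symm
      · have := congrArg h.sig h.root2
        simpa only [map_sub, map_add, map_mul, map_pow, map_ofNat, map_one, map_zero] using this
  obtain ⟨t, d, hd, hTd, hst, htr⟩ := key
  obtain ⟨e, hde, hed⟩ := exists_inv (k := k) d hd
  have heT : e * T = i t * e := by
    calc e * T = e * T * (d * e) := by rw [hde, mul_one]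
      _ = e * (T * d) * e := by noncomm_ring
      _ = (e * d) * i t * e := by rw [hTd]; noncomm_ring
      _ = i t * e := by rw [hed, one_mul]
  let V := e * U * d
  have hV : V * i t = i (h.sig t) * V := by
    calc V * i t = e * U * (d * i t) := by simp only [V, mul_assoc]
      _ = e * (U * T) * d := by rw [← hTd]; simp only [mul_assoc]
      _ = e * T * T * U * d - e * 2 * U * d := by rw [hUT]; noncomm_ring
      _ = i t * (i t) * e * U * d - 2 * e * U * d := by
        rw [heT, mul_assoc (i t) e T, heT]; noncomm_ring
      _ = i (h.sig t) * V := by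
        rw [hst, map_sub, map_pow, map_ofNat]; simp only [V]; noncomm_ring
  have hV3 : V ^ 3 = algebraMap k _ a := by
    calc V ^ 3 = e * U * (d * e) * U * (d * e) * U * d := by simp only [V]; noncomm_ring
      _ = e * U ^ 3 * d := by rw [hde]; noncomm_ring
      _ = _ := by rw [hU, ← Algebra.commutes, mul_assoc, hed, mul_one]
  -- components
  have hne1 : h.sig t ≠ t := by
    intro h1
    apply h7
    rw [← seven_of t htr, show t ^ 2 - t - 2 = 0 by rw [h1] at hst; linear_combination -hst, zero_mul]
  have hVx := congrArg CA.x hV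
  have hVz := congrArg CA.z hV
  simp [i, CA.inc_def] at hVx hVz
  have hx : V.x = 0 := by
    by_contra h0
    rw [mul_comm] at hVx
    exact hne1 (mul_right_cancel₀ h0 hVx).symm
  have hz : V.z = 0 := by
    by_contra h0
    rw [mul_comm] at hVz
    have := mul_right_cancel₀ h0 hVz
    exact hne1 (h.sig.injective this)
  have := congrArg CA.x hV3
  rw [CA.algebraMap_eq, pow_succ, pow_two] at this
  simp [hx, hz] at this
  exact ⟨V.y, by rw [← this]; ring⟩
end
end HN


namespace HN
set_option linter.unusedSectionVars false
open Module Polynomial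

lemma exists_cyc (k : Type) [Field k] (h : ∀ x : k, x ^ 3 + x ^ 2 - 2 * x - 1 ≠ 0) :
    ∃ (E : Type) (_ : Field E) (_ : Algebra k E) (θ : E), Cyc k E θ := by
  have : Fact (Irreducible (cf k)) := ⟨cf_irr h⟩
  refine ⟨AdjoinRoot (cf k), inferInstance, inferInstance, AdjoinRoot.root (cf k), ?_, h, ?_⟩
  · rw [← cf_aeval (k := k)]
    exact (AdjoinRoot.aeval_eq _).trans AdjoinRoot.mk_self
  · rw [(AdjoinRoot.powerBasis (cf_irr h).ne_zero).finrank, AdjoinRoot.powerBasis_dim, cf_natDegree]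

lemma noroot_rat (x : ℚ) : x ^ 3 + x ^ 2 - 2 * x - 1 ≠ 0 := by
  intro hx
  have hxint : IsIntegral ℤ x := by
    refine ⟨X ^ 3 + X ^ 2 - 2 * X - 1, by monicity!, ?_⟩
    simp only [eval₂_sub, eval₂_add, eval₂_mul, eval₂_X_pow, eval₂_X, eval₂_one, eval₂_ofNat]
    exact hx
  obtain ⟨n, rfl⟩ := IsIntegrallyClosed.isIntegral_iff.mp hxint
  simp only [eq_intCast] at hx
  have hn : n ^ 3 + n ^ 2 - 2 * n - 1 = 0 := by exact_mod_cast hx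
  have hd : n ∣ 1 := ⟨n ^ 2 + n - 2, by linear_combination -hn⟩
  rcases Int.isUnit_iff.mp (isUnit_of_dvd_one hd) with rfl | rfl <;> norm_num at hn

lemma exists_L : ∃ (L : Type) (_ : Field L) (_ : NumberField L) (θ : L), Cyc ℚ L θ := by
  obtain ⟨L, i1, i2, θ, h⟩ := exists_cyc ℚ noroot_rat
  have hc : CharZero L := charZero_of_injective_algebraMap (algebraMap ℚ L).injective
  obtain rfl : i2 = DivisionRing.toRatAlgebra := Subsingleton.elim _ _
  exact ⟨L, i1, { to_charZero := hc, to_finiteDimensional := h.fin }, θ, h⟩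

lemma exists_primes (N : ℕ) : ∃ p : Fin N → ℕ, (∀ i, (p i).Prime) ∧ (∀ i, p i % 7 = 2) ∧
    (∀ i, p i ≠ 2) ∧ Function.Injective p := by
  have hinf : {q : ℕ | q.Prime ∧ q % 7 = 2}.Infinite := by
    refine (Nat.infinite_setOfPred_prime_and_modEq (q := 7) (a := 2) (by norm_num) (by norm_num)).mono ?_
    exact fun q hq => ⟨hq.1, hq.2⟩
  have h2 := hinf.sdiff (Set.finite_singleton 2)
  have e := (Set.Infinite.natEmbedding _ h2)
  refine ⟨fun i => (e i : ℕ), fun i => (e i).2.1.1, fun i => (e i).2.1.2, fun i => (e i).2.2, ?_⟩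
  intro i j hij
  exact Fin.ext (e.injective (Subtype.ext hij))

section
variable {L : Type} [Field L] [NumberField L] {θ : L} {N : ℕ} {p : Fin N → ℕ}

lemma galL (h : Cyc ℚ L θ) : IsGalois ℚ L := h.galois (by norm_num)

lemma odd_prod (hp : ∀ i, (p i).Prime) (h2 : ∀ i, p i ≠ 2) (i : Fin N) : ¬ 2 ∣ (∏ k, p k) * p i := by
  have h0 : ∀ k, ¬ 2 ∣ p k := fun k hk => h2 k ((Nat.prime_dvd_prime_iff_eq Nat.prime_two (hp k)).mp hk).symm
  rw [Nat.prime_two.dvd_mul, Nat.prime_two.prime.dvd_finsetProd_iff]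
  rintro (⟨k, -, hk⟩ | hk)
  exacts [h0 _ hk, h0 _ hk]

lemma noZ (h : Cyc ℚ L θ) (hp : ∀ i, (p i).Prime) (h2 : ∀ i, p i ≠ 2) (i : Fin N) :
    NoZeroDivisors (DA h (Aval p i : ℚ)) := by
  have := galL h
  obtain ⟨w, hw, h21, hn⟩ := exists_val h 2 Nat.prime_two (by norm_num)
  refine CA.noZeroDiv hw ?_
  have := hn _ (odd_prod hp h2 i)
  rw [map_natCast, Aval, mul_assoc, Nat.cast_mul, map_mul, this, mul_one, h21]

lemma cenL (h : Cyc ℚ L θ) (a : ℚ) : Subalgebra.center ℚ (DA h a) = ⊥ := by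
  have := galL h
  have h7 : (7 : L) ≠ 0 := by norm_num
  have h1 : h.sig θ ≠ θ := by
    intro h1
    refine h.sig_ne h7 ?_
    ext x
    have : (h.sig : L →ₐ[ℚ] L) = AlgHom.id ℚ L := h.ext h1
    exact DFunLike.congr_fun this x
  refine CA.center_eq (θ := θ) h1 ?_ ?_
  · intro h2
    have h3 := h.sig3 θ
    rw [h2] at h3
    exact h1 h3
  · intro l hl
    rw [IsGalois.mem_range_algebraMap_iff_fixed]
    intro f
    obtain ⟨n, rfl⟩ := h.zpow h7 f
    have : h.sig ∈ MulAction.stabilizer Gal(L/ℚ) l := hl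
    exact Subgroup.zpow_mem _ this n

lemma noIso (h : Cyc ℚ L θ) (hp : ∀ i, (p i).Prime) (h7 : ∀ i, p i % 7 = 2) (h2 : ∀ i, p i ≠ 2)
    (hinj : Function.Injective p) {i j : Fin N} (hij : i ≠ j) :
    IsEmpty (DA h (Aval p i : ℚ) ≃ₐ[ℚ] DA h (Aval p j : ℚ)) := by
  have := galL h
  have := noZ h hp h2 j
  refine ⟨fun φ => ?_⟩
  obtain ⟨y, hy⟩ := norm_of_iso h (by norm_num) _ _ φ
  obtain ⟨w, hw, h21, hn⟩ := exists_val h (p i) (hp i) (h7 i)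
  have hA : ∀ j, ((Aval p j : ℕ) : L) = (2 : ℕ) * ((p i : L) * ((∏ k ∈ Finset.univ.erase i, p k : ℕ) : L)) * p j := by
    intro j
    rw [Aval, ← Finset.mul_prod_erase _ _ (Finset.mem_univ i)]
    push_cast; ring
  have hne : ∀ k, k ≠ i → ¬ p i ∣ p k := fun k hk hd =>
    hk (hinj ((Nat.prime_dvd_prime_iff_eq (hp i) (hp k)).mp hd).symm)
  have w2 : w ((2 : ℕ) : L) = 1 := hn 2 fun hd =>
    h2 i ((Nat.prime_dvd_prime_iff_eq (hp i) Nat.prime_two).mp hd)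
  have wP : w ((∏ k ∈ Finset.univ.erase i, p k : ℕ) : L) = 1 := hn _ fun hd => by
    obtain ⟨k, hk, hk'⟩ := (Prime.dvd_finsetProd_iff (hp i).prime _).mp hd
    exact hne k (Finset.ne_of_mem_erase hk) hk'
  have wj : w (p j : L) = 1 := hn _ (hne j hij.symm)
  rw [map_natCast, map_natCast, hA i, hA j] at hy
  have := congrArg w hy
  simp only [map_mul, hw, w2, wP, wj, h21, one_mul, mul_one] at this
  have hy0 : w y ≠ 0 := by
    intro h0; rw [h0] at this; simp at this
  obtain ⟨m, hm⟩ : ∃ m : ℤ, w y = WithZero.exp m := ⟨WithZero.log (w y), (WithZero.exp_log hy0).symm⟩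
  rw [hm, ← WithZero.exp_add, ← WithZero.exp_add, ← WithZero.exp_add, ← WithZero.exp_add, WithZero.exp_inj] at this
  omega

/-- one direction -/
lemma transfer (h : Cyc ℚ L θ) (hp : ∀ i, (p i).Prime) (h7 : ∀ i, p i % 7 = 2) (h2 : ∀ i, p i ≠ 2)
    (hinj : Function.Injective p) (F : Type) [Field F] [NumberField F] (hF : finrank ℚ F = 3) (i j : Fin N)
    (ι : F →ₐ[ℚ] DA h (Aval p i : ℚ)) : Nonempty (F →ₐ[ℚ] DA h (Aval p j : ℚ)) := by
  have hfin := h.fin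
  by_cases hr : ∃ x : F, x ^ 3 + x ^ 2 - 2 * x - 1 = 0
  · obtain ⟨x, hx⟩ := hr
    let g : L →ₐ[ℚ] F := h.pb.lift x (by rw [h.pb_gen, h.minpoly_eq, cf_aeval, hx])
    have hb : Function.Bijective g := by
      refine ⟨g.toRingHom.injective, ?_⟩
      exact (LinearMap.injective_iff_surjective_of_finrank_eq_finrank (f := g.toLinearMap)
        (by rw [h.fr, hF])).mp g.toRingHom.injective
    exact ⟨(CA.inc _ _ _).comp (AlgEquiv.ofBijective g hb).symm.toAlgHom⟩
  · push Not at hr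
    obtain ⟨E, i1, i2, ϑ, hE⟩ := exists_cyc F hr
    have hfE := hE.fin
    have hc : CharZero E := charZero_of_injective_algebraMap (algebraMap F E).injective
    have hfQ : FiniteDimensional ℚ E := FiniteDimensional.trans ℚ F E
    have : NumberField E := { to_charZero := hc, to_finiteDimensional := hfQ }
    have h9 : finrank ℚ E = 9 := by rw [← finrank_mul_finrank ℚ F E, hF, hE.fr]
    have hg : IsGalois F E := hE.galois (by norm_num)
    have hT : (CA.inc h.sig h.sig3 (Aval p i : ℚ) θ) ^ 3 + (CA.inc h.sig h.sig3 (Aval p i : ℚ) θ) ^ 2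
        - 2 * (CA.inc h.sig h.sig3 (Aval p i : ℚ) θ) - 1 = 0 := by
      have := congrArg (CA.inc h.sig h.sig3 (Aval p i : ℚ)) h.root
      simpa only [map_sub, map_add, map_mul, map_pow, map_ofNat, map_one, map_zero] using this
    have hu := CA.u_inc (σ := h.sig) (h3 := h.sig3) (a := (Aval p i : ℚ)) θ
    rw [h.sig_th, map_sub, map_pow, map_ofNat] at hu
    obtain ⟨e, he⟩ := embed_norm hE hF (CA.finrank_eq h.fr) _ _ hT hu _ CA.u_cube ι
    rw [map_natCast, map_natCast] at he
    obtain ⟨e', he'⟩ := norm_transfer hE h9 hp h7 h2 hinj i j e he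
    have := noZ h hp h2 j
    let g : L →ₐ[ℚ] E := h.pb.lift ϑ (by rw [h.pb_gen, h.minpoly_eq, cf_aeval, hE.root])
    have hgθ : g θ = ϑ := by
      have := h.pb.lift_gen ϑ (by rw [h.pb_gen, h.minpoly_eq, cf_aeval, hE.root])
      exact (congrArg g h.pb_gen).symm.trans this
    refine norm_embed h.sig h.sig3 _ hE.sig g ?_ ?_ e' hE.sig3 ?_
    · intro l
      have : g.comp (h.sig : L →ₐ[ℚ] L) = ((hE.sig : E →ₐ[F] E).restrictScalars ℚ).comp g := by
        apply h.ext
        change g (h.sig θ) = hE.sig (g θ)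
        rw [h.sig_th, map_sub, map_pow, hgθ, hE.sig_th, map_ofNat]
      exact DFunLike.congr_fun this l
    · rw [h9]; exact CA.finrank_eq h.fr
    · rw [map_natCast]; exact he'
end
end HN


namespace HN
/-- the division algebras -/
noncomputable def DD {L : Type} [Field L] [NumberField L] {θ : L} {N : ℕ} {p : Fin N → ℕ}
    (h : Cyc ℚ L θ) (hp : ∀ i, (p i).Prime) (h2 : ∀ i, p i ≠ 2) (i : Fin N) : CentralDivAlg ℚ 3 :=
  have hz : NoZeroDivisors (DA h (Aval p i : ℚ)) := noZ h hp h2 i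
  have hd : IsDomain (DA h (Aval p i : ℚ)) := NoZeroDivisors.to_isDomain _
  have hf : FiniteDimensional ℚ L := h.fin
  { carrier := DA h (Aval p i : ℚ)
    divisionRing := divisionRingOfFiniteDimensional ℚ (DA h (Aval p i : ℚ))
    algebra := inferInstanceAs (Algebra ℚ (DA h (Aval p i : ℚ)))
    findim := inferInstanceAs (FiniteDimensional ℚ (DA h (Aval p i : ℚ)))
    central := cenL h _
    degree_eq := CA.finrank_eq h.fr }
end HN

/-- for every `N` there exist `N` pairwise non-isomorphic central division
algebras of degree 3 over `ℚ` that all have the same maximal subfields: a cubic field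
extension of `ℚ` embeds into one of them iff it embeds into any other. -/
theorem exists_arbitrarily_many_cubic_division_algebras_with_same_maximal_subfields
    (N : ℕ) :
    ∃ D : Fin N → CentralDivAlg ℚ 3,
      (∀ i j : Fin N, i ≠ j → IsEmpty ((D i).carrier ≃ₐ[ℚ] (D j).carrier)) ∧
      (∀ (F : Type) [Field F] [Algebra ℚ F], Module.finrank ℚ F = 3 →
        ∀ i j : Fin N,
          (Nonempty (F →ₐ[ℚ] (D i).carrier) ↔ Nonempty (F →ₐ[ℚ] (D j).carrier))) := by
  obtain ⟨L, i1, i2, θ, h⟩ := HN.exists_L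
  obtain ⟨p, hp, h7, h2, hinj⟩ := HN.exists_primes N
  refine ⟨fun i => HN.DD h hp h2 i, ?_, ?_⟩
  · intro i j hij
    exact HN.noIso h hp h7 h2 hinj hij
  · intro F _ iA hF i j
    have hc : CharZero F := charZero_of_injective_algebraMap (algebraMap ℚ F).injective
    obtain rfl : iA = DivisionRing.toRatAlgebra := Subsingleton.elim _ _
    have hfd : FiniteDimensional ℚ F := Module.finite_of_finrank_pos (by omega)
    have : NumberField F := { to_charZero := hc, to_finiteDimensional := hfd }
    exact ⟨fun ⟨f⟩ => HN.transfer h hp h7 h2 hinj F hF i j f,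
      fun ⟨f⟩ => HN.transfer h hp h7 h2 hinj F hF j i f⟩
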